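/- Let p₁(·), p₂(·) : ℝⁿ → [1,∞) be measurable exponent functions with 1 < (pⱼ)₋ ≤ (pⱼ)₊ < ∞ and pⱼ(·) ∈ LH for j = 1,2, define p(·) by 1/p(x) = 1/p₁(x) + 1/p₂(x), and let w₁, w₂ be weights with w = w₁w₂. Then the bilinear maximal operator satisfies the weighted bound ‖M(f₁,f₂)w‖_{p(·)} ≤ C‖f₁w₁‖_{p₁(·)}‖f₂w₂‖_{p₂(·)} for all f₁ ∈ L^{p₁(·)}(w₁) and f₂ ∈ L^{p₂(·)}(w₂) if and only if the triple (w₁,w₂,w) belongs to A_{p⃗(·)}. -/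

import Mathlib

open MeasureTheory ENNReal Set

noncomputable section

/-- Euclidean space `ℝⁿ`. -/
abbrev Rn (n : ℕ) : Type := Fin n → ℝ

/-- A cube in `ℝⁿ` with sides parallel to the coordinate axes. -/
structure Cube (n : ℕ) : Type where
  base : Fin n → ℝ
  side : ℝ
  side_pos : 0 < side

namespace Cube

/-- The set of points of a cube. -/
def toSet {n : ℕ} (Q : Cube n) : Set (Rn n) :=
  {x | ∀ i, Q.base i ≤ x i ∧ x i < Q.base i + Q.side}

/-- The volume `|Q|` of a cube. -/
def vol {n : ℕ} (Q : Cube n) : ℝ≥0∞ := ENNReal.ofReal (Q.side ^ n)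

/-- Membership in the standard dyadic grid `𝒟₀`. -/
def IsDyadic {n : ℕ} (Q : Cube n) : Prop :=
  ∃ (k : ℤ) (j : Fin n → ℤ), Q.side = (2 : ℝ) ^ (-k) ∧
    ∀ i, Q.base i = (2 : ℝ) ^ (-k) * (j i : ℝ)

end Cube

/-- The modular associated to an extended-real-valued exponent `r(·)`:
`ρ(f/λ) = ∫_{r ≠ ∞} (f/λ)^{r(x)} dμ + ‖f/λ‖_{L^∞({r = ∞})}`. -/
def eModular {n : ℕ} (r : Rn n → ℝ≥0∞) (μ : Measure (Rn n)) (f : Rn n → ℝ≥0∞)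
    (lam : ℝ≥0∞) : ℝ≥0∞ :=
  (∫⁻ x in {x | r x ≠ ∞}, (f x / lam) ^ (r x).toReal ∂μ)
    + essSup (fun x => f x / lam) (μ.restrict {x | r x = ∞})

/-- The variable Lebesgue (quasi)norm `‖f‖_{r(·)}` with respect to a measure `μ`. -/
def eNorm {n : ℕ} (r : Rn n → ℝ≥0∞) (μ : Measure (Rn n)) (f : Rn n → ℝ≥0∞) : ℝ≥0∞ :=
  sInf {lam : ℝ≥0∞ | lam ≠ 0 ∧ eModular r μ f lam ≤ 1}

/-- The variable Lebesgue norm of a real-valued function with respect to Lebesgue measure. -/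
def vNorm {n : ℕ} (r : Rn n → ℝ≥0∞) (f : Rn n → ℝ) : ℝ≥0∞ :=
  eNorm r volume fun x => ENNReal.ofReal |f x|

/-- View a real-valued exponent as an extended-real-valued one. -/
def ofExp {n : ℕ} (p : Rn n → ℝ) : Rn n → ℝ≥0∞ := fun x => ENNReal.ofReal (p x)

/-- The conjugate of an extended real exponent: `1/t + 1/t' = 1`. -/
def econj (t : ℝ≥0∞) : ℝ≥0∞ :=
  if t = 1 then ∞ else if t = ∞ then 1 else ENNReal.ofReal (t.toReal / (t.toReal - 1))

/-- The pointwise conjugate exponent `p'(·)` of a real-valued exponent. -/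
def conjExp {n : ℕ} (p : Rn n → ℝ) : Rn n → ℝ≥0∞ := fun x => econj (ENNReal.ofReal (p x))

/-- A weight: a measurable function that is positive (and finite) a.e. -/
def IsWeight {n : ℕ} (w : Rn n → ℝ) : Prop :=
  Measurable w ∧ ∀ᵐ x ∂(volume : Measure (Rn n)), 0 < w x

/-- Local log-Hölder continuity `LH₀`. -/
def LH0 {n : ℕ} (p : Rn n → ℝ) : Prop :=
  ∃ C₀ > 0, ∀ x y : Rn n, dist x y < 1 / 2 →
    |1 / p x - 1 / p y| ≤ C₀ / (-Real.log (dist x y))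

/-- Log-Hölder continuity at infinity with a given asymptotic value `pinf`. -/
def LHinfWith {n : ℕ} (p : Rn n → ℝ) (pinf : ℝ) : Prop :=
  ∃ C > 0, ∀ x : Rn n, |1 / p x - 1 / pinf| ≤ C / Real.log (Real.exp 1 + ‖x‖)

/-- Log-Hölder continuity at infinity `LH∞`. -/
def LHinf {n : ℕ} (p : Rn n → ℝ) : Prop := ∃ pinf > 0, LHinfWith p pinf

/-- Log-Hölder continuity `LH = LH₀ ∩ LH∞`. -/
def LH {n : ℕ} (p : Rn n → ℝ) : Prop := LH0 p ∧ LHinf p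

/-- The bilinear variable Muckenhoupt condition `(w₁,w₂,w) ∈ A_{p⃗(·)}`. -/
def ApVec {n : ℕ} (p₁ p₂ p w₁ w₂ w : Rn n → ℝ) : Prop :=
  ∃ C : ℝ≥0∞, C ≠ ∞ ∧ ∀ Q : Cube n,
    Q.vol⁻¹ ^ 2 * vNorm (ofExp p) (Q.toSet.indicator w) *
      vNorm (conjExp p₁) (Q.toSet.indicator fun x => (w₁ x)⁻¹) *
      vNorm (conjExp p₂) (Q.toSet.indicator fun x => (w₂ x)⁻¹) ≤ C

/-- The variable Muckenhoupt class `A_{r(·)}` for an extended-real-valued exponent. -/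
def ApVarE {n : ℕ} (r : Rn n → ℝ≥0∞) (v : Rn n → ℝ) : Prop :=
  ∃ C : ℝ≥0∞, C ≠ ∞ ∧ ∀ Q : Cube n,
    Q.vol⁻¹ * vNorm r (Q.toSet.indicator v) *
      vNorm (fun x => econj (r x)) (Q.toSet.indicator fun x => (v x)⁻¹) ≤ C

/-- The bilinear maximal operator `M(f₁,f₂)`. -/
def biMax {n : ℕ} (f₁ f₂ : Rn n → ℝ) (x : Rn n) : ℝ≥0∞ :=
  ⨆ (Q : Cube n) (_ : x ∈ Q.toSet),
    (Q.vol⁻¹ * ∫⁻ y in Q.toSet, ENNReal.ofReal |f₁ y|) *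
      (Q.vol⁻¹ * ∫⁻ y in Q.toSet, ENNReal.ofReal |f₂ y|)

/-- The dyadic bilinear maximal operator `M^d(f₁,f₂)`. -/
def biMaxD {n : ℕ} (f₁ f₂ : Rn n → ℝ) (x : Rn n) : ℝ≥0∞ :=
  ⨆ (Q : Cube n) (_ : Q.IsDyadic) (_ : x ∈ Q.toSet),
    (Q.vol⁻¹ * ∫⁻ y in Q.toSet, ENNReal.ofReal |f₁ y|) *
      (Q.vol⁻¹ * ∫⁻ y in Q.toSet, ENNReal.ofReal |f₂ y|)

/-- The bilinear averaging operator `A_Q(f₁,f₂) = (⨍_Q f₁)(⨍_Q f₂)χ_Q`. -/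
def avgOp {n : ℕ} (Q : Cube n) (f₁ f₂ : Rn n → ℝ) (x : Rn n) : ℝ≥0∞ :=
  Q.toSet.indicator
    (fun _ =>
      (Q.vol⁻¹ * ∫⁻ y in Q.toSet, ENNReal.ofReal |f₁ y|) *
        (Q.vol⁻¹ * ∫⁻ y in Q.toSet, ENNReal.ofReal |f₂ y|)) x

/-- `(p)₋(Q)`, the essential infimum of `p` on a cube `Q`. -/
def pMinusOn {n : ℕ} (p : Rn n → ℝ) (Q : Cube n) : ℝ :=
  essInf p (volume.restrict Q.toSet)

/-- The exponent `q(Q)` with `1/q(Q) = 1/(p₁)₋(Q) + 1/(p₂)₋(Q)`. -/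
def qExp {n : ℕ} (p₁ p₂ : Rn n → ℝ) (Q : Cube n) : ℝ :=
  ((pMinusOn p₁ Q)⁻¹ + (pMinusOn p₂ Q)⁻¹)⁻¹

namespace BilinearMaximal

variable {n : ℕ}

lemma toSet_eq_pi (Q : Cube n) :
    Q.toSet = Set.pi univ fun i => Ico (Q.base i) (Q.base i + Q.side) := by
  ext x; simp [Cube.toSet]

lemma measurableSet_toSet (Q : Cube n) : MeasurableSet Q.toSet := by
  rw [toSet_eq_pi]
  exact MeasurableSet.univ_pi fun i => measurableSet_Ico

lemma volume_toSet (Q : Cube n) : volume Q.toSet = Q.vol := by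
  rw [toSet_eq_pi, Real.volume_pi_Ico]
  simp [Cube.vol, ENNReal.ofReal_pow Q.side_pos.le]

lemma vol_ne_zero (Q : Cube n) : Q.vol ≠ 0 := by
  simpa [Cube.vol] using pow_pos Q.side_pos n

lemma vol_ne_top (Q : Cube n) : Q.vol ≠ ∞ := ENNReal.ofReal_ne_top

lemma base_mem (Q : Cube n) : Q.base ∈ Q.toSet := fun i => ⟨le_rfl, by linarith [Q.side_pos]⟩

lemma dist_lt_of_mem {Q : Cube n} {x : Rn n} (hx : x ∈ Q.toSet) : dist x Q.base < Q.side := by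
  rw [dist_pi_lt_iff Q.side_pos]
  intro i
  rw [Real.dist_eq, abs_lt]
  constructor <;> linarith [(hx i).1, (hx i).2, Q.side_pos]

/-- A system of nested partitions of `ℝⁿ` into cubes; the level increases with the size. -/
structure Grid (n : ℕ) where
  /-- The cube of level `k` containing `x`. -/
  cell : ℤ → Rn n → Cube n
  mem : ∀ k x, x ∈ (cell k x).toSet
  nested : ∀ k l x y, k ≤ l → y ∈ (cell k x).toSet → cell l y = cell l x
  countable : ∀ k, (range (cell k)).Countable

/-- The offset of the grid shifted by thirds. -/
def thirdOffset (τ : Fin n → Bool) (k : ℤ) (i : Fin n) : ℝ :=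
  (if τ i then 1 else 0) * ((2 : ℝ) ^ k * ((-1 : ℝ) ^ k / 3))

lemma thirdOffset_succ (τ : Fin n → Bool) (k : ℤ) (i : Fin n) :
    ∃ a : ℤ, thirdOffset τ (k + 1) i = thirdOffset τ k i + 2 ^ k * (a : ℝ) := by
  rcases Int.even_or_odd k with hk | hk
  · refine ⟨if τ i then -1 else 0, ?_⟩
    have : ((-1 : ℝ)) ^ k = 1 := hk.neg_one_zpow
    unfold thirdOffset
    rw [zpow_add₀ (by norm_num), zpow_add₀ (by norm_num), this]
    split_ifs <;> push_cast <;> ring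
  · refine ⟨if τ i then 1 else 0, ?_⟩
    have : ((-1 : ℝ)) ^ k = -1 := hk.neg_one_zpow
    unfold thirdOffset
    rw [zpow_add₀ (by norm_num), zpow_add₀ (by norm_num), this]
    split_ifs <;> push_cast <;> ring

/-- The cube with a given index in the grid shifted by thirds. -/
def thirdCube (τ : Fin n → Bool) (k : ℤ) (m : Fin n → ℤ) : Cube n where
  base i := 2 ^ k * (m i : ℝ) + thirdOffset τ k i
  side := 2 ^ k
  side_pos := by positivity

/-- The index of the cube containing a point. -/
def thirdIndex (τ : Fin n → Bool) (k : ℤ) (x : Rn n) (i : Fin n) : ℤ :=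
  ⌊(x i - thirdOffset τ k i) / 2 ^ k⌋

lemma mem_thirdCube {τ : Fin n → Bool} {k : ℤ} {m : Fin n → ℤ} {x : Rn n} :
    x ∈ (thirdCube τ k m).toSet ↔ thirdIndex τ k x = m := by
  have h2 : (0 : ℝ) < 2 ^ k := by positivity
  simp only [Cube.toSet, thirdCube, mem_ofPred_eq, funext_iff, thirdIndex, Int.floor_eq_iff]
  refine forall_congr' fun i => ?_
  rw [le_div_iff₀ h2, div_lt_iff₀ h2]
  constructor <;> rintro ⟨h, h'⟩ <;> constructor <;> nlinarith

lemma thirdIndex_succ {τ : Fin n → Bool} {k : ℤ} {x y : Rn n}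
    (h : thirdIndex τ k x = thirdIndex τ k y) :
    thirdIndex τ (k + 1) x = thirdIndex τ (k + 1) y := by
  funext i
  obtain ⟨a, ha⟩ := thirdOffset_succ τ k i
  have key : ∀ z : Rn n, thirdIndex τ (k + 1) z i = (thirdIndex τ k z i - a) / 2 := by
    intro z
    have h2 : (2 : ℝ) ^ k ≠ 0 := by positivity
    have e : (z i - thirdOffset τ (k + 1) i) / 2 ^ (k + 1)
        = ((z i - thirdOffset τ k i) / 2 ^ k - (a : ℝ)) / ((2 : ℕ) : ℝ) := by
      rw [ha, zpow_add₀ (by norm_num)]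
      field_simp
      norm_num
      ring
    unfold thirdIndex
    rw [e, Int.floor_div_natCast, Int.floor_sub_intCast]
    rfl
  rw [key x, key y, h]

/-- The dyadic grid shifted by thirds in the directions selected by `τ`. -/
def thirdGrid (τ : Fin n → Bool) : Grid n where
  cell k x := thirdCube τ k (thirdIndex τ k x)
  mem k x := mem_thirdCube.2 rfl
  nested k l x y hkl hy := by
    have h0 : thirdIndex τ k y = thirdIndex τ k x := mem_thirdCube.1 hy
    have : thirdIndex τ l y = thirdIndex τ l x :=
      Int.leInduction (motive := fun l _ => thirdIndex τ l y = thirdIndex τ l x) h0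
        (fun l _ ih => thirdIndex_succ ih) l hkl
    rw [this]
  countable k := (countable_range (thirdCube τ k)).mono (by rintro _ ⟨x, rfl⟩; exact ⟨_, rfl⟩)

lemma thirdGrid_side (τ : Fin n → Bool) (k : ℤ) (x : Rn n) :
    ((thirdGrid τ).cell k x).side = 2 ^ k := rfl

lemma exists_floor_const (ε : ℝ) (hε : ε = 1 ∨ ε = -1) (β : ℝ) :
    ∃ t : Bool, ∀ v ∈ Ico β (β + 1 / 3), ∀ v' ∈ Ico β (β + 1 / 3),
      ⌊v - (if t then 1 else 0) * (ε / 3)⌋ = ⌊v' - (if t then 1 else 0) * (ε / 3)⌋ := by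
  have hβ1 := Int.floor_le β
  have hβ2 := Int.lt_floor_add_one β
  by_cases h : β + 1 / 3 ≤ ⌊β⌋ + 1
  · refine ⟨false, fun v hv v' hv' => ?_⟩
    have : ∀ v ∈ Ico β (β + 1 / 3), ⌊v - (if false then 1 else 0) * (ε / 3)⌋ = ⌊β⌋ := by
      intro v hv
      rw [Int.floor_eq_iff]
      constructor <;> simp <;> linarith [hv.1, hv.2]
    simpa using (this v hv).trans (this v' hv').symm
  · push Not at h
    refine ⟨true, fun v hv v' hv' => ?_⟩
    rcases hε with rfl | rfl
    · have : ∀ v ∈ Ico β (β + 1 / 3), ⌊v - (if true then 1 else 0) * ((1:ℝ) / 3)⌋ = ⌊β⌋ := by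
        intro v hv
        rw [Int.floor_eq_iff]
        constructor <;> simp <;> linarith [hv.1, hv.2]
      simpa using (this v hv).trans (this v' hv').symm
    · have : ∀ v ∈ Ico β (β + 1 / 3),
          ⌊v - (if true then 1 else 0) * ((-1:ℝ) / 3)⌋ = ⌊β⌋ + 1 := by
        intro v hv
        rw [Int.floor_eq_iff]
        constructor <;> simp <;> linarith [hv.1, hv.2]
      simpa using (this v hv).trans (this v' hv').symm

/-- Every cube is contained in a comparable cube of one of the grids shifted by thirds. -/
lemma exists_thirdGrid_cell (Q : Cube n) :
    ∃ (τ : Fin n → Bool) (k : ℤ), (2 : ℝ) ^ k ≤ 6 * Q.side ∧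
      ∀ x ∈ Q.toSet, Q.toSet ⊆ ((thirdGrid τ).cell k x).toSet := by
  obtain ⟨k, hk1, hk2⟩ := exists_mem_Ioc_zpow (x := 3 * Q.side) (y := (2:ℝ))
    (by linarith [Q.side_pos]) (by norm_num)
  have h2 : (0 : ℝ) < 2 ^ (k + 1) := by positivity
  have hε : ((-1 : ℝ)) ^ (k + 1) = 1 ∨ ((-1 : ℝ)) ^ (k + 1) = -1 := by
    rcases Int.even_or_odd (k + 1) with h | h
    · exact Or.inl h.neg_one_zpow
    · exact Or.inr h.neg_one_zpow
  choose τ hτ using fun i => exists_floor_const _ hε (Q.base i / 2 ^ (k + 1))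
  refine ⟨τ, k + 1, ?_, fun x hx y hy => ?_⟩
  · rw [zpow_add₀ (by norm_num)]; norm_num; linarith
  · refine mem_thirdCube.2 (funext fun i => ?_)
    have hmem : ∀ z ∈ Q.toSet,
        z i / 2 ^ (k + 1) ∈ Ico (Q.base i / 2 ^ (k + 1)) (Q.base i / 2 ^ (k + 1) + 1 / 3) := by
      intro z hz
      constructor
      · exact div_le_div_of_nonneg_right (hz i).1 h2.le
      · rw [div_add' _ _ _ h2.ne']
        apply div_lt_div_of_pos_right _ h2
        linarith [(hz i).2]
    have := hτ i _ (hmem y hy) _ (hmem x hx)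
    have e : ∀ z : Rn n, (z i - thirdOffset τ (k + 1) i) / 2 ^ (k + 1)
        = z i / 2 ^ (k + 1) - (if τ i then 1 else 0) * ((-1 : ℝ) ^ (k + 1) / 3) := by
      intro z
      unfold thirdOffset
      field_simp
    unfold thirdIndex
    rw [e, e]
    exact this

/-- The maximal cubes with property `P` among the cubes of a grid with levels in `J`. -/
def maxCubes (G : Grid n) (J : Finset ℤ) (P : Cube n → Prop) : Set (Cube n) :=
  {Q | P Q ∧ ∃ x, ∃ j ∈ J, Q = G.cell j x ∧ ∀ l ∈ J, j < l → ¬ P (G.cell l x)}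

section stopping

variable {G : Grid n} {J : Finset ℤ} {P : Cube n → Prop}

lemma Grid.cell_subset (G : Grid n) {j l : ℤ} (h : j ≤ l) (x : Rn n) :
    (G.cell j x).toSet ⊆ (G.cell l x).toSet := by
  intro y hy
  rw [← G.nested j l x y h hy]
  exact G.mem l y

lemma Grid.cell_eq (G : Grid n) {j : ℤ} {x y : Rn n} (h : y ∈ (G.cell j x).toSet) :
    G.cell j y = G.cell j x := G.nested j j x y le_rfl h

lemma countable_maxCubes : (maxCubes G J P).Countable := by
  refine (countable_iUnion fun j => G.countable j).mono ?_
  rintro Q ⟨-, x, j, -, rfl, -⟩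
  exact mem_iUnion.2 ⟨j, x, rfl⟩

lemma maxCubes_cases {Q : Cube n} (hQ : Q ∈ maxCubes G J P) {z : Rn n} (hz : z ∈ Q.toSet) :
    ∃ j ∈ J, Q = G.cell j z ∧ ∀ l ∈ J, j < l → ¬ P (G.cell l z) := by
  obtain ⟨-, x, j, hj, rfl, h⟩ := hQ
  refine ⟨j, hj, (G.cell_eq hz).symm, fun l hl hjl => ?_⟩
  rw [G.nested j l x z hjl.le hz]
  exact h l hl hjl

lemma maxCubes_eq {Q Q' : Cube n} (hQ : Q ∈ maxCubes G J P) (hQ' : Q' ∈ maxCubes G J P)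
    {z : Rn n} (hz : z ∈ Q.toSet) (hz' : z ∈ Q'.toSet) : Q = Q' := by
  obtain ⟨j, hj, rfl, h⟩ := maxCubes_cases hQ hz
  obtain ⟨j', hj', rfl, h'⟩ := maxCubes_cases hQ' hz'
  rcases lt_trichotomy j j' with hlt | rfl | hlt
  · exact absurd hQ'.1 (h j' hj' hlt)
  · rfl
  · exact absurd hQ.1 (h' j hj hlt)

lemma pairwiseDisjoint_maxCubes : (maxCubes G J P).PairwiseDisjoint Cube.toSet := by
  intro Q hQ Q' hQ' hne
  rw [Function.onFun, Set.disjoint_left]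
  exact fun z hz hz' => hne (maxCubes_eq hQ hQ' hz hz')

lemma exists_maxCube {x : Rn n} {j : ℤ} (hj : j ∈ J) (hP : P (G.cell j x)) :
    ∃ Q ∈ maxCubes G J P, x ∈ Q.toSet ∧ (G.cell j x).toSet ⊆ Q.toSet := by
  classical
  obtain ⟨l, hl, hmax⟩ := Finset.exists_max_image (J.filter fun l => P (G.cell l x)) id
    ⟨j, Finset.mem_filter.2 ⟨hj, hP⟩⟩
  rw [Finset.mem_filter] at hl
  refine ⟨G.cell l x, ⟨hl.2, x, l, hl.1, rfl, fun m hm hlm hPm => ?_⟩, G.mem l x,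
    G.cell_subset (hmax j (Finset.mem_filter.2 ⟨hj, hP⟩)) x⟩
  exact absurd (hmax m (Finset.mem_filter.2 ⟨hm, hPm⟩)) (not_le.2 hlm)

lemma cell_subset_maxCube {Q : Cube n} (hQ : Q ∈ maxCubes G J P) {x : Rn n}
    (hx : x ∈ Q.toSet) {j : ℤ} (hj : j ∈ J) (hP : P (G.cell j x)) :
    (G.cell j x).toSet ⊆ Q.toSet := by
  obtain ⟨Q', hQ', hx', hs⟩ := exists_maxCube hj hP
  rwa [maxCubes_eq hQ hQ' hx hx']

/-- The maximum of `T` over the cubes of a grid that contain `x` and have levels in `J`. -/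
def gridSup (G : Grid n) (J : Finset ℤ) (T : Cube n → ℝ≥0∞) (x : Rn n) : ℝ≥0∞ :=
  J.sup fun j => T (G.cell j x)

lemma lt_gridSup {T : Cube n → ℝ≥0∞} {a : ℝ≥0∞} {x : Rn n} :
    a < gridSup G J T x ↔ ∃ j ∈ J, a < T (G.cell j x) := Finset.lt_sup_iff

lemma le_gridSup {T : Cube n → ℝ≥0∞} {Q : Cube n} (hQ : Q ∈ maxCubes G J P) {x : Rn n}
    (hx : x ∈ Q.toSet) : T Q ≤ gridSup G J T x := by
  obtain ⟨j, hj, rfl, -⟩ := maxCubes_cases hQ hx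
  exact Finset.le_sup (f := fun j => T (G.cell j x)) hj

lemma gridSup_lt_top {T : Cube n → ℝ≥0∞} (hT : ∀ Q, T Q < ∞) (x : Rn n) :
    gridSup G J T x < ∞ := by
  rw [gridSup, Finset.sup_lt_iff (by simp)]
  exact fun j _ => hT _

lemma measurable_comp_cell (G : Grid n) (T : Cube n → ℝ≥0∞) (j : ℤ) :
    Measurable fun x => T (G.cell j x) := by
  intro s _
  have : (fun x => T (G.cell j x)) ⁻¹' s
      = ⋃ Q ∈ range (G.cell j) ∩ T ⁻¹' s, Q.toSet := by
    ext x
    simp only [mem_preimage, mem_iUnion, exists_prop, mem_inter_iff, mem_range]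
    constructor
    · exact fun h => ⟨_, ⟨⟨x, rfl⟩, h⟩, G.mem j x⟩
    · rintro ⟨_, ⟨⟨y, rfl⟩, h⟩, hx⟩
      rwa [G.cell_eq hx]
  rw [this]
  exact MeasurableSet.biUnion ((G.countable j).mono inter_subset_left)
    fun Q _ => measurableSet_toSet Q

lemma measurable_gridSup (G : Grid n) (J : Finset ℤ) (T : Cube n → ℝ≥0∞) :
    Measurable (gridSup G J T) := by
  have : gridSup G J T = J.sup fun j x => T (G.cell j x) := by
    ext x; simp [gridSup]
  rw [this]
  exact Finset.sup_induction (p := Measurable) measurable_const (fun _ h _ h' => h.sup h')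
    fun j _ => measurable_comp_cell G T j

lemma setOf_lt_gridSup (T : Cube n → ℝ≥0∞) (a : ℝ≥0∞) :
    {x | a < gridSup G J T x} = ⋃ Q ∈ maxCubes G J (fun Q => a < T Q), Q.toSet := by
  ext x
  simp only [mem_ofPred_eq, mem_iUnion, exists_prop]
  constructor
  · intro h
    obtain ⟨j, hj, h⟩ := lt_gridSup.1 h
    obtain ⟨Q, hQ, hx, -⟩ := exists_maxCube (P := fun Q => a < T Q) hj h
    exact ⟨Q, hQ, hx⟩
  · rintro ⟨Q, hQ, hx⟩
    exact hQ.1.trans_le (le_gridSup hQ hx)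

end stopping

/-- The average of `g` over a cube with respect to `σ`. -/
def avg (σ : Measure (Rn n)) (g : Rn n → ℝ≥0∞) (Q : Cube n) : ℝ≥0∞ :=
  (∫⁻ y in Q.toSet, g y ∂σ) / σ Q.toSet

section Doob

variable {σ : Measure (Rn n)} {g : Rn n → ℝ≥0∞}

lemma weak_type_gridSup (G : Grid n) (J : Finset ℤ) (hσ : ∀ Q : Cube n, σ Q.toSet ≠ 0)
    (hσ' : ∀ Q : Cube n, σ Q.toSet ≠ ∞) (hg : Measurable g) {a : ℝ≥0∞} (ha : a ≠ ∞) :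
    a / 2 * σ {x | a < gridSup G J (avg σ g) x} ≤ ∫⁻ x in {x | a / 2 < g x}, g x ∂σ := by
  have hm : MeasurableSet {x | a / 2 < g x} := measurableSet_lt measurable_const hg
  have key : ∀ Q : Cube n, a < avg σ g Q →
      a / 2 * σ Q.toSet ≤ ∫⁻ x in Q.toSet, {x | a / 2 < g x}.indicator g x ∂σ := by
    intro Q hQ
    have h1 : a * σ Q.toSet ≤ ∫⁻ x in Q.toSet, g x ∂σ := by
      rw [avg] at hQ
      exact ((ENNReal.lt_div_iff_mul_lt (Or.inl (hσ Q)) (Or.inl (hσ' Q))).1 hQ).le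
    have h2 : ∫⁻ x in Q.toSet, g x ∂σ
        ≤ (∫⁻ x in Q.toSet, {x | a / 2 < g x}.indicator g x ∂σ) + a / 2 * σ Q.toSet := by
      calc ∫⁻ x in Q.toSet, g x ∂σ
          ≤ ∫⁻ x in Q.toSet, ({x | a / 2 < g x}.indicator g x + a / 2) ∂σ := by
            refine lintegral_mono fun x => ?_
            by_cases hx : a / 2 < g x
            · simp [indicator, hx]
            · have := not_lt.1 hx
              rw [indicator_of_notMem (by exact hx), zero_add]
              exact this
        _ = _ := by
            rw [lintegral_add_right _ measurable_const, setLIntegral_const]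
    have h3 : a / 2 * σ Q.toSet ≠ ∞ :=
      ENNReal.mul_ne_top (ENNReal.div_ne_top ha (by simp)) (hσ' Q)
    have h4 : a / 2 * σ Q.toSet + a / 2 * σ Q.toSet = a * σ Q.toSet := by
      rw [← add_mul, ENNReal.add_halves]
    rw [← ENNReal.add_le_add_iff_right h3, h4]
    exact h1.trans h2
  rw [setOf_lt_gridSup, measure_biUnion countable_maxCubes pairwiseDisjoint_maxCubes
    (fun Q _ => measurableSet_toSet Q), ← ENNReal.tsum_mul_left]
  calc _ ≤ ∑' Q : maxCubes G J (fun Q => a < avg σ g Q),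
        ∫⁻ x in (Q : Cube n).toSet, {x | a / 2 < g x}.indicator g x ∂σ :=
        ENNReal.tsum_le_tsum fun Q => key Q Q.2.1
    _ = ∫⁻ x in ⋃ Q ∈ maxCubes G J (fun Q => a < avg σ g Q), Q.toSet,
          {x | a / 2 < g x}.indicator g x ∂σ :=
        (lintegral_biUnion countable_maxCubes (fun Q _ => measurableSet_toSet Q)
          pairwiseDisjoint_maxCubes _).symm
    _ ≤ ∫⁻ x, {x | a / 2 < g x}.indicator g x ∂σ := setLIntegral_le_lintegral _ _
    _ = _ := lintegral_indicator hm _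

lemma tsum_zpow_rpow_le {s : ℝ} (hs : 1 < s) :
    ∃ C : ℝ≥0∞, C ≠ ∞ ∧ ∀ t : ℝ≥0∞, t ≠ ∞ →
      ∑' k : ℤ, (if (2 : ℝ≥0∞) ^ k < t then ((2 : ℝ≥0∞) ^ k) ^ (s - 1) else 0)
        ≤ C * t ^ (s - 1) := by
  have hs' : 0 < s - 1 := by linarith
  set q : ℝ≥0∞ := (2⁻¹ : ℝ≥0∞) ^ (s - 1) with hq
  have hq1 : q < 1 := ENNReal.rpow_lt_one (by simp) hs'
  refine ⟨(1 - q)⁻¹, ENNReal.inv_ne_top.2 (tsub_pos_of_lt hq1).ne', fun t ht => ?_⟩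
  rcases eq_or_ne t 0 with rfl | h0
  · simp
  obtain ⟨m, hm1, hm2⟩ := ENNReal.exists_mem_Ioc_zpow h0 ht (y := 2) (by norm_num) (by simp)
  have inj : Function.Injective fun i : ℕ => m - (i : ℤ) := by
    intro a b h; simpa using h
  rw [← inj.tsum_eq]
  · calc ∑' i : ℕ, (if (2 : ℝ≥0∞) ^ (m - (i : ℤ)) < t
            then ((2 : ℝ≥0∞) ^ (m - (i : ℤ))) ^ (s - 1) else 0)
        ≤ ∑' i : ℕ, t ^ (s - 1) * q ^ i := by
          refine ENNReal.tsum_le_tsum fun i => ?_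
          split_ifs
          · have : (2 : ℝ≥0∞) ^ (m - (i : ℤ)) = 2 ^ m * (2⁻¹) ^ i := by
              rw [ENNReal.zpow_sub (by simp) (by simp), zpow_natCast, ENNReal.inv_pow]
            rw [this, ENNReal.mul_rpow_of_nonneg _ _ hs'.le, hq, ← ENNReal.rpow_natCast,
              ← ENNReal.rpow_natCast, ← ENNReal.rpow_mul, ← ENNReal.rpow_mul, mul_comm (i : ℝ)]
            gcongr
          · exact zero_le
      _ = _ := by rw [ENNReal.tsum_mul_left, ENNReal.tsum_geometric, mul_comm]
  · intro k hk
    by_contra hcon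
    apply hk
    have hmk : m < k := by
      by_contra! h
      exact hcon ⟨(m - k).toNat, by simp [Int.toNat_of_nonneg (sub_nonneg.2 h)]⟩
    have : ¬ (2 : ℝ≥0∞) ^ k < t := by
      rw [not_lt]
      exact hm2.trans (ENNReal.zpow_le_of_le (by norm_num) hmk)
    simp [this]

/-- Doob's maximal inequality for the averages over the cubes of a grid. -/
lemma lintegral_gridSup_rpow_le {s : ℝ} (hs : 1 < s) :
    ∃ C : ℝ≥0∞, C ≠ ∞ ∧ ∀ (G : Grid n) (J : Finset ℤ) (σ : Measure (Rn n)) (g : Rn n → ℝ≥0∞),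
      (∀ Q : Cube n, σ Q.toSet ≠ 0) → (∀ Q : Cube n, σ Q.toSet ≠ ∞) → Measurable g →
      (∀ x, g x ≠ ∞) → (∀ Q : Cube n, avg σ g Q < ∞) →
      ∫⁻ x, gridSup G J (avg σ g) x ^ s ∂σ ≤ C * ∫⁻ x, g x ^ s ∂σ := by
  obtain ⟨C, hC, hCt⟩ := tsum_zpow_rpow_le hs
  have hs0 : 0 < s := by linarith
  have hs' : 0 < s - 1 := by linarith
  refine ⟨2 ^ (2 * s) * C, ENNReal.mul_ne_top (by simp) hC, ?_⟩
  intro G J σ g hσ hσ' hg hgt hav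
  set M := gridSup G J (avg σ g)
  have hM : Measurable M := measurable_gridSup _ _ _
  have z2 : ∀ k : ℤ, (2 : ℝ≥0∞) ^ k ≠ ∞ := fun k => ENNReal.zpow_ne_top (by simp) (by simp) k
  have z0 : ∀ k : ℤ, (2 : ℝ≥0∞) ^ k ≠ 0 := fun k =>
    (ENNReal.zpow_pos (by simp) (by simp) k).ne'
  have step : ∀ k : ℤ, ((2 : ℝ≥0∞) ^ (k + 2)) ^ s * σ {x | 2 ^ (k + 1) < M x}
      ≤ 2 ^ (2 * s) * ∫⁻ x, (if (2 : ℝ≥0∞) ^ k < g x then ((2 : ℝ≥0∞) ^ k) ^ (s - 1) else 0)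
        * g x ∂σ := by
    intro k
    have h := weak_type_gridSup G J hσ hσ' hg (z2 (k + 1))
    have e : (2 : ℝ≥0∞) ^ (k + 1) / 2 = 2 ^ k := by
      rw [ENNReal.zpow_add (by simp) (by simp), zpow_one, ENNReal.mul_div_cancel_right] <;> simp
    have e2 : ((2 : ℝ≥0∞) ^ (k + 2)) ^ s
        = 2 ^ (2 * s) * ((2 : ℝ≥0∞) ^ k) ^ (s - 1) * 2 ^ k := by
      rw [ENNReal.zpow_add (by simp) (by simp), ENNReal.mul_rpow_of_nonneg _ _ hs0.le, mul_comm,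
        mul_assoc]
      congr 1
      · rw [ENNReal.rpow_mul]; norm_num
      · conv_rhs => enter [2]; rw [← ENNReal.rpow_one ((2 : ℝ≥0∞) ^ k)]
        rw [← ENNReal.rpow_add _ _ (z0 k) (z2 k)]
        congr 1; ring
    rw [e] at h
    rw [e2, mul_assoc, mul_assoc]
    gcongr
    calc _ ≤ ((2 : ℝ≥0∞) ^ k) ^ (s - 1) * ∫⁻ x in {x | 2 ^ k < g x}, g x ∂σ := by gcongr
      _ = ((2 : ℝ≥0∞) ^ k) ^ (s - 1) * ∫⁻ x, {x | 2 ^ k < g x}.indicator g x ∂σ := by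
          rw [lintegral_indicator (measurableSet_lt measurable_const hg)]
      _ = ∫⁻ x, ((2 : ℝ≥0∞) ^ k) ^ (s - 1) * {x | 2 ^ k < g x}.indicator g x ∂σ := by
          rw [lintegral_const_mul _ (hg.indicator (measurableSet_lt measurable_const hg))]
      _ = _ := by
          refine lintegral_congr fun x => ?_
          by_cases hx : (2 : ℝ≥0∞) ^ k < g x <;> simp [indicator, hx]
  calc ∫⁻ x, M x ^ s ∂σ
      ≤ ∫⁻ x, ∑' k : ℤ, ((2 : ℝ≥0∞) ^ (k + 2)) ^ s * {x | 2 ^ (k + 1) < M x}.indicator 1 x ∂σ := by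
        refine lintegral_mono fun x => ?_
        rcases eq_or_ne (M x) 0 with h0 | h0
        · simp [h0, hs0]
        obtain ⟨m, hm1, hm2⟩ := ENNReal.exists_mem_Ioc_zpow h0 (gridSup_lt_top hav x).ne
          (y := 2) (by norm_num) (by simp)
        refine le_trans ?_ (ENNReal.le_tsum (m - 1))
        have h1 : m - 1 + 2 = m + 1 := by ring
        have h2 : m - 1 + 1 = m := by ring
        rw [h1, h2, indicator_of_mem (by exact hm1)]
        simp only [Pi.one_apply, mul_one]
        exact ENNReal.rpow_le_rpow hm2 hs0.le
    _ = ∑' k : ℤ, ((2 : ℝ≥0∞) ^ (k + 2)) ^ s * σ {x | 2 ^ (k + 1) < M x} := by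
        have hmeas : ∀ k : ℤ, MeasurableSet {x | (2 : ℝ≥0∞) ^ (k + 1) < M x} :=
          fun k => measurableSet_lt measurable_const hM
        rw [lintegral_tsum fun k =>
          ((measurable_one.indicator (hmeas k)).const_mul _).aemeasurable]
        congr 1 with k
        rw [lintegral_const_mul _ (measurable_one.indicator (hmeas k)),
          lintegral_indicator_one (hmeas k)]
    _ ≤ ∑' k : ℤ, 2 ^ (2 * s) *
          ∫⁻ x, (if (2 : ℝ≥0∞) ^ k < g x then ((2 : ℝ≥0∞) ^ k) ^ (s - 1) else 0) * g x ∂σ :=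
        ENNReal.tsum_le_tsum step
    _ = 2 ^ (2 * s) * ∫⁻ x,
          (∑' k : ℤ, if (2 : ℝ≥0∞) ^ k < g x then ((2 : ℝ≥0∞) ^ k) ^ (s - 1) else 0) * g x ∂σ := by
        rw [ENNReal.tsum_mul_left, ← lintegral_tsum]
        · congr 2 with x
          rw [ENNReal.tsum_mul_right]
        · intro k
          exact ((Measurable.ite (measurableSet_lt measurable_const hg) measurable_const
            measurable_const).mul hg).aemeasurable
    _ ≤ 2 ^ (2 * s) * ∫⁻ x, C * g x ^ s ∂σ := by
        refine mul_le_mul' le_rfl (lintegral_mono fun x => ?_)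
        rcases eq_or_ne (g x) 0 with h0 | h0
        · simp [h0]
        calc _ ≤ C * g x ^ (s - 1) * g x := mul_le_mul' (hCt _ (hgt x)) le_rfl
          _ = C * g x ^ s := by
            rw [mul_assoc]
            congr 1
            conv_lhs => enter [2]; rw [← ENNReal.rpow_one (g x)]
            rw [← ENNReal.rpow_add _ _ h0 (hgt x)]
            congr 1; ring
    _ = _ := by rw [lintegral_const_mul _ (hg.pow_const s), mul_assoc]

end Doob

section sparse

lemma four_mul_le_add_of_sq_le {r x y : ℝ≥0∞} (hx : x ≠ ∞) (hy : y ≠ ∞)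
    (h : 4 * r ^ 2 ≤ x * y) : 4 * r ≤ x + y := by
  have hr : r ≠ ∞ := by
    rintro rfl
    exact absurd h (not_le.2 (by simpa using ENNReal.mul_lt_top hx.lt_top hy.lt_top))
  lift r to NNReal using hr
  lift x to NNReal using hx
  lift y to NNReal using hy
  norm_cast at h ⊢
  rw [← NNReal.coe_le_coe] at h ⊢
  push_cast at h ⊢
  nlinarith [r.2, x.2, y.2, sq_nonneg ((x : ℝ) - y), x.coe_nonneg, y.coe_nonneg, r.coe_nonneg]

variable {G : Grid n} {J : Finset ℤ} {f₁ f₂ : Rn n → ℝ≥0∞}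

/-- The product of the averages of two functions over a cube. -/
def biAvg (f₁ f₂ : Rn n → ℝ≥0∞) (Q : Cube n) : ℝ≥0∞ := avg volume f₁ Q * avg volume f₂ Q

lemma avg_volume_lt_top {f : Rn n → ℝ≥0∞} (h : ∀ Q : Cube n, ∫⁻ x in Q.toSet, f x ≠ ∞)
    (Q : Cube n) : avg volume f Q < ∞ := by
  rw [avg, volume_toSet]
  exact ENNReal.div_lt_top (h Q) (vol_ne_zero Q)

lemma volume_inter_setOf_lt_gridSup_le (h₁ : ∀ Q : Cube n, ∫⁻ x in Q.toSet, f₁ x ≠ ∞)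
    (h₂ : ∀ Q : Cube n, ∫⁻ x in Q.toSet, f₂ x ≠ ∞) {a b : ℝ≥0∞} {Q : Cube n}
    (hQ : Q ∈ maxCubes G J fun Q => a < biAvg f₁ f₂ Q) (hab : 4 * biAvg f₁ f₂ Q ≤ b)
    (hle : a ≤ b) :
    2 * volume (Q.toSet ∩ {x | b < gridSup G J (biAvg f₁ f₂) x}) ≤ volume Q.toSet := by
  set S := {R | R ∈ maxCubes G J (fun Q => b < biAvg f₁ f₂ Q) ∧ R.toSet ⊆ Q.toSet} with hS
  have hS' : S ⊆ maxCubes G J (fun Q => b < biAvg f₁ f₂ Q) := fun R hR => hR.1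
  have hcov : Q.toSet ∩ {x | b < gridSup G J (biAvg f₁ f₂) x} ⊆ ⋃ R ∈ S, R.toSet := by
    rintro x ⟨hxQ, hx⟩
    obtain ⟨j, hj, h⟩ := lt_gridSup.1 hx
    obtain ⟨R, hR, hxR, -⟩ := exists_maxCube (P := fun Q => b < biAvg f₁ f₂ Q) hj h
    obtain ⟨l, hl, rfl, -⟩ := maxCubes_cases hR hxR
    exact mem_biUnion (x := G.cell l x)
      ⟨hR, cell_subset_maxCube hQ hxQ hl (hle.trans_lt hR.1)⟩ hxR
  have hcount : S.Countable := countable_maxCubes.mono hS'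
  have hdisj : S.PairwiseDisjoint Cube.toSet := pairwiseDisjoint_maxCubes.subset hS'
  set A := ∫⁻ x in Q.toSet, f₁ x
  set B := ∫⁻ x in Q.toSet, f₂ x
  set V := volume Q.toSet with hV
  have hV0 : V ≠ 0 := by rw [hV, volume_toSet]; exact vol_ne_zero Q
  have hVt : V ≠ ∞ := by rw [hV, volume_toSet]; exact vol_ne_top Q
  have hT : biAvg f₁ f₂ Q = A * B * V⁻¹ ^ 2 := by
    simp only [biAvg, avg, ENNReal.div_eq_inv_mul]; ring
  have hTpos : biAvg f₁ f₂ Q ≠ 0 := (lt_of_le_of_lt zero_le hQ.1).ne'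
  have hA0 : A ≠ 0 := fun h => hTpos (by rw [hT, h]; simp)
  have hB0 : B ≠ 0 := fun h => hTpos (by rw [hT, h]; simp)
  have hAt : A ≠ ∞ := h₁ Q
  have hBt : B ≠ ∞ := h₂ Q
  have key : ∀ R ∈ S, 4 * (volume R.toSet * V⁻¹) ≤
      (∫⁻ x in R.toSet, f₁ x) * A⁻¹ + (∫⁻ x in R.toSet, f₂ x) * B⁻¹ := by
    intro R hR
    refine four_mul_le_add_of_sq_le (ENNReal.mul_ne_top (h₁ R) (by simpa using hA0))
      (ENNReal.mul_ne_top (h₂ R) (by simpa using hB0)) ?_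
    have hv0 : volume R.toSet ≠ 0 := by rw [volume_toSet]; exact vol_ne_zero R
    have hvt : volume R.toSet ≠ ∞ := by rw [volume_toSet]; exact vol_ne_top R
    have hb : 4 * (A * B * V⁻¹ ^ 2) ≤
        (∫⁻ x in R.toSet, f₁ x) * (∫⁻ x in R.toSet, f₂ x) * (volume R.toSet)⁻¹ ^ 2 := by
      rw [← hT]
      refine hab.trans (hR.1.1.le.trans (le_of_eq ?_))
      simp only [biAvg, avg, ENNReal.div_eq_inv_mul]; ring
    calc 4 * (volume R.toSet * V⁻¹) ^ 2
        = 4 * (A * B * V⁻¹ ^ 2) * (A⁻¹ * B⁻¹ * volume R.toSet ^ 2) := by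
          have e : A * B * (A⁻¹ * B⁻¹) = 1 := by
            rw [mul_mul_mul_comm, ENNReal.mul_inv_cancel hA0 hAt, ENNReal.mul_inv_cancel hB0 hBt,
              one_mul]
          calc _ = 4 * (volume R.toSet * V⁻¹) ^ 2 * 1 := by ring
            _ = _ := by rw [← e]; ring
      _ ≤ (∫⁻ x in R.toSet, f₁ x) * (∫⁻ x in R.toSet, f₂ x) * (volume R.toSet)⁻¹ ^ 2
            * (A⁻¹ * B⁻¹ * volume R.toSet ^ 2) := mul_le_mul' hb le_rfl
      _ = _ := by
          have e : (volume R.toSet)⁻¹ ^ 2 * volume R.toSet ^ 2 = 1 := by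
            rw [← mul_pow, ENNReal.inv_mul_cancel hv0 hvt, one_pow]
          calc _ = (∫⁻ x in R.toSet, f₁ x) * (∫⁻ x in R.toSet, f₂ x) * (A⁻¹ * B⁻¹) *
                ((volume R.toSet)⁻¹ ^ 2 * volume R.toSet ^ 2) := by ring
            _ = _ := by rw [e]; ring
  have hI : ∀ f : Rn n → ℝ≥0∞, ∑' R : S, ∫⁻ x in (R : Cube n).toSet, f x
      ≤ ∫⁻ x in Q.toSet, f x := by
    intro f
    rw [← lintegral_biUnion hcount (fun R _ => measurableSet_toSet R) hdisj]
    exact lintegral_mono_set (iUnion₂_subset fun R hR => hR.2)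
  have hsum : 4 * (volume (⋃ R ∈ S, R.toSet) * V⁻¹) ≤ 2 := by
    rw [measure_biUnion hcount hdisj (fun R _ => measurableSet_toSet R), ← ENNReal.tsum_mul_right,
      ← ENNReal.tsum_mul_left]
    calc _ ≤ ∑' R : S, ((∫⁻ x in (R : Cube n).toSet, f₁ x) * A⁻¹
            + (∫⁻ x in (R : Cube n).toSet, f₂ x) * B⁻¹) :=
          ENNReal.tsum_le_tsum fun R => key R R.2
      _ ≤ A * A⁻¹ + B * B⁻¹ := by
          rw [ENNReal.tsum_add, ENNReal.tsum_mul_right, ENNReal.tsum_mul_right]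
          exact add_le_add (mul_le_mul' (hI f₁) le_rfl) (mul_le_mul' (hI f₂) le_rfl)
      _ = 2 := by
          rw [ENNReal.mul_inv_cancel hA0 hAt, ENNReal.mul_inv_cancel hB0 hBt]; norm_num
  have h4 : 2 * (2 * volume (⋃ R ∈ S, R.toSet)) ≤ 2 * V := by
    calc 2 * (2 * volume (⋃ R ∈ S, R.toSet))
        = 4 * (volume (⋃ R ∈ S, R.toSet) * V⁻¹) * V := by
          calc _ = 4 * volume (⋃ R ∈ S, R.toSet) * 1 := by ring
            _ = _ := by rw [← ENNReal.inv_mul_cancel hV0 hVt]; ring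
      _ ≤ 2 * V := mul_le_mul' hsum le_rfl
  refine le_trans (mul_le_mul' le_rfl (measure_mono hcov)) ?_
  exact (ENNReal.mul_le_mul_iff_right (by simp) (by simp)).1 h4

/-- A sparse domination principle for the dyadic bilinear maximal operator. -/
lemma lintegral_comp_gridSup_le (h₁ : ∀ Q : Cube n, ∫⁻ x in Q.toSet, f₁ x ≠ ∞)
    (h₂ : ∀ Q : Cube n, ∫⁻ x in Q.toSet, f₂ x ≠ ∞) {Ψ : ℝ≥0∞ → Rn n → ℝ≥0∞}
    (hΨ : ∀ x a b, a ≤ b → Ψ a x ≤ Ψ b x) (hΨ0 : ∀ x, Ψ 0 x = 0) {K : Rn n → ℝ≥0∞}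
    (hK : ∀ Q : Cube n, (∀ x ∈ Q.toSet, ∃ j ∈ J, Q = G.cell j x) →
      ∀ E ⊆ Q.toSet, MeasurableSet E → volume Q.toSet ≤ 2 * volume E →
      ∫⁻ x in E, Ψ (4 * biAvg f₁ f₂ Q) x ≤ ∫⁻ x in E, K x) :
    ∫⁻ x, Ψ (gridSup G J (biAvg f₁ f₂) x) x ≤ 2 * ∫⁻ x, K x := by
  set T := biAvg f₁ f₂ with hT
  set M := gridSup G J T with hMdef
  have hM : Measurable M := measurable_gridSup _ _ _
  have hTt : ∀ Q, T Q < ∞ := fun Q =>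
    ENNReal.mul_lt_top (avg_volume_lt_top h₁ Q) (avg_volume_lt_top h₂ Q)
  set L : ℤ → Set (Rn n) := fun k => {x | (4 : ℝ≥0∞) ^ k < M x ∧ M x ≤ 4 ^ (k + 1)} with hL
  have hLm : ∀ k, MeasurableSet (L k) := fun k =>
    (measurableSet_lt measurable_const hM).inter (measurableSet_le hM measurable_const)
  have hLd : Pairwise (Function.onFun Disjoint L) := by
    intro k l hkl
    rw [Function.onFun, Set.disjoint_left]
    rintro x ⟨hx1, hx2⟩ ⟨hx3, hx4⟩
    rcases lt_or_gt_of_ne hkl with h | h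
    · exact absurd (hx3.trans_le hx2)
        (not_lt.2 (ENNReal.zpow_le_of_le (by norm_num) (by omega)))
    · exact absurd (hx1.trans_le hx4)
        (not_lt.2 (ENNReal.zpow_le_of_le (by norm_num) (by omega)))
  have hlayer : ∀ k, ∫⁻ x in L k, Ψ (M x) x ≤ (∫⁻ x in L k, K x) + ∫⁻ x in L (k + 1), K x := by
    intro k
    set S := maxCubes G J (fun Q => (4 : ℝ≥0∞) ^ k < T Q) with hS
    have hSd : S.PairwiseDisjoint Cube.toSet := pairwiseDisjoint_maxCubes
    have hmem : ∀ Q ∈ S, ∀ x ∈ Q.toSet, T Q ≤ M x := fun Q hQ x hx => le_gridSup hQ hx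
    have hcov : L k = ⋃ Q ∈ S, Q.toSet ∩ L k := by
      ext x
      simp only [mem_iUnion, exists_prop, mem_inter_iff]
      constructor
      · intro hx
        obtain ⟨j, hj, h⟩ := lt_gridSup.1 hx.1
        obtain ⟨R, hR, hxR, -⟩ := exists_maxCube (P := fun Q => (4 : ℝ≥0∞) ^ k < T Q) hj h
        exact ⟨R, hR, hxR, hx⟩
      · rintro ⟨Q, -, -, h⟩; exact h
    have hdL : ∀ U : Set (Rn n), S.PairwiseDisjoint fun Q => Q.toSet ∩ U := fun U =>
      hSd.mono_on fun Q _ => inter_subset_left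
    have hmL : ∀ U : Set (Rn n), MeasurableSet U → ∀ Q ∈ S, MeasurableSet (Q.toSet ∩ U) :=
      fun U hU Q _ => (measurableSet_toSet Q).inter hU
    set U := L k ∪ L (k + 1) with hU
    have hUm : MeasurableSet U := (hLm _).union (hLm _)
    have hstep : ∀ Q ∈ S, ∫⁻ x in Q.toSet ∩ L k, Ψ (M x) x ≤ ∫⁻ x in Q.toSet ∩ U, K x := by
      intro Q hQ
      by_cases hne : (Q.toSet ∩ L k).Nonempty
      · obtain ⟨z, hzQ, hz⟩ := hne
        have hTQ : T Q ≤ 4 ^ (k + 1) := (hmem Q hQ z hzQ).trans hz.2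
        have e1 : (4 : ℝ≥0∞) ^ (k + 1) = 4 * 4 ^ k := by
          rw [ENNReal.zpow_add (by simp) (by simp), zpow_one, mul_comm]
        have e2 : (4 : ℝ≥0∞) ^ (k + 2) = 4 * 4 ^ (k + 1) := by
          rw [show k + 2 = 1 + (k + 1) by ring, ENNReal.zpow_add (by simp) (by simp), zpow_one]
        have hvol := volume_inter_setOf_lt_gridSup_le h₁ h₂ (G := G) (J := J)
          (a := 4 ^ k) (b := 4 ^ (k + 2)) hQ (by rw [e2]; exact mul_le_mul' le_rfl hTQ)
          (ENNReal.zpow_le_of_le (by norm_num) (by omega))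
        set E := Q.toSet \ {x | (4 : ℝ≥0∞) ^ (k + 2) < M x} with hE
        have hEm : MeasurableSet E :=
          (measurableSet_toSet Q).diff (measurableSet_lt measurable_const hM)
        have hEvol : volume Q.toSet ≤ 2 * volume E := by
          have hs : volume Q.toSet = volume (Q.toSet ∩ {x | (4 : ℝ≥0∞) ^ (k + 2) < M x})
              + volume E := (measure_inter_add_sdiff _ (measurableSet_lt measurable_const hM)).symm
          have ht : volume Q.toSet ≠ ∞ := by rw [volume_toSet]; exact vol_ne_top Q
          rw [← ENNReal.add_le_add_iff_left ht]
          calc volume Q.toSet + volume Q.toSet = 2 * volume Q.toSet := by ring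
            _ = 2 * volume (Q.toSet ∩ {x | (4 : ℝ≥0∞) ^ (k + 2) < M x}) + 2 * volume E := by
                rw [hs]; ring
            _ ≤ _ := by gcongr
        have hEU : E ⊆ Q.toSet ∩ U := by
          rintro x ⟨hxQ, hx⟩
          refine ⟨hxQ, ?_⟩
          have hlt : (4 : ℝ≥0∞) ^ k < M x := lt_of_lt_of_le hQ.1 (hmem Q hQ x hxQ)
          rcases le_or_gt (M x) (4 ^ (k + 1)) with h | h
          · exact Or.inl ⟨hlt, h⟩
          · refine Or.inr ⟨h, ?_⟩
            rw [show k + 1 + 1 = k + 2 by ring]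
            exact not_lt.1 hx
        calc ∫⁻ x in Q.toSet ∩ L k, Ψ (M x) x
            ≤ ∫⁻ x in Q.toSet ∩ L k, Ψ (4 * T Q) x := by
              refine setLIntegral_mono' (hmL _ (hLm k) Q hQ) fun x hx => hΨ x _ _ ?_
              refine hx.2.2.trans ?_
              rw [e1]
              exact mul_le_mul' le_rfl hQ.1.le
          _ ≤ ∫⁻ x in E, Ψ (4 * T Q) x := by
              refine lintegral_mono_set fun x hx => ⟨hx.1, not_lt.2 (hx.2.2.trans ?_)⟩
              exact ENNReal.zpow_le_of_le (by norm_num) (by omega)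
          _ ≤ ∫⁻ x in E, K x := by
              refine hK Q (fun x hx => ?_) E sdiff_subset hEm hEvol
              obtain ⟨j, hj, h, -⟩ := maxCubes_cases hQ hx
              exact ⟨j, hj, h⟩
          _ ≤ _ := lintegral_mono_set hEU
      · rw [not_nonempty_iff_eq_empty.1 hne]
        simp
    calc ∫⁻ x in L k, Ψ (M x) x
        = ∑' Q : S, ∫⁻ x in (Q : Cube n).toSet ∩ L k, Ψ (M x) x := by
          conv_lhs => rw [hcov]
          exact lintegral_biUnion countable_maxCubes (hmL _ (hLm k)) (hdL _) _
      _ ≤ ∑' Q : S, ∫⁻ x in (Q : Cube n).toSet ∩ U, K x :=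
          ENNReal.tsum_le_tsum fun Q => hstep Q Q.2
      _ = ∫⁻ x in ⋃ Q ∈ S, Q.toSet ∩ U, K x :=
          (lintegral_biUnion countable_maxCubes (hmL _ hUm) (hdL _) _).symm
      _ ≤ ∫⁻ x in U, K x := lintegral_mono_set (iUnion₂_subset fun Q _ => inter_subset_right)
      _ ≤ _ := lintegral_union_le _ _ _
  have hzero : ∫⁻ x in (⋃ k, L k)ᶜ, Ψ (M x) x = 0 := by
    refine (setLIntegral_congr_fun (MeasurableSet.iUnion hLm).compl (g := fun _ => 0) ?_).trans
      (by simp)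
    intro x hx
    have : M x = 0 := by
      by_contra h0
      obtain ⟨m, hm⟩ := ENNReal.exists_mem_Ioc_zpow h0 (gridSup_lt_top hTt x).ne
          (y := 4) (by norm_num) (by simp)
      exact hx (mem_iUnion.2 ⟨m, hm⟩)
    simp only [this, hΨ0]
  calc ∫⁻ x, Ψ (M x) x = ∑' k, ∫⁻ x in L k, Ψ (M x) x := by
        rw [← lintegral_add_compl _ (MeasurableSet.iUnion hLm), hzero, add_zero,
          lintegral_iUnion hLm hLd]
    _ ≤ ∑' k, ((∫⁻ x in L k, K x) + ∫⁻ x in L (k + 1), K x) := ENNReal.tsum_le_tsum hlayer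
    _ = (∑' k, ∫⁻ x in L k, K x) + ∑' k, ∫⁻ x in L k, K x := by
        rw [ENNReal.tsum_add]
        congr 1
        exact (Equiv.addRight (1 : ℤ)).tsum_eq fun k => ∫⁻ x in L k, K x
    _ = 2 * ∫⁻ x in ⋃ k, L k, K x := by rw [lintegral_iUnion hLm hLd, two_mul]
    _ ≤ _ := mul_le_mul' le_rfl (setLIntegral_le_lintegral _ _)

end sparse

/-- The logarithmic size of a cube as seen from the point `y`. -/
def lg (Q : Cube n) (y : Rn n) : ℝ :=
  Real.log (Real.exp 1 + ‖y‖) + max 0 (-Real.log Q.side)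

lemma exp_one_le_base (y : Rn n) : Real.exp 1 ≤ Real.exp 1 + ‖y‖ := by
  linarith [norm_nonneg y]

lemma base_pos (y : Rn n) : 0 < Real.exp 1 + ‖y‖ := (Real.exp_pos 1).trans_le (exp_one_le_base y)

lemma one_le_log_base (y : Rn n) : 1 ≤ Real.log (Real.exp 1 + ‖y‖) := by
  rw [Real.le_log_iff_exp_le (base_pos y)]
  exact exp_one_le_base y

lemma log_base_le_lg (Q : Cube n) (y : Rn n) : Real.log (Real.exp 1 + ‖y‖) ≤ lg Q y :=
  le_add_of_nonneg_right (le_max_left _ _)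

lemma one_le_lg (Q : Cube n) (y : Rn n) : 1 ≤ lg Q y :=
  (one_le_log_base y).trans (log_base_le_lg Q y)

/-- A power of `e + |y|`, integrable against the weights when `K` is large. -/
def bump (K : ℝ) (y : Rn n) : ℝ := (Real.exp 1 + ‖y‖) ^ (-K)

lemma bump_pos (K : ℝ) (y : Rn n) : 0 < bump K y := Real.rpow_pos_of_pos (base_pos y) _

lemma bump_le_one {K : ℝ} (hK : 0 ≤ K) (y : Rn n) : bump K y ≤ 1 :=
  Real.rpow_le_one_of_one_le_of_nonpos
    ((Real.one_le_exp zero_le_one).trans (exp_one_le_base y)) (by linarith)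

lemma log_bump (K : ℝ) (y : Rn n) : Real.log (bump K y) = -K * Real.log (Real.exp 1 + ‖y‖) :=
  Real.log_rpow (base_pos y) _

lemma measurable_bump (K : ℝ) : Measurable (bump K : Rn n → ℝ) := by
  unfold bump; fun_prop

lemma rpow_le_exp_mul_rpow {t a b κ l L : ℝ} (ht : 0 < t) (h : |Real.log t| ≤ κ * l)
    (hκ : 0 ≤ κ) (hab : |a - b| * l ≤ L) : t ^ a ≤ Real.exp (κ * L) * t ^ b := by
  have : t ^ a = t ^ (a - b) * t ^ b := by rw [← Real.rpow_add ht]; congr 1; ring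
  rw [this]
  refine mul_le_mul_of_nonneg_right ?_ (Real.rpow_nonneg ht.le _)
  rw [Real.rpow_def_of_pos ht, Real.exp_le_exp]
  calc Real.log t * (a - b) ≤ |Real.log t| * |a - b| := by
        rw [← abs_mul]; exact le_abs_self _
    _ ≤ κ * l * |a - b| := mul_le_mul_of_nonneg_right h (abs_nonneg _)
    _ = κ * (|a - b| * l) := by ring
    _ ≤ κ * L := mul_le_mul_of_nonneg_left hab hκ

lemma rpow_neg_le {K κ L : ℝ} (hK : 0 ≤ K) (hκ : 2 * K ≤ κ) {Q : Cube n} {y : Rn n} {t a b : ℝ}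
    (ht : 0 < t) (hlog : -κ * lg Q y ≤ Real.log t) (ha : 1 / 2 ≤ a)
    (hab : |a - b| * lg Q y ≤ L) :
    t ^ (-a) ≤ Real.exp (κ * L) * t ^ (-b) + bump K y := by
  have hl := one_le_lg Q y
  have hκ0 : 0 ≤ κ := by linarith
  rcases le_or_gt (Real.log t) (κ * lg Q y) with h | h
  · have : t ^ (-a) ≤ Real.exp (κ * L) * t ^ (-b) := by
      refine rpow_le_exp_mul_rpow ht (abs_le.2 ⟨by linarith, h⟩) hκ0 ?_
      rwa [neg_sub_neg, abs_sub_comm]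
    linarith [bump_pos K y]
  · have h1 : t ^ (-a) ≤ bump K y := by
      rw [← Real.log_le_log_iff (Real.rpow_pos_of_pos ht _) (bump_pos K y), log_bump,
        Real.log_rpow ht]
      have h2 := log_base_le_lg Q y
      have h3 := one_le_log_base y
      have h4 : 2 * K * Real.log (Real.exp 1 + ‖y‖) ≤ Real.log t :=
        (mul_le_mul hκ h2 (by linarith) hκ0).trans h.le
      have h5 : 0 ≤ Real.log t := le_trans (by positivity) h4
      nlinarith
    have : 0 ≤ Real.exp (κ * L) * t ^ (-b) := by positivity
    linarith

/-- The cube `[-ρ, ρ)ⁿ`. -/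
def centered (n : ℕ) (ρ : ℝ) (hρ : 0 < ρ) : Cube n := ⟨fun _ => -ρ, 2 * ρ, by linarith⟩

lemma mem_centered {ρ : ℝ} {hρ : 0 < ρ} {y : Rn n} (h : ‖y‖ < ρ) :
    y ∈ (centered n ρ hρ).toSet := by
  intro i
  have := abs_lt.1 ((Real.norm_eq_abs (y i) ▸ norm_le_pi_norm y i).trans_lt h)
  exact ⟨this.1.le, by simp only [centered]; linarith⟩

/-- The cube `[0, 1)ⁿ`. -/
def unitCube (n : ℕ) : Cube n := ⟨fun _ => 0, 1, one_pos⟩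

lemma unitCube_subset {ρ : ℝ} (hρ : 1 ≤ ρ) :
    (unitCube n).toSet ⊆ (centered n ρ (by linarith)).toSet := by
  intro y hy i
  have := hy i
  simp only [unitCube, centered] at this ⊢
  constructor <;> linarith

lemma exists_small_cube {Q : Cube n} {y : Rn n} (hy : y ∈ Q.toSet) :
    ∃ Q' : Cube n, Q'.side = min Q.side 1 ∧ Q'.toSet ⊆ Q.toSet ∧
      Q'.toSet ⊆ (centered n (2 + ‖y‖) (by positivity)).toSet := by
  refine ⟨⟨fun i => min (y i) (Q.base i + Q.side - min Q.side 1), min Q.side 1,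
    lt_min Q.side_pos one_pos⟩, rfl, fun z hz i => ?_, fun z hz i => ?_⟩
  · have h1 := hz i
    have h2 := hy i
    have h3 := min_le_left Q.side 1
    simp only at h1
    refine ⟨le_trans (le_min h2.1 (by linarith)) h1.1, ?_⟩
    linarith [min_le_right (y i) (Q.base i + Q.side - min Q.side 1)]
  · have h1 := hz i
    have h2 := hy i
    have h3 := min_le_right Q.side 1
    have h4 := abs_le.1 (Real.norm_eq_abs (y i) ▸ norm_le_pi_norm y i)
    have h5 : y i - 1 ≤ min (y i) (Q.base i + Q.side - min Q.side 1) :=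
      le_min (by linarith) (by linarith)
    have h6 := min_le_left (y i) (Q.base i + Q.side - min Q.side 1)
    simp only [centered] at h1 ⊢
    constructor <;> linarith

/-- Three weighted variable Lebesgue spaces with log-Hölder exponents `r j`, whose reciprocals sum
to `2`, and weights whose product is `1`. The weight of index `j` is encoded through the measure
with density `φ j`, and `α j Q` is comparable to the norm of its restriction to the cube `Q`. -/
structure Triple (n : ℕ) where
  r : Fin 3 → Rn n → ℝ
  rQ : Fin 3 → Cube n → ℝ
  R : ℝ
  L : ℝ
  half_le : ∀ j y, 1 / 2 ≤ r j y
  le_R : ∀ j y, r j y ≤ R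
  half_le_rQ : ∀ j Q, 1 / 2 ≤ rQ j Q
  rQ_le_R : ∀ j Q, rQ j Q ≤ R
  holder : ∀ j Q, ∀ y ∈ Q.toSet, |r j y - rQ j Q| * lg Q y ≤ L
  measurable_r : ∀ j, Measurable (r j)
  φ : Fin 3 → Rn n → ℝ≥0∞
  measurable_φ : ∀ j, Measurable (φ j)
  α : Fin 3 → Cube n → ℝ
  α_pos : ∀ j Q, 0 < α j Q
  lintegral_α_le : ∀ j (Q : Cube n),
    ∫⁻ y in Q.toSet, ENNReal.ofReal (α j Q ^ (-r j y)) ∂(volume.withDensity (φ j)) ≤ 1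
  α_le : ∀ j (Q : Cube n) (β : ℝ), 0 < β →
    ∫⁻ y in Q.toSet, ENNReal.ofReal (β ^ (-r j y)) ∂(volume.withDensity (φ j)) ≤ 1 → α j Q ≤ 2 * β
  A : ℝ
  prod_α_le : ∀ Q : Cube n, ∏ j, α j Q ≤ A * (Q.side ^ n) ^ 2
  young : ∀ (β : Fin 3 → ℝ) (E : Set (Rn n)), (∀ j, 0 < β j) → MeasurableSet E →
    volume E ≤ ENNReal.ofReal (√(∏ j, β j)) *
      ∑ j, ∫⁻ y in E, ENNReal.ofReal (β j ^ (-r j y)) ∂(volume.withDensity (φ j))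

namespace Triple

variable (T : Triple n)

/-- The measure associated to a weight of the triple. -/
def ν (j : Fin 3) : Measure (Rn n) := volume.withDensity (T.φ j)

lemma half_le_R : 1 / 2 ≤ T.R := (T.half_le 0 0).trans (T.le_R 0 0)

lemma A_pos : 0 < T.A := by
  have h := T.prod_α_le (unitCube n)
  have h2 : 0 < ∏ j, T.α j (unitCube n) := Finset.prod_pos fun j _ => T.α_pos j _
  simp only [unitCube, one_pow, mul_one] at h h2
  exact h2.trans_le h

lemma α_mono (j : Fin 3) {Q R : Cube n} (h : Q.toSet ⊆ R.toSet) : T.α j Q ≤ 2 * T.α j R :=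
  T.α_le j Q _ (T.α_pos j R) ((lintegral_mono_set h).trans (T.lintegral_α_le j R))

lemma sq_le_prod_α (Q : Cube n) : (Q.side ^ n) ^ 2 ≤ 9 * ∏ j, T.α j Q := by
  have hp : 0 < ∏ j, T.α j Q := Finset.prod_pos fun j _ => T.α_pos j Q
  have h := T.young (fun j => T.α j Q) Q.toSet (fun j => T.α_pos j Q) (measurableSet_toSet Q)
  have h2 : volume Q.toSet ≤ ENNReal.ofReal (√(∏ j, T.α j Q)) * 3 := by
    refine h.trans (mul_le_mul' le_rfl ?_)
    calc _ ≤ ∑ j : Fin 3, (1 : ℝ≥0∞) := Finset.sum_le_sum fun j _ => T.lintegral_α_le j Q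
      _ = 3 := by simp
  rw [volume_toSet, Cube.vol, show (3 : ℝ≥0∞) = ENNReal.ofReal 3 by simp,
    ← ENNReal.ofReal_mul (Real.sqrt_nonneg _), ENNReal.ofReal_le_ofReal_iff (by positivity)] at h2
  have h3 : 0 ≤ Q.side ^ n := pow_nonneg Q.side_pos.le _
  calc (Q.side ^ n) ^ 2 ≤ (√(∏ j, T.α j Q) * 3) ^ 2 := pow_le_pow_left₀ h3 h2 2
    _ = 9 * ∏ j, T.α j Q := by rw [mul_pow, Real.sq_sqrt hp.le]; ring

lemma α_le_of_subset (j : Fin 3) {Q R : Cube n} (h : Q.toSet ⊆ R.toSet) :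
    (Q.side ^ n) ^ 2 * T.α j R ≤ 36 * T.A * (R.side ^ n) ^ 2 * T.α j Q := by
  have e : ∀ S : Cube n, ∏ k, T.α k S = T.α j S * ∏ k ∈ Finset.univ.erase j, T.α k S := fun S =>
    (Finset.mul_prod_erase _ _ (Finset.mem_univ j)).symm
  have h1 : ∏ k ∈ Finset.univ.erase j, T.α k Q ≤ 4 * ∏ k ∈ Finset.univ.erase j, T.α k R := by
    calc _ ≤ ∏ k ∈ Finset.univ.erase j, 2 * T.α k R :=
          Finset.prod_le_prod (fun k _ => (T.α_pos k Q).le) fun k _ => T.α_mono k h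
      _ = _ := by
          rw [Finset.prod_mul_distrib, Finset.prod_const,
            Finset.card_erase_of_mem (Finset.mem_univ j)]
          norm_num
  have hq := T.α_pos j Q
  have hr := T.α_pos j R
  calc (Q.side ^ n) ^ 2 * T.α j R
      ≤ 9 * (T.α j Q * ∏ k ∈ Finset.univ.erase j, T.α k Q) * T.α j R := by
        rw [← e]; exact mul_le_mul_of_nonneg_right (T.sq_le_prod_α Q) hr.le
    _ ≤ 9 * (T.α j Q * (4 * ∏ k ∈ Finset.univ.erase j, T.α k R)) * T.α j R := by gcongr
    _ = 36 * T.α j Q * ∏ k, T.α k R := by rw [e R]; ring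
    _ ≤ 36 * T.α j Q * (T.A * (R.side ^ n) ^ 2) :=
        mul_le_mul_of_nonneg_left (T.prod_α_le R) (by positivity)
    _ = _ := by ring

lemma exists_neg_lg_le_log_α : ∃ κ, 0 ≤ κ ∧ ∀ j Q, ∀ y ∈ Q.toSet,
    -κ * lg Q y ≤ Real.log (T.α j Q) := by
  have hA := T.A_pos
  set c : Fin 3 → ℝ := fun j => Real.log (T.α j (unitCube n) / (144 * T.A)) with hc
  refine ⟨2 * n * 4 + ∑ j, |c j|, by positivity, fun j Q y hy => ?_⟩
  obtain ⟨Q', hs, h1, h2⟩ := exists_small_cube hy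
  set ρ := 2 + ‖y‖ with hρ
  have hρ0 : 0 < ρ := by positivity
  set R := centered n ρ hρ0 with hR
  have hRs : R.side = 2 * ρ := rfl
  have k1 := T.α_mono j h1
  have k2 := T.α_mono j (unitCube_subset (n := n) (ρ := ρ) (by linarith [norm_nonneg y]))
  have k3 := T.α_le_of_subset j h2
  have hs0 := Q'.side_pos
  have k4 : (Q'.side ^ n) ^ 2 * (T.α j (unitCube n) / (144 * T.A))
      ≤ ((2 * ρ) ^ n) ^ 2 * T.α j Q := by
    rw [mul_div_assoc', div_le_iff₀ (by positivity)]
    calc (Q'.side ^ n) ^ 2 * T.α j (unitCube n) ≤ (Q'.side ^ n) ^ 2 * (2 * T.α j R) := by gcongr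
      _ = 2 * ((Q'.side ^ n) ^ 2 * T.α j R) := by ring
      _ ≤ 2 * (36 * T.A * (R.side ^ n) ^ 2 * T.α j Q') := by gcongr
      _ ≤ 2 * (36 * T.A * (R.side ^ n) ^ 2 * (2 * T.α j Q)) := by
          have : 0 ≤ R.side := R.side_pos.le
          gcongr
      _ = _ := by rw [hRs]; ring
  have k0 : 0 < T.α j (unitCube n) / (144 * T.A) := div_pos (T.α_pos j _) (by positivity)
  have k5 := Real.log_le_log (by positivity) k4
  rw [Real.log_mul (by positivity) k0.ne', Real.log_mul (by positivity) (T.α_pos j Q).ne',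
    Real.log_pow, Real.log_pow, Real.log_pow, Real.log_pow] at k5
  have k6 : Real.log Q'.side = -max 0 (-Real.log Q.side) := by
    rw [hs]
    rcases le_total Q.side 1 with h | h
    · rw [min_eq_left h, max_eq_right (neg_nonneg.2 (Real.log_nonpos Q.side_pos.le h)), neg_neg]
    · rw [min_eq_right h, max_eq_left (neg_nonpos.2 (Real.log_nonneg h))]; simp
  have k7 : Real.log (2 * ρ) ≤ 3 * Real.log (Real.exp 1 + ‖y‖) := by
    have e1 : 2 * ρ ≤ Real.exp 1 ^ 2 * (Real.exp 1 + ‖y‖) := by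
      have e2 : 2 ≤ Real.exp 1 := by linarith [Real.add_one_le_exp 1]
      have e3 : 2 ≤ Real.exp 1 ^ 2 := by nlinarith
      have := norm_nonneg y
      rw [hρ]
      gcongr
    have := Real.log_le_log (by positivity) e1
    rw [Real.log_mul (by positivity) (base_pos y).ne', Real.log_pow, Real.log_exp] at this
    have := one_le_log_base y
    push_cast at *
    linarith
  have hl := one_le_lg Q y
  have hcj : |c j| ≤ ∑ j, |c j| :=
    Finset.single_le_sum (f := fun j => |c j|) (fun _ _ => abs_nonneg _) (Finset.mem_univ j)
  have hcl : -((∑ j, |c j|) * lg Q y) ≤ c j := by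
    have : |c j| ≤ (∑ j, |c j|) * lg Q y :=
      hcj.trans (le_mul_of_one_le_right ((abs_nonneg _).trans hcj) hl)
    linarith [neg_abs_le (c j)]
  rw [k6] at k5
  push_cast at k5
  have hmax : max 0 (-Real.log Q.side) = lg Q y - Real.log (Real.exp 1 + ‖y‖) := by simp [lg]
  have h8 : (n : ℝ) * Real.log (2 * ρ) ≤ n * (3 * lg Q y) :=
    mul_le_mul_of_nonneg_left (k7.trans (by linarith [log_base_le_lg Q y])) (by positivity)
  have h9 : (n : ℝ) * max 0 (-Real.log Q.side) ≤ n * lg Q y :=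
    mul_le_mul_of_nonneg_left (by rw [hmax]; linarith [one_le_log_base y]) (by positivity)
  change _ ≤ _ at k5
  have hck : Real.log (T.α j (unitCube n) / (144 * T.A)) = c j := rfl
  rw [hck] at k5
  nlinarith

/-- The mass of a cube. -/
def m (j : Fin 3) (Q : Cube n) : ℝ := (T.ν j Q.toSet).toReal

lemma ν_le (j : Fin 3) (Q : Cube n) :
    T.ν j Q.toSet ≤ ENNReal.ofReal (max 1 (T.α j Q) ^ T.R) := by
  have hα := T.α_pos j Q
  have h1 : (1 : ℝ) ≤ max 1 (T.α j Q) := le_max_left _ _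
  have h : ∀ y, (1 : ℝ≥0∞) ≤ ENNReal.ofReal (max 1 (T.α j Q) ^ T.R) *
      ENNReal.ofReal (T.α j Q ^ (-T.r j y)) := by
    intro y
    rw [← ENNReal.ofReal_mul (by positivity), ENNReal.one_le_ofReal]
    calc (1 : ℝ) = T.α j Q ^ T.r j y * T.α j Q ^ (-T.r j y) := by
          rw [← Real.rpow_add hα]; simp
      _ ≤ _ := by
          gcongr
          calc T.α j Q ^ T.r j y ≤ max 1 (T.α j Q) ^ T.r j y :=
                Real.rpow_le_rpow hα.le (le_max_right _ _) (by linarith [T.half_le j y])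
            _ ≤ _ := Real.rpow_le_rpow_of_exponent_le h1 (T.le_R j y)
  calc T.ν j Q.toSet = ∫⁻ y in Q.toSet, 1 ∂(T.ν j) := by simp
    _ ≤ ∫⁻ y in Q.toSet, ENNReal.ofReal (max 1 (T.α j Q) ^ T.R) *
      ENNReal.ofReal (T.α j Q ^ (-T.r j y)) ∂(T.ν j) := lintegral_mono fun y => h y
    _ ≤ ENNReal.ofReal (max 1 (T.α j Q) ^ T.R) * 1 := by
        rw [lintegral_const_mul' _ _ ENNReal.ofReal_ne_top]
        exact mul_le_mul' le_rfl (T.lintegral_α_le j Q)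
    _ = _ := mul_one _

lemma ν_ne_top (j : Fin 3) (Q : Cube n) : T.ν j Q.toSet ≠ ∞ :=
  ((T.ν_le j Q).trans_lt ENNReal.ofReal_lt_top).ne

lemma ofReal_m (j : Fin 3) (Q : Cube n) : ENNReal.ofReal (T.m j Q) = T.ν j Q.toSet :=
  ENNReal.ofReal_toReal (T.ν_ne_top j Q)

lemma one_lt_mul_m (j : Fin 3) (Q : Cube n) : 1 < max 1 (3 / T.α j Q) ^ T.R * T.m j Q := by
  have hα := T.α_pos j Q
  have hnot : 1 < ∫⁻ y in Q.toSet, ENNReal.ofReal ((T.α j Q / 3) ^ (-T.r j y)) ∂(T.ν j) := by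
    by_contra! h
    have := T.α_le j Q (T.α j Q / 3) (by positivity) h
    linarith
  have h2 : ∫⁻ y in Q.toSet, ENNReal.ofReal ((T.α j Q / 3) ^ (-T.r j y)) ∂(T.ν j)
      ≤ ENNReal.ofReal (max 1 (3 / T.α j Q) ^ T.R * T.m j Q) := by
    rw [ENNReal.ofReal_mul (by positivity), T.ofReal_m, ← setLIntegral_const]
    refine lintegral_mono fun y => ENNReal.ofReal_le_ofReal ?_
    rw [Real.rpow_neg (by positivity), ← Real.inv_rpow (by positivity), inv_div]
    calc (3 / T.α j Q) ^ T.r j y ≤ max 1 (3 / T.α j Q) ^ T.r j y :=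
          Real.rpow_le_rpow (by positivity) (le_max_right _ _) (by linarith [T.half_le j y])
      _ ≤ _ := Real.rpow_le_rpow_of_exponent_le (le_max_left _ _) (T.le_R j y)
  have := hnot.trans_le h2
  rw [← ENNReal.ofReal_one, ENNReal.ofReal_lt_ofReal_iff'] at this
  exact this.1

lemma m_pos (j : Fin 3) (Q : Cube n) : 0 < T.m j Q := by
  have h := T.one_lt_mul_m j Q
  have : 0 < max 1 (3 / T.α j Q) ^ T.R := by positivity
  by_contra! h0
  nlinarith

lemma ν_ne_zero (j : Fin 3) (Q : Cube n) : T.ν j Q.toSet ≠ 0 := by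
  rw [← T.ofReal_m]; simpa using T.m_pos j Q

lemma exists_neg_lg_le_log_m : ∃ κ, 0 ≤ κ ∧ ∀ j Q, ∀ y ∈ Q.toSet,
    -κ * lg Q y ≤ Real.log (T.m j Q) := by
  obtain ⟨κ, hκ, h⟩ := T.exists_neg_lg_le_log_α
  have hR := T.half_le_R
  have h3 : 0 ≤ Real.log 3 := Real.log_nonneg (by norm_num)
  refine ⟨T.R * (Real.log 3 + κ), by positivity, fun j Q y hy => ?_⟩
  have hl := one_le_lg Q y
  have h1 := Real.log_le_log one_pos (T.one_lt_mul_m j Q).le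
  have h2 := h j Q y hy
  rw [Real.log_one, Real.log_mul (by positivity) (T.m_pos j Q).ne', Real.log_rpow (by positivity)]
    at h1
  have h4 : Real.log (max 1 (3 / T.α j Q)) ≤ (Real.log 3 + κ) * lg Q y := by
    rcases max_cases 1 (3 / T.α j Q) with h' | h'
    · rw [h'.1, Real.log_one]; positivity
    · rw [h'.1, Real.log_div (by norm_num) (T.α_pos j Q).ne']
      nlinarith
  have h5 : T.R * Real.log (max 1 (3 / T.α j Q)) ≤ T.R * ((Real.log 3 + κ) * lg Q y) :=
    mul_le_mul_of_nonneg_left h4 (by linarith)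
  linarith

end Triple

namespace Triple

variable (T : Triple n)

/-- A decay exponent for which `bump` is integrable against the weights. -/
def K : ℝ := 2 * n * T.R + 1

lemma K_nonneg : 0 ≤ T.K := by
  have := T.half_le_R
  unfold K; positivity

/-- The error function. -/
def b : Rn n → ℝ := bump T.K

lemma b_pos (y : Rn n) : 0 < T.b y := bump_pos _ y

lemma b_le_one (y : Rn n) : T.b y ≤ 1 := bump_le_one T.K_nonneg y

lemma measurable_b : Measurable T.b := measurable_bump _

lemma exists_ν_centered_le : ∃ C, 0 ≤ C ∧ ∀ j ρ, ∀ hρ : 1 ≤ ρ,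
    T.ν j (centered n ρ (by linarith)).toSet ≤ ENNReal.ofReal (C * ρ ^ (2 * n * T.R)) := by
  have hR := T.half_le_R
  have hA := T.A_pos
  set c : Fin 3 → ℝ := fun j => 36 * T.A * 2 ^ (2 * n) * T.α j (unitCube n) with hc
  have hc0 : ∀ j, 0 < c j := fun j => by have := T.α_pos j (unitCube n); positivity
  refine ⟨(1 + ∑ j, c j) ^ T.R, Real.rpow_nonneg (add_nonneg zero_le_one
      (Finset.sum_nonneg fun j _ => (hc0 j).le)) _, fun j ρ hρ => (T.ν_le j _).trans ?_⟩
  refine ENNReal.ofReal_le_ofReal ?_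
  have hρ0 : 0 < ρ := by linarith
  have hcj : c j ≤ ∑ j, c j :=
    Finset.single_le_sum (f := c) (fun j _ => (hc0 j).le) (Finset.mem_univ j)
  have h1 : T.α j (centered n ρ hρ0) ≤ c j * ρ ^ (2 * n) := by
    have := T.α_le_of_subset j (unitCube_subset (n := n) hρ)
    simp only [unitCube, one_pow, one_mul] at this
    refine this.trans (le_of_eq ?_)
    simp only [centered, hc, unitCube]
    ring
  have h2 : (1 : ℝ) ≤ ρ ^ (2 * n) := one_le_pow₀ hρ
  have hs := (hc0 j).le.trans hcj
  have h3 : max 1 (T.α j (centered n ρ hρ0)) ≤ (1 + ∑ j, c j) * ρ ^ (2 * n) := by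
    refine max_le (one_le_mul_of_one_le_of_one_le (by linarith) h2) (h1.trans ?_)
    gcongr
    linarith
  calc max 1 (T.α j (centered n ρ hρ0)) ^ T.R
      ≤ ((1 + ∑ j, c j) * ρ ^ (2 * n)) ^ T.R :=
        Real.rpow_le_rpow (by positivity) h3 (by linarith)
    _ = _ := by
        rw [Real.mul_rpow (by positivity) (by positivity), ← Real.rpow_natCast,
          ← Real.rpow_mul hρ0.le]
        push_cast
        rfl

lemma exists_lintegral_b_le : ∃ B, 0 ≤ B ∧ ∀ j,
    ∫⁻ y, ENNReal.ofReal (T.b y) ∂(T.ν j) ≤ ENNReal.ofReal B := by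
  obtain ⟨C, hC, h⟩ := T.exists_ν_centered_le
  have hR := T.half_le_R
  set N : ℝ := 2 * n * T.R with hN
  have hp : ∀ k : ℕ, (1 : ℝ) ≤ 2 ^ (k + 1) := fun k => one_le_pow₀ (by norm_num)
  have hp0 : ∀ k : ℕ, (0 : ℝ) < 2 ^ (k + 1) := fun k => by positivity
  refine ⟨C * 2 ^ N * 2, by positivity, fun j => ?_⟩
  calc ∫⁻ y, ENNReal.ofReal (T.b y) ∂(T.ν j)
      ≤ ∫⁻ y, ∑' k : ℕ, ENNReal.ofReal (((2 : ℝ) ^ k) ^ (-T.K)) *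
          (centered n (2 ^ (k + 1)) (hp0 k)).toSet.indicator 1 y ∂(T.ν j) := by
        refine lintegral_mono fun y => ?_
        obtain ⟨k, hk1, hk2⟩ := exists_nat_pow_near (x := Real.exp 1 + ‖y‖) (y := 2)
          ((Real.one_le_exp zero_le_one).trans (exp_one_le_base y)) (by norm_num)
        refine le_trans ?_ (ENNReal.le_tsum k)
        rw [indicator_of_mem (mem_centered (by linarith [Real.exp_pos 1])), Pi.one_apply, mul_one]
        exact ENNReal.ofReal_le_ofReal (Real.rpow_le_rpow_of_nonpos (by positivity) hk1
          (by linarith [T.K_nonneg]))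
    _ = ∑' k : ℕ, ENNReal.ofReal (((2 : ℝ) ^ k) ^ (-T.K)) *
          T.ν j (centered n (2 ^ (k + 1)) (hp0 k)).toSet := by
        rw [lintegral_tsum fun k => ((measurable_one.indicator
          (measurableSet_toSet _)).const_mul _).aemeasurable]
        congr 1 with k
        rw [lintegral_const_mul _ (measurable_one.indicator (measurableSet_toSet _)),
          lintegral_indicator_one (measurableSet_toSet _)]
    _ ≤ ∑' k : ℕ, ENNReal.ofReal (C * 2 ^ N * (1 / 2) ^ k) := by
        refine ENNReal.tsum_le_tsum fun k => ?_
        refine (mul_le_mul' le_rfl (h j _ (hp k))).trans (le_of_eq ?_)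
        rw [← ENNReal.ofReal_mul (by positivity)]
        congr 1
        have e : ((1 : ℝ) / 2) ^ k = 2 ^ (-(k : ℝ)) := by
          rw [Real.rpow_neg (by norm_num), Real.rpow_natCast, one_div, inv_pow]
        rw [e, ← Real.rpow_natCast, ← Real.rpow_mul (by norm_num), ← Real.rpow_natCast,
          ← Real.rpow_mul (by norm_num), mul_left_comm, mul_assoc, ← Real.rpow_add (by norm_num),
          ← Real.rpow_add (by norm_num)]
        congr 2
        simp only [K, ← hN]
        push_cast
        ring
    _ = _ := by
        rw [← ENNReal.ofReal_tsum_of_nonneg (fun k => by positivity)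
          (summable_geometric_two.mul_left _), tsum_mul_left, tsum_geometric_two]

/-- A majorant for the integrals of `b`. -/
def B : ℝ := T.exists_lintegral_b_le.choose

lemma B_nonneg : 0 ≤ T.B := T.exists_lintegral_b_le.choose_spec.1

lemma lintegral_b_le (j : Fin 3) : ∫⁻ y, ENNReal.ofReal (T.b y) ∂(T.ν j) ≤ ENNReal.ofReal T.B :=
  T.exists_lintegral_b_le.choose_spec.2 j

lemma L_nonneg : 0 ≤ T.L :=
  (mul_nonneg (abs_nonneg _) (by linarith [one_le_lg (unitCube n) (unitCube n).base])).trans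
    (T.holder 0 (unitCube n) _ (base_mem _))

lemma exists_m_le : ∃ C, 1 ≤ C ∧ ∀ j Q, T.m j Q ≤ C * T.α j Q ^ T.rQ j Q := by
  obtain ⟨κ, hκ, h⟩ := T.exists_neg_lg_le_log_α
  have hK := T.K_nonneg
  have hB := T.B_nonneg
  set D := Real.exp ((κ + 2 * T.K) * T.L)
  refine ⟨1 + (D + T.B), by have : 0 < D := Real.exp_pos _; linarith, fun j Q => ?_⟩
  have hα := T.α_pos j Q
  have key : ENNReal.ofReal (T.α j Q ^ (-T.rQ j Q) * T.m j Q) ≤ ENNReal.ofReal (D + T.B) := by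
    rw [ENNReal.ofReal_mul (by positivity), T.ofReal_m, ← setLIntegral_const,
      ENNReal.ofReal_add (Real.exp_pos _).le hB]
    calc _ ≤ ∫⁻ y in Q.toSet, (ENNReal.ofReal D * ENNReal.ofReal (T.α j Q ^ (-T.r j y))
          + ENNReal.ofReal (T.b y)) ∂(T.ν j) := by
          refine setLIntegral_mono' (measurableSet_toSet Q) fun y hy => ?_
          rw [← ENNReal.ofReal_mul (Real.exp_pos _).le, ← ENNReal.ofReal_add (by positivity)
            (T.b_pos y).le]
          refine ENNReal.ofReal_le_ofReal ?_
          refine rpow_neg_le hK (κ := κ + 2 * T.K) (by linarith) (Q := Q) hα ?_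
            (T.half_le_rQ j Q) ?_
          · have := h j Q y hy
            have := one_le_lg Q y
            nlinarith
          · rw [abs_sub_comm]; exact T.holder j Q y hy
      _ ≤ _ := by
          rw [lintegral_add_right _ T.measurable_b.ennreal_ofReal,
            lintegral_const_mul' _ _ ENNReal.ofReal_ne_top]
          refine add_le_add ?_ ((setLIntegral_le_lintegral _ _).trans (T.lintegral_b_le j))
          exact (mul_le_mul' le_rfl (T.lintegral_α_le j Q)).trans (mul_one _).le
  rw [ENNReal.ofReal_le_ofReal_iff (by positivity)] at key
  rw [Real.rpow_neg hα.le, inv_mul_le_iff₀ (by positivity)] at key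
  have : 0 < T.α j Q ^ T.rQ j Q := by positivity
  nlinarith

/-- The normalized mass of a cube. -/
def a (j : Fin 3) (Q : Cube n) : ℝ := T.m j Q ^ (1 / T.rQ j Q)

lemma a_pos (j : Fin 3) (Q : Cube n) : 0 < T.a j Q := Real.rpow_pos_of_pos (T.m_pos j Q) _

lemma rQ_pos (j : Fin 3) (Q : Cube n) : 0 < T.rQ j Q := by linarith [T.half_le_rQ j Q]

lemma a_rpow (j : Fin 3) (Q : Cube n) : T.a j Q ^ T.rQ j Q = T.m j Q := by
  rw [a, ← Real.rpow_mul (T.m_pos j Q).le, one_div, inv_mul_cancel₀ (T.rQ_pos j Q).ne',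
    Real.rpow_one]

lemma one_div_rQ_le (j : Fin 3) (Q : Cube n) : 1 / T.rQ j Q ≤ 2 := by
  rw [div_le_iff₀ (T.rQ_pos j Q)]; linarith [T.half_le_rQ j Q]

lemma exists_prod_a_le : ∃ C, 0 < C ∧ ∀ Q : Cube n, ∏ j, T.a j Q ≤ C * (Q.side ^ n) ^ 2 := by
  obtain ⟨C, hC, h⟩ := T.exists_m_le
  have hA := T.A_pos
  refine ⟨(C ^ 2) ^ 3 * T.A, by positivity, fun Q => ?_⟩
  have h1 : ∀ j, T.a j Q ≤ C ^ 2 * T.α j Q := by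
    intro j
    have hα := T.α_pos j Q
    have hr := T.rQ_pos j Q
    calc T.a j Q ≤ (C * T.α j Q ^ T.rQ j Q) ^ (1 / T.rQ j Q) :=
          Real.rpow_le_rpow (T.m_pos j Q).le (h j Q) (by positivity)
      _ = C ^ (1 / T.rQ j Q) * T.α j Q := by
          rw [Real.mul_rpow (by linarith) (by positivity), ← Real.rpow_mul hα.le, one_div,
            mul_inv_cancel₀ hr.ne', Real.rpow_one]
      _ ≤ C ^ (2 : ℝ) * T.α j Q := by
          gcongr
          exact T.one_div_rQ_le j Q
      _ = _ := by norm_num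
  calc ∏ j, T.a j Q ≤ ∏ j, C ^ 2 * T.α j Q :=
        Finset.prod_le_prod (fun j _ => (T.a_pos j Q).le) fun j _ => h1 j
    _ = (C ^ 2) ^ 3 * ∏ j, T.α j Q := by rw [Finset.prod_mul_distrib]; simp
    _ ≤ (C ^ 2) ^ 3 * (T.A * (Q.side ^ n) ^ 2) :=
        mul_le_mul_of_nonneg_left (T.prod_α_le Q) (by positivity)
    _ = _ := by ring

lemma ν_ne_top_of_subset {j : Fin 3} {Q : Cube n} {E : Set (Rn n)} (hE : E ⊆ Q.toSet) :
    T.ν j E ≠ ∞ := ((measure_mono hE).trans_lt (T.ν_ne_top j Q).lt_top).ne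

lemma exists_lintegral_a_le {ε : ℝ} (hε : 0 < ε) : ∃ C, 0 ≤ C ∧ ∀ j (Q : Cube n),
    ∀ E ⊆ Q.toSet, MeasurableSet E → ∫⁻ y in E, ENNReal.ofReal ((ε * T.a j Q) ^ (-T.r j y)) ∂(T.ν j)
      ≤ ENNReal.ofReal (C * ((T.ν j E).toReal / T.m j Q) + T.B) := by
  obtain ⟨κ, hκ, h⟩ := T.exists_neg_lg_le_log_m
  have hK := T.K_nonneg
  have hB := T.B_nonneg
  set κ' := |Real.log ε| + 2 * κ + 2 * T.K with hκ'
  set D := Real.exp (κ' * T.L) with hD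
  have hD0 : 0 < D := Real.exp_pos _
  refine ⟨D * max 1 ε⁻¹ ^ T.R, by positivity, fun j Q E hE hEm => ?_⟩
  have ha := T.a_pos j Q
  have hm := T.m_pos j Q
  have hr := T.rQ_pos j Q
  have hpt : ∀ y ∈ E, (ε * T.a j Q) ^ (-T.r j y) ≤ D * max 1 ε⁻¹ ^ T.R / T.m j Q + T.b y := by
    intro y hy
    have hl := one_le_lg Q y
    have h1 : (ε * T.a j Q) ^ (-T.r j y) ≤ D * (ε * T.a j Q) ^ (-T.rQ j Q) + bump T.K y := by
      refine rpow_neg_le hK (by have := abs_nonneg (Real.log ε); linarith) (Q := Q)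
        (mul_pos hε ha) ?_ (T.half_le j y) (T.holder j Q y (hE hy))
      rw [Real.log_mul hε.ne' ha.ne', a, Real.log_rpow hm]
      have h2 := h j Q y (hE hy)
      have h3 := T.one_div_rQ_le j Q
      have h4 : 0 < 1 / T.rQ j Q := by positivity
      have h5 : -(2 * κ * lg Q y) ≤ 1 / T.rQ j Q * Real.log (T.m j Q) := by
        have : 0 ≤ κ * lg Q y := by positivity
        nlinarith
      have h6 : -(|Real.log ε| * lg Q y) ≤ Real.log ε := by
        have := neg_abs_le (Real.log ε)
        nlinarith [abs_nonneg (Real.log ε)]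
      have h7 : 0 ≤ T.K * lg Q y := by positivity
      rw [hκ']
      linarith
    refine h1.trans (add_le_add ?_ le_rfl)
    rw [mul_div_assoc]
    refine mul_le_mul_of_nonneg_left ?_ hD0.le
    rw [Real.mul_rpow hε.le ha.le, Real.rpow_neg ha.le, T.a_rpow, ← div_eq_mul_inv]
    refine div_le_div_of_nonneg_right ?_ hm.le
    rw [Real.rpow_neg hε.le, ← Real.inv_rpow hε.le]
    calc ε⁻¹ ^ T.rQ j Q ≤ max 1 ε⁻¹ ^ T.rQ j Q :=
          Real.rpow_le_rpow (by positivity) (le_max_right _ _) hr.le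
      _ ≤ _ := Real.rpow_le_rpow_of_exponent_le (le_max_left _ _) (T.rQ_le_R j Q)
  calc _ ≤ ∫⁻ y in E, (ENNReal.ofReal (D * max 1 ε⁻¹ ^ T.R / T.m j Q)
        + ENNReal.ofReal (T.b y)) ∂(T.ν j) := by
        refine setLIntegral_mono' hEm fun y hy => ?_
        rw [← ENNReal.ofReal_add (by positivity) (T.b_pos y).le]
        exact ENNReal.ofReal_le_ofReal (hpt y hy)
    _ ≤ ENNReal.ofReal (D * max 1 ε⁻¹ ^ T.R / T.m j Q) * T.ν j E + ENNReal.ofReal T.B := by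
        rw [lintegral_add_right _ T.measurable_b.ennreal_ofReal, setLIntegral_const]
        exact add_le_add le_rfl ((setLIntegral_le_lintegral _ _).trans (T.lintegral_b_le j))
    _ = _ := by
        rw [ENNReal.ofReal_add (by positivity) hB]
        nth_rewrite 1 [← ENNReal.ofReal_toReal (T.ν_ne_top_of_subset (j := j) hE)]
        rw [← ENNReal.ofReal_mul (by positivity)]
        congr 2
        ring

lemma exists_ν_le_mul : ∃ C : ℝ≥0∞, C ≠ ∞ ∧ ∀ j (Q : Cube n), ∀ E ⊆ Q.toSet, MeasurableSet E →
    volume Q.toSet ≤ 2 * volume E → T.ν j Q.toSet ≤ C * T.ν j E := by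
  obtain ⟨A, hA, hprod⟩ := T.exists_prod_a_le
  obtain ⟨C₁, hC₁, h₁⟩ := T.exists_lintegral_a_le one_pos
  have hB := T.B_nonneg
  set S := 3 * (C₁ + T.B) with hS
  have hS0 : 0 ≤ S := by positivity
  set ε := (1 / (4 * (S + 1))) ^ 2 / A with hε
  have hε0 : 0 < ε := by positivity
  obtain ⟨C, hC, h⟩ := T.exists_lintegral_a_le hε0
  refine ⟨ENNReal.ofReal C, ENNReal.ofReal_ne_top, fun j Q E hE hEm hvol => ?_⟩
  set β : Fin 3 → ℝ := Function.update (fun k => T.a k Q) j (ε * T.a j Q) with hβ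
  have hβpos : ∀ k, 0 < β k := by
    intro k
    rcases eq_or_ne k j with rfl | hk
    · simp only [hβ, Function.update_self]; exact mul_pos hε0 (T.a_pos _ _)
    · simp only [hβ, Function.update_of_ne hk]; exact T.a_pos _ _
  have hm := T.m_pos j Q
  set x := (T.ν j E).toReal / T.m j Q with hx
  have hx0 : 0 ≤ x := by positivity
  have hV : 0 < Q.side ^ n := pow_pos Q.side_pos _
  have hprodβ : √(∏ k, β k) ≤ 1 / (4 * (S + 1)) * Q.side ^ n := by
    rw [Real.sqrt_le_left (by positivity)]
    have : ∏ k, β k = ε * ∏ k, T.a k Q := by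
      rw [hβ, Finset.prod_update_of_mem (Finset.mem_univ j),
        ← Finset.mul_prod_erase _ _ (Finset.mem_univ j), Finset.sdiff_singleton_eq_erase]
      ring
    rw [this]
    calc ε * ∏ k, T.a k Q ≤ ε * (A * (Q.side ^ n) ^ 2) :=
          mul_le_mul_of_nonneg_left (hprod Q) hε0.le
      _ = _ := by rw [hε]; field_simp
  have hsum : ∑ k, ∫⁻ y in E, ENNReal.ofReal (β k ^ (-T.r k y)) ∂(T.ν k)
      ≤ ENNReal.ofReal (C * x + S) := by
    have hbd : ∀ k, ∫⁻ y in E, ENNReal.ofReal (β k ^ (-T.r k y)) ∂(T.ν k)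
        ≤ ENNReal.ofReal ((if k = j then C * x else 0) + (C₁ + T.B)) := by
      intro k
      rcases eq_or_ne k j with rfl | hk
      · simp only [hβ, Function.update_self, if_true]
        exact (h k Q E hE hEm).trans (ENNReal.ofReal_le_ofReal (by linarith))
      · simp only [hβ, Function.update_of_ne hk, if_neg hk, zero_add]
        have := h₁ k Q E hE hEm
        rw [one_mul] at this
        refine this.trans (ENNReal.ofReal_le_ofReal (add_le_add ?_ le_rfl))
        refine mul_le_of_le_one_right hC₁ ((div_le_one (T.m_pos k Q)).2 ?_)
        exact ENNReal.toReal_mono (T.ν_ne_top k Q) (measure_mono hE)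
    refine (Finset.sum_le_sum fun k _ => hbd k).trans (le_of_eq ?_)
    rw [← ENNReal.ofReal_sum_of_nonneg]
    · congr 1
      rw [Finset.sum_add_distrib, Finset.sum_ite_eq', hS]
      simp
      ring
    · intro k _
      split_ifs <;> positivity
  have key : ENNReal.ofReal (Q.side ^ n) ≤
      ENNReal.ofReal (2 * (1 / (4 * (S + 1)) * Q.side ^ n * (C * x + S))) := by
    calc ENNReal.ofReal (Q.side ^ n) = volume Q.toSet := (volume_toSet Q).symm
      _ ≤ 2 * volume E := hvol
      _ ≤ 2 * (ENNReal.ofReal (1 / (4 * (S + 1)) * Q.side ^ n) * ENNReal.ofReal (C * x + S)) := by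
          refine mul_le_mul' le_rfl ((T.young β E hβpos hEm).trans ?_)
          exact mul_le_mul' (ENNReal.ofReal_le_ofReal hprodβ) hsum
      _ = _ := by
          rw [← ENNReal.ofReal_mul (by positivity), ENNReal.ofReal_mul zero_le_two,
            ENNReal.ofReal_ofNat]
  rw [ENNReal.ofReal_le_ofReal_iff (by positivity)] at key
  have h2 : 1 ≤ C * x := by
    have e : 2 * (1 / (4 * (S + 1)) * Q.side ^ n * (C * x + S))
        = Q.side ^ n * ((C * x + S) / (2 * (S + 1))) := by field_simp; ring
    rw [e] at key
    have := (le_mul_iff_one_le_right hV).1 key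
    rw [one_le_div (by positivity)] at this
    linarith
  rw [← T.ofReal_m, ← ENNReal.ofReal_toReal (T.ν_ne_top_of_subset (j := j) hE),
    ← ENNReal.ofReal_mul hC]
  refine ENNReal.ofReal_le_ofReal ?_
  rw [hx, mul_div_assoc', one_le_div hm] at h2
  exact h2

end Triple

lemma le_add_rpow_mul {g τ q : ℝ} (hg : 0 ≤ g) (hτ : 0 < τ) (hq : 1 ≤ q) :
    g ≤ τ + g ^ q * τ ^ (1 - q) := by
  have h0 : 0 ≤ g ^ q * τ ^ (1 - q) := by positivity
  rcases le_or_gt g τ with h | h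
  · linarith
  · have hg' : 0 < g := hτ.trans h
    have : g = g ^ q * g ^ (1 - q) := by rw [← Real.rpow_add hg']; simp
    have h2 : g ^ q * g ^ (1 - q) ≤ g ^ q * τ ^ (1 - q) :=
      mul_le_mul_of_nonneg_left (Real.rpow_le_rpow_of_nonpos hτ h.le (by linarith)) (by positivity)
    linarith

lemma le_exp_mul_of_log_le {g D b q q₀ κ l L : ℝ} (hg : 0 ≤ g) (hD : 0 < D) (hb : 0 < b)
    (hb1 : b ≤ 1) (hq : 1 ≤ q) (hq₀ : 1 ≤ q₀) (hκ : 0 ≤ κ) (hl : 1 ≤ l)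
    (hlb : |Real.log b| ≤ κ * l) (hlD : Real.log D ≤ κ * l) (hL : |q - q₀| * l ≤ L) :
    g ≤ Real.exp (κ * L) * (2 * D ^ (1 / q₀) + (g ^ q + b) * D ^ (1 / q₀ - 1)) := by
  have hL0 : 0 ≤ L := (mul_nonneg (abs_nonneg _) (by linarith)).trans hL
  have hC : 1 ≤ Real.exp (κ * L) := Real.one_le_exp (by positivity)
  set C := Real.exp (κ * L)
  set d := D ^ (1 / q₀) with hd
  have hd0 : 0 < d := Real.rpow_pos_of_pos hD _
  have e : D ^ (1 / q₀ - 1) = d ^ (1 - q₀) := by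
    rw [hd, ← Real.rpow_mul hD.le]
    congr 1
    field_simp
  rw [e]
  have h1 := le_add_rpow_mul hg (lt_max_of_lt_left hd0 : 0 < max d b) hq
  have hlem : ∀ t, 0 < t → |Real.log t| ≤ κ * l → t ^ (1 - q) ≤ C * t ^ (1 - q₀) := by
    intro t ht hlt
    refine rpow_le_exp_mul_rpow ht hlt hκ ?_
    have e : 1 - q - (1 - q₀) = -(q - q₀) := by ring
    rwa [e, abs_neg]
  have hlogd : Real.log d = 1 / q₀ * Real.log D := Real.log_rpow hD _
  have h2 : max d b ^ (1 - q) ≤ C * d ^ (1 - q₀) := by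
    rcases le_total b d with h | h
    · rw [max_eq_left h]
      refine hlem d hd0 (abs_le.2 ⟨?_, ?_⟩)
      · have := Real.log_le_log hb h
        have := (abs_le.1 hlb).1
        linarith
      · have hq1 : 1 / q₀ ≤ 1 := by rw [div_le_one (by linarith)]; exact hq₀
        have hq2 : 0 < 1 / q₀ := by positivity
        rw [hlogd]
        rcases le_total 0 (Real.log D) with h0 | h0
        · nlinarith
        · have : 0 ≤ κ * l := by positivity
          nlinarith
    · rw [max_eq_right h]
      refine (hlem b hb hlb).trans (mul_le_mul_of_nonneg_left ?_ (by linarith))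
      exact Real.rpow_le_rpow_of_nonpos hd0 h (by linarith)
  have h3 : max d b ≤ 2 * d + b * d ^ (1 - q₀) := by
    have h0 : 0 ≤ b * d ^ (1 - q₀) := by positivity
    refine max_le (by linarith) ?_
    rcases le_total d 1 with h | h
    · have : 1 ≤ d ^ (1 - q₀) := Real.one_le_rpow_of_pos_of_le_one_of_nonpos hd0 h (by linarith)
      nlinarith
    · linarith
  have h4 : g ^ q * max d b ^ (1 - q) ≤ g ^ q * (C * d ^ (1 - q₀)) :=
    mul_le_mul_of_nonneg_left h2 (by positivity)
  have h5 : 2 * d + b * d ^ (1 - q₀) ≤ C * (2 * d + b * d ^ (1 - q₀)) :=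
    le_mul_of_one_le_left (by positivity) hC
  linarith

/-- A triple in which the last two exponents are conjugate to exponents `p 0` and `p 1`, which are
bounded below by `s > 1` and whose harmonic sum is the first exponent. -/
structure BiTriple (n : ℕ) extends Triple n where
  p : Fin 2 → Rn n → ℝ
  P : Fin 2 → Cube n → ℝ
  s : ℝ
  one_lt_s : 1 < s
  s_le_p : ∀ i y, s ≤ p i y
  s_le_P : ∀ i Q, s ≤ P i Q
  measurable_p : ∀ i, Measurable (p i)
  holder_p : ∀ i Q, ∀ y ∈ Q.toSet, |p i y - P i Q| * lg Q y ≤ L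
  conj : ∀ (i : Fin 2) Q, 1 / rQ i.succ Q = 1 - 1 / P i Q
  sum_P : ∀ Q, 1 / rQ 0 Q = 1 / P 0 Q + 1 / P 1 Q

namespace BiTriple

variable (T : BiTriple n)

/-- The function to which Doob's inequality is applied. -/
def tilt (i : Fin 2) (g : Rn n → ℝ) (y : Rn n) : ℝ := g y ^ (T.p i y / T.s) + T.b y

variable {i : Fin 2} {g : Rn n → ℝ}

lemma s_pos : 0 < T.s := by linarith [T.one_lt_s]

lemma tilt_pos (hg : ∀ y, 0 ≤ g y) (y : Rn n) : 0 < T.tilt i g y :=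
  add_pos_of_nonneg_of_pos (Real.rpow_nonneg (hg y) _) (T.b_pos y)

lemma measurable_tilt (hgm : Measurable g) : Measurable (T.tilt i g) :=
  (hgm.pow ((T.measurable_p i).div_const _)).add T.measurable_b

/-- The average of the tilted function. -/
def D (i : Fin 2) (g : Rn n → ℝ) (Q : Cube n) : ℝ :=
  (avg (T.ν i.succ) (fun y => ENNReal.ofReal (T.tilt i g y)) Q).toReal

lemma lintegral_tilt_le (hg : ∀ y, 0 ≤ g y)
    (hg1 : ∫⁻ y, ENNReal.ofReal (g y ^ T.p i y) ∂(T.ν i.succ) ≤ 1) (Q : Cube n) :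
    ∫⁻ y in Q.toSet, ENNReal.ofReal (T.tilt i g y) ∂(T.ν i.succ)
      ≤ ENNReal.ofReal (2 * T.m i.succ Q + 1) := by
  have hm := T.m_pos i.succ Q
  have hs := T.one_lt_s
  calc _ ≤ ∫⁻ y in Q.toSet, (ENNReal.ofReal (g y ^ T.p i y) + 2) ∂(T.ν i.succ) := by
        refine lintegral_mono fun y => ?_
        rw [← ENNReal.ofReal_ofNat 2,
          ← ENNReal.ofReal_add (Real.rpow_nonneg (hg y) _) zero_le_two]
        refine ENNReal.ofReal_le_ofReal ?_
        have h1 := T.b_le_one y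
        have h2 : g y ^ (T.p i y / T.s) ≤ 1 + g y ^ T.p i y := by
          have h0 : 0 ≤ g y ^ T.p i y := Real.rpow_nonneg (hg y) _
          have hp : 0 < T.p i y := T.s_pos.trans_le (T.s_le_p i y)
          rcases le_total (g y) 1 with h | h
          · have : g y ^ (T.p i y / T.s) ≤ 1 :=
              Real.rpow_le_one (hg y) h (div_nonneg hp.le T.s_pos.le)
            linarith
          · have : g y ^ (T.p i y / T.s) ≤ g y ^ T.p i y :=
              Real.rpow_le_rpow_of_exponent_le h (div_le_self hp.le hs.le)
            linarith
        simp only [tilt]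
        linarith
    _ ≤ 1 + 2 * T.ν i.succ Q.toSet := by
        rw [lintegral_add_right _ measurable_const, setLIntegral_const]
        exact add_le_add ((setLIntegral_le_lintegral _ _).trans hg1) le_rfl
    _ = _ := by
        rw [ENNReal.ofReal_add (by positivity) zero_le_one, ENNReal.ofReal_mul zero_le_two,
          ← T.ofReal_m]
        simp [add_comm]

lemma ofReal_D (hg : ∀ y, 0 ≤ g y)
    (hg1 : ∫⁻ y, ENNReal.ofReal (g y ^ T.p i y) ∂(T.ν i.succ) ≤ 1) (Q : Cube n) :
    ENNReal.ofReal (T.D i g Q) = avg (T.ν i.succ) (fun y => ENNReal.ofReal (T.tilt i g y)) Q :=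
  ENNReal.ofReal_toReal (ENNReal.div_lt_top
    ((T.lintegral_tilt_le hg hg1 Q).trans_lt ENNReal.ofReal_lt_top).ne (T.ν_ne_zero _ Q)).ne

lemma lintegral_tilt_eq (hg : ∀ y, 0 ≤ g y)
    (hg1 : ∫⁻ y, ENNReal.ofReal (g y ^ T.p i y) ∂(T.ν i.succ) ≤ 1) (Q : Cube n) :
    ∫⁻ y in Q.toSet, ENNReal.ofReal (T.tilt i g y) ∂(T.ν i.succ)
      = ENNReal.ofReal (T.D i g Q * T.m i.succ Q) := by
  rw [ENNReal.ofReal_mul (show 0 ≤ T.D i g Q from ENNReal.toReal_nonneg), T.ofReal_D hg hg1, avg,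
    T.ofReal_m,
    ENNReal.div_mul_cancel (T.ν_ne_zero _ Q) (T.ν_ne_top _ Q)]

lemma D_pos (hg : ∀ y, 0 ≤ g y) (hgm : Measurable g)
    (hg1 : ∫⁻ y, ENNReal.ofReal (g y ^ T.p i y) ∂(T.ν i.succ) ≤ 1) (Q : Cube n) :
    0 < T.D i g Q := by
  have hm := T.m_pos i.succ Q
  have h : 0 < ∫⁻ y in Q.toSet, ENNReal.ofReal (T.tilt i g y) ∂(T.ν i.succ) := by
    rw [setLIntegral_pos_iff (T.measurable_tilt hgm).ennreal_ofReal]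
    have : Function.support (fun y => ENNReal.ofReal (T.tilt i g y)) = univ := by
      ext y; simpa using T.tilt_pos hg y
    rw [this, univ_inter]
    exact pos_iff_ne_zero.2 (T.ν_ne_zero _ Q)
  rw [T.lintegral_tilt_eq hg hg1, ENNReal.ofReal_pos] at h
  exact (pos_iff_pos_of_mul_pos h).2 hm

lemma exists_log_D_le : ∃ κ, 0 ≤ κ ∧ ∀ (i : Fin 2) (g : Rn n → ℝ), (∀ y, 0 ≤ g y) →
    Measurable g → ∫⁻ y, ENNReal.ofReal (g y ^ T.p i y) ∂(T.ν i.succ) ≤ 1 →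
    ∀ Q : Cube n, ∀ y ∈ Q.toSet, Real.log (T.D i g Q) ≤ κ * lg Q y := by
  obtain ⟨κ, hκ, h⟩ := T.exists_neg_lg_le_log_m
  have h3 : 0 ≤ Real.log 3 := Real.log_nonneg (by norm_num)
  refine ⟨Real.log 3 + κ, by positivity, fun i g hg hgm hg1 Q y hy => ?_⟩
  have hm := T.m_pos i.succ Q
  have hl := one_le_lg Q y
  have hD := T.D_pos hg hgm hg1 Q
  have h1 := T.lintegral_tilt_le hg hg1 Q
  rw [T.lintegral_tilt_eq hg hg1, ENNReal.ofReal_le_ofReal_iff (by positivity)] at h1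
  have h4 := h i.succ Q y hy
  rcases le_total 1 (T.m i.succ Q) with hm1 | hm1
  · have : T.D i g Q ≤ 3 := by nlinarith
    have := Real.log_le_log hD this
    have : 0 ≤ κ * lg Q y := by positivity
    nlinarith
  · have := Real.log_le_log (mul_pos hD hm) (h1.trans (show _ ≤ (3 : ℝ) by linarith))
    rw [Real.log_mul hD.ne' hm.ne'] at this
    nlinarith

lemma exists_lintegral_le : ∃ C, 0 ≤ C ∧ ∀ (i : Fin 2) (g : Rn n → ℝ), (∀ y, 0 ≤ g y) →
    Measurable g → ∫⁻ y, ENNReal.ofReal (g y ^ T.p i y) ∂(T.ν i.succ) ≤ 1 →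
    ∀ Q : Cube n, ∫⁻ y in Q.toSet, ENNReal.ofReal (g y) ∂(T.ν i.succ)
      ≤ ENNReal.ofReal (C * (T.m i.succ Q * T.D i g Q ^ (T.s / T.P i Q))) := by
  obtain ⟨κ, hκ, h⟩ := T.exists_log_D_le
  have hK := T.K_nonneg
  set C := Real.exp ((κ + T.K) * T.L) with hC
  have hC0 : 0 < C := Real.exp_pos _
  refine ⟨3 * C, by positivity, fun i g hg hgm hg1 Q => ?_⟩
  have hm := T.m_pos i.succ Q
  have hD := T.D_pos hg hgm hg1 Q
  have hs := T.s_pos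
  set d := T.D i g Q ^ (T.s / T.P i Q) with hd
  have hd0 : 0 < d := Real.rpow_pos_of_pos hD _
  set d' := T.D i g Q ^ (T.s / T.P i Q - 1) with hd'
  have hd'0 : 0 < d' := Real.rpow_pos_of_pos hD _
  have hdd : d' * T.D i g Q = d := by
    rw [hd', hd, Real.rpow_sub_one hD.ne', div_mul_cancel₀ _ hD.ne']
  calc _ ≤ ∫⁻ y in Q.toSet, (ENNReal.ofReal (C * (2 * d))
        + ENNReal.ofReal (C * d') * ENNReal.ofReal (T.tilt i g y)) ∂(T.ν i.succ) := by
        refine setLIntegral_mono' (measurableSet_toSet Q) fun y hy => ?_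
        have ht := T.tilt_pos (i := i) hg y
        rw [← ENNReal.ofReal_mul (by positivity), ← ENNReal.ofReal_add (by positivity)
          (by positivity)]
        refine ENNReal.ofReal_le_ofReal ?_
        have hl := one_le_lg Q y
        have hlb := log_base_le_lg Q y
        have hlb1 := one_le_log_base y
        have hsp := T.s_le_p i y
        have hsP := T.s_le_P i Q
        have key := le_exp_mul_of_log_le (hg y) hD (T.b_pos y) (T.b_le_one y)
          (q := T.p i y / T.s) (q₀ := T.P i Q / T.s) (κ := κ + T.K) (l := lg Q y) (L := T.L)
          ((one_le_div hs).2 hsp) ((one_le_div hs).2 hsP) (by positivity) hl ?_ ?_ ?_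
        · rw [one_div_div] at key
          refine key.trans (le_of_eq ?_)
          simp only [tilt, hd, hd', hC]
          ring
        · rw [Triple.b, log_bump, abs_mul, abs_neg, abs_of_nonneg hK,
            abs_of_nonneg (show 0 ≤ Real.log (Real.exp 1 + ‖y‖) by linarith)]
          nlinarith
        · have := h i g hg hgm hg1 Q y hy
          nlinarith
        · have := T.holder_p i Q y hy
          rw [← sub_div, abs_div, abs_of_pos hs]
          refine le_trans ?_ this
          exact mul_le_mul_of_nonneg_right (div_le_self (abs_nonneg _) T.one_lt_s.le)
            (by linarith)
    _ = ENNReal.ofReal (C * (2 * d)) * T.ν i.succ Q.toSet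
        + ENNReal.ofReal (C * d') * ENNReal.ofReal (T.D i g Q * T.m i.succ Q) := by
        rw [lintegral_add_left measurable_const, setLIntegral_const,
          lintegral_const_mul' _ _ ENNReal.ofReal_ne_top, T.lintegral_tilt_eq hg hg1]
    _ = _ := by
        rw [← T.ofReal_m, ← ENNReal.ofReal_mul (by positivity),
          ← ENNReal.ofReal_mul (by positivity),
          ← ENNReal.ofReal_add (by positivity) (by positivity)]
        congr 1
        linear_combination C * T.m i.succ Q * hdd

lemma lintegral_tilt_rpow_le (hg : ∀ y, 0 ≤ g y)
    (hg1 : ∫⁻ y, ENNReal.ofReal (g y ^ T.p i y) ∂(T.ν i.succ) ≤ 1) :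
    ∫⁻ y, ENNReal.ofReal (T.tilt i g y) ^ T.s ∂(T.ν i.succ)
      ≤ ENNReal.ofReal (2 ^ T.s * (1 + T.B)) := by
  have hs := T.one_lt_s
  have hB := T.B_nonneg
  calc _ ≤ ∫⁻ y, ENNReal.ofReal (2 ^ T.s) * (ENNReal.ofReal (g y ^ T.p i y)
        + ENNReal.ofReal (T.b y)) ∂(T.ν i.succ) := by
        refine lintegral_mono fun y => ?_
        have hgp : 0 ≤ g y ^ T.p i y := Real.rpow_nonneg (hg y) _
        have hb := T.b_pos y
        rw [ENNReal.ofReal_rpow_of_nonneg (T.tilt_pos hg y).le T.s_pos.le,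
          ← ENNReal.ofReal_add hgp hb.le, ← ENNReal.ofReal_mul (by positivity)]
        refine ENNReal.ofReal_le_ofReal ?_
        set x := g y ^ (T.p i y / T.s) with hx
        have hx0 : 0 ≤ x := Real.rpow_nonneg (hg y) _
        have hxs : x ^ T.s = g y ^ T.p i y := by
          rw [hx, ← Real.rpow_mul (hg y), div_mul_cancel₀ _ T.s_pos.ne']
        have hbs : T.b y ^ T.s ≤ T.b y := by
          calc T.b y ^ T.s ≤ T.b y ^ (1 : ℝ) :=
                Real.rpow_le_rpow_of_exponent_ge hb (T.b_le_one y) hs.le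
            _ = _ := Real.rpow_one _
        have hbs0 : 0 ≤ T.b y ^ T.s := by positivity
        calc (x + T.b y) ^ T.s ≤ (2 * max x (T.b y)) ^ T.s := by
              refine Real.rpow_le_rpow (by positivity) ?_ T.s_pos.le
              linarith [le_max_left x (T.b y), le_max_right x (T.b y)]
          _ = 2 ^ T.s * max x (T.b y) ^ T.s := Real.mul_rpow zero_le_two (by positivity)
          _ ≤ 2 ^ T.s * (g y ^ T.p i y + T.b y) := by
              refine mul_le_mul_of_nonneg_left ?_ (by positivity)
              rcases max_cases x (T.b y) with h | h <;> rw [h.1] <;> linarith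
    _ ≤ ENNReal.ofReal (2 ^ T.s) * (1 + ENNReal.ofReal T.B) := by
        rw [lintegral_const_mul' _ _ ENNReal.ofReal_ne_top,
          lintegral_add_right _ T.measurable_b.ennreal_ofReal]
        exact mul_le_mul' le_rfl (add_le_add hg1 (T.lintegral_b_le _))
    _ = _ := by
        rw [ENNReal.ofReal_mul (by positivity), ENNReal.ofReal_add zero_le_one hB,
          ENNReal.ofReal_one]

lemma m_mul_D_rpow_le (hg : ∀ y, 0 ≤ g y) (hgm : Measurable g)
    (hg1 : ∫⁻ y, ENNReal.ofReal (g y ^ T.p i y) ∂(T.ν i.succ) ≤ 1) (Q : Cube n) :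
    T.m i.succ Q * T.D i g Q ^ T.s ≤ 2 ^ T.s * (2 ^ T.s * (1 + T.B)) := by
  have hs := T.one_lt_s
  have hB := T.B_nonneg
  have hm := T.m_pos i.succ Q
  have hD := T.D_pos hg hgm hg1 Q
  set D := T.D i g Q
  set Γ := 2 ^ T.s * (1 + T.B) with hΓ
  have hΓ0 : 0 ≤ Γ := by positivity
  have key : ENNReal.ofReal (D * T.m i.succ Q) ≤
      ENNReal.ofReal (D / 2 * T.m i.succ Q + (D / 2) ^ (1 - T.s) * Γ) := by
    rw [← T.lintegral_tilt_eq hg hg1, ENNReal.ofReal_add (by positivity) (by positivity),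
      ENNReal.ofReal_mul (by positivity), ENNReal.ofReal_mul (by positivity), T.ofReal_m]
    calc _ ≤ ∫⁻ y in Q.toSet, (ENNReal.ofReal (D / 2) +
          ENNReal.ofReal ((D / 2) ^ (1 - T.s)) * ENNReal.ofReal (T.tilt i g y) ^ T.s)
            ∂(T.ν i.succ) := by
          refine lintegral_mono fun y => ?_
          have ht := T.tilt_pos (i := i) hg y
          rw [ENNReal.ofReal_rpow_of_nonneg ht.le T.s_pos.le, ← ENNReal.ofReal_mul (by positivity),
            ← ENNReal.ofReal_add (by positivity) (by positivity)]
          refine ENNReal.ofReal_le_ofReal ?_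
          have := le_add_rpow_mul ht.le (half_pos hD) hs.le
          linarith
      _ ≤ _ := by
          rw [lintegral_add_left measurable_const, setLIntegral_const,
            lintegral_const_mul' _ _ ENNReal.ofReal_ne_top]
          gcongr
          exact (setLIntegral_le_lintegral _ _).trans (T.lintegral_tilt_rpow_le hg hg1)
  rw [ENNReal.ofReal_le_ofReal_iff (by positivity)] at key
  have h1 : D / 2 * T.m i.succ Q ≤ (D / 2) ^ (1 - T.s) * Γ := by linarith
  have h2 : (D / 2) ^ (T.s - 1) * (D / 2 * T.m i.succ Q) ≤ Γ := by
    refine (mul_le_mul_of_nonneg_left h1 (by positivity)).trans (le_of_eq ?_)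
    rw [← mul_assoc, ← Real.rpow_add (by positivity)]
    simp
  have h3 : (D / 2) ^ (T.s - 1) * (D / 2) = (D / 2) ^ T.s := by
    rw [Real.rpow_sub_one (by positivity), div_mul_cancel₀ _ (by positivity)]
  rw [← mul_assoc, h3, Real.div_rpow hD.le zero_le_two, div_mul_eq_mul_div,
    div_le_iff₀ (by positivity)] at h2
  linarith

end BiTriple

namespace BiTriple

variable (T : BiTriple n)

/-- Nonnegative functions in the unit ball of the weighted space of index `i`. -/
structure UnitBall (g : Fin 2 → Rn n → ℝ) : Prop where
  nonneg : ∀ i y, 0 ≤ g i y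
  measurable : ∀ i, Measurable (g i)
  le_one : ∀ i, ∫⁻ y, ENNReal.ofReal (g i y ^ T.p i y) ∂(T.ν (Fin.succ i)) ≤ 1

/-- The function on `ℝⁿ` whose average is taken. -/
def dens (g : Fin 2 → Rn n → ℝ) (i : Fin 2) (y : Rn n) : ℝ≥0∞ :=
  T.φ i.succ y * ENNReal.ofReal (g i y)

/-- The energy of a cube. -/
def e (g : Fin 2 → Rn n → ℝ) (i : Fin 2) (Q : Cube n) : ℝ :=
  T.m i.succ Q * T.D i (g i) Q ^ T.s

variable {T} {g : Fin 2 → Rn n → ℝ}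

lemma UnitBall.e_pos (h : T.UnitBall g) (i : Fin 2) (Q : Cube n) : 0 < T.e g i Q :=
  mul_pos (T.m_pos _ _)
    (Real.rpow_pos_of_pos (T.D_pos (h.nonneg i) (h.measurable i) (h.le_one i) Q) _)

lemma UnitBall.lintegral_dens (h : T.UnitBall g) (i : Fin 2) (Q : Cube n) :
    ∫⁻ y in Q.toSet, T.dens g i y = ∫⁻ y in Q.toSet, ENNReal.ofReal (g i y) ∂(T.ν i.succ) := by
  rw [Triple.ν, setLIntegral_withDensity_eq_setLIntegral_mul _ (T.measurable_φ _)
    (h.measurable i).ennreal_ofReal (measurableSet_toSet Q)]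
  rfl

lemma P_pos (T : BiTriple n) (i : Fin 2) (Q : Cube n) : 0 < T.P i Q :=
  T.s_pos.trans_le (T.s_le_P i Q)

lemma m_mul_D_rpow (h : T.UnitBall g) (i : Fin 2) (Q : Cube n) :
    T.m i.succ Q * T.D i (g i) Q ^ (T.s / T.P i Q)
      = T.a i.succ Q * T.e g i Q ^ (1 / T.P i Q) := by
  have hm := T.m_pos i.succ Q
  have hD := T.D_pos (h.nonneg i) (h.measurable i) (h.le_one i) Q
  rw [e, Real.mul_rpow hm.le (by positivity), ← Real.rpow_mul hD.le, Triple.a, T.conj,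
    mul_one_div, ← mul_assoc, ← Real.rpow_add hm, sub_add_cancel, Real.rpow_one]

variable (T)

lemma exists_biAvg_le : ∃ C, 0 < C ∧ ∀ g, T.UnitBall g → ∀ Q : Cube n,
    biAvg (T.dens g 0) (T.dens g 1) Q ≤
      ENNReal.ofReal (C / T.a 0 Q * ∏ i, T.e g i Q ^ (1 / T.P i Q)) := by
  obtain ⟨C, hC, h⟩ := T.exists_lintegral_le
  obtain ⟨A, hA, hprod⟩ := T.exists_prod_a_le
  refine ⟨(C ^ 2 + 1) * A, by positivity, fun g hg Q => ?_⟩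
  have hV : 0 < Q.side ^ n := pow_pos Q.side_pos n
  have key : ∀ i, avg volume (T.dens g i) Q ≤
      ENNReal.ofReal (C * (T.a i.succ Q * T.e g i Q ^ (1 / T.P i Q)) / Q.side ^ n) := by
    intro i
    rw [avg, volume_toSet, Cube.vol, ENNReal.ofReal_div_of_pos hV, hg.lintegral_dens,
      ← m_mul_D_rpow hg]
    exact ENNReal.div_le_div_right (h i _ (hg.nonneg i) (hg.measurable i) (hg.le_one i) Q) _
  have he : ∀ i, 0 < T.e g i Q ^ (1 / T.P i Q) := fun i => Real.rpow_pos_of_pos (hg.e_pos i Q) _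
  have ha := fun j => T.a_pos j Q
  have h0 := he 0
  have h1 := he 1
  refine (mul_le_mul' (key 0) (key 1)).trans ?_
  have ha1 := ha (Fin.succ 0)
  have ha2 := ha (Fin.succ 1)
  rw [← ENNReal.ofReal_mul (by positivity), Fin.prod_univ_two]
  refine ENNReal.ofReal_le_ofReal ?_
  have hp := hprod Q
  rw [Fin.prod_univ_three] at hp
  have ha0 := ha 0
  rw [div_mul_div_comm, div_mul_eq_mul_div, div_le_div_iff₀ (by positivity) ha0]
  set E := T.e g 0 Q ^ (1 / T.P 0 Q) * T.e g 1 Q ^ (1 / T.P 1 Q) with hE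
  have hE0 : 0 < E := mul_pos h0 h1
  have hpos : 0 < T.a 0 Q * T.a 1 Q * T.a 2 Q := mul_pos (mul_pos ha0 (ha 1)) (ha 2)
  calc _ = C ^ 2 * (T.a 0 Q * T.a 1 Q * T.a 2 Q) * E := by
        rw [hE]
        change C * (T.a 1 Q * _) * (C * (T.a 2 Q * _)) * _ = _
        ring
    _ ≤ (C ^ 2 + 1) * (A * (Q.side ^ n) ^ 2) * E := by
        gcongr
        linarith
    _ = _ := by ring

lemma exists_lintegral_biAvg_le : ∃ C, 0 ≤ C ∧ ∀ g, T.UnitBall g → ∀ Q : Cube n,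
    ∀ E ⊆ Q.toSet, MeasurableSet E →
    ∫⁻ y in E, (4 * biAvg (T.dens g 0) (T.dens g 1) Q) ^ T.r 0 y ∂(T.ν 0) ≤
      ENNReal.ofReal (C * ∑ i, T.e g i Q) + ∫⁻ y in E, ENNReal.ofReal (T.b y) ∂(T.ν 0) := by
  obtain ⟨C, hC, h⟩ := T.exists_biAvg_le
  obtain ⟨κ, hκ, hlog⟩ := T.exists_neg_lg_le_log_m
  have hK := T.K_nonneg
  have hL := T.L_nonneg
  set Γ := 2 ^ T.s * (2 ^ T.s * (1 + T.B)) with hΓ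
  set κ' := |Real.log (4 * C)| + 2 * κ + 2 * |Real.log Γ| + 2 * T.K with hκ'
  have hκ'0 : 0 ≤ κ' := by positivity
  set X := Real.exp (κ' * T.L) * max 1 (4 * C) ^ T.R with hX
  have hX0 : 0 ≤ X := by positivity
  refine ⟨X, hX0, fun g hg Q E hE hEm => ?_⟩
  have hm := T.m_pos 0 Q
  have ha := T.a_pos 0 Q
  have hr := T.rQ_pos 0 Q
  have he := fun i => hg.e_pos i Q
  set S := ∏ i, T.e g i Q ^ (1 / T.P i Q) with hS
  have hS0 : 0 < S := Finset.prod_pos fun i _ => Real.rpow_pos_of_pos (he i) _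
  set u := 4 * C / T.a 0 Q * S with hu
  have hu0 : 0 < u := by positivity
  have hsum0 : 0 < ∑ i, T.e g i Q := Finset.sum_pos (fun i _ => he i) ⟨0, Finset.mem_univ _⟩
  have hloga : Real.log (T.a 0 Q) = 1 / T.rQ 0 Q * Real.log (T.m 0 Q) := Real.log_rpow hm _
  have hlogS : Real.log S ≤ 2 * |Real.log Γ| := by
    rw [hS, Real.log_prod fun i _ => (Real.rpow_pos_of_pos (he i) _).ne', two_mul,
      Fin.sum_univ_two]
    have : ∀ i, Real.log (T.e g i Q ^ (1 / T.P i Q)) ≤ |Real.log Γ| := by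
      intro i
      have hP := T.P_pos i Q
      have hP1 : 1 / T.P i Q ≤ 1 := by
        rw [div_le_one hP]; linarith [T.s_le_P i Q, T.one_lt_s]
      rw [Real.log_rpow (he i)]
      have h1 : Real.log (T.e g i Q) ≤ |Real.log Γ| := (Real.log_le_log (he i)
        (T.m_mul_D_rpow_le (hg.nonneg i) (hg.measurable i) (hg.le_one i) Q)).trans (le_abs_self _)
      calc 1 / T.P i Q * Real.log (T.e g i Q) ≤ 1 / T.P i Q * |Real.log Γ| :=
            mul_le_mul_of_nonneg_left h1 (by positivity)
        _ ≤ 1 * |Real.log Γ| := mul_le_mul_of_nonneg_right hP1 (abs_nonneg _)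
        _ = _ := one_mul _
    exact add_le_add (this 0) (this 1)
  have hpow : u ^ T.rQ 0 Q ≤ max 1 (4 * C) ^ T.R * (∑ i, T.e g i Q) / T.m 0 Q := by
    have h1 : (4 * C) ^ T.rQ 0 Q ≤ max 1 (4 * C) ^ T.R :=
      (Real.rpow_le_rpow (by positivity) (le_max_right _ _) hr.le).trans
        (Real.rpow_le_rpow_of_exponent_le (le_max_left _ _) (T.rQ_le_R 0 Q))
    have h2 : S ^ T.rQ 0 Q ≤ ∑ i, T.e g i Q := by
      have hθ : ∀ i, 0 < 1 / T.P i Q * T.rQ 0 Q := fun i =>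
        mul_pos (one_div_pos.2 (T.P_pos i Q)) hr
      have hθ1 : 1 / T.P 0 Q * T.rQ 0 Q + 1 / T.P 1 Q * T.rQ 0 Q = 1 := by
        rw [← add_mul, ← T.sum_P]; exact one_div_mul_cancel hr.ne'
      rw [hS, Fin.prod_univ_two, Fin.sum_univ_two, Real.mul_rpow (Real.rpow_nonneg (he 0).le _)
        (Real.rpow_nonneg (he 1).le _), ← Real.rpow_mul (he 0).le, ← Real.rpow_mul (he 1).le]
      refine (Real.geom_mean_le_arith_mean2_weighted (hθ 0).le (hθ 1).le (he 0).le (he 1).le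
        hθ1).trans (add_le_add ?_ ?_)
      · exact mul_le_of_le_one_left (he 0).le (by linarith [hθ 1])
      · exact mul_le_of_le_one_left (he 1).le (by linarith [hθ 0])
    rw [hu, Real.mul_rpow (by positivity) hS0.le, Real.div_rpow (by positivity) ha.le, T.a_rpow,
      div_mul_eq_mul_div]
    gcongr
  have hpt : ∀ y ∈ E, (4 * biAvg (T.dens g 0) (T.dens g 1) Q) ^ T.r 0 y ≤
      ENNReal.ofReal (X * (∑ i, T.e g i Q) / T.m 0 Q) + ENNReal.ofReal (T.b y) := by
    intro y hy
    have hry : 0 ≤ T.r 0 y := by linarith [T.half_le 0 y]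
    have hl := one_le_lg Q y
    have hu1 : 4 * biAvg (T.dens g 0) (T.dens g 1) Q ≤ ENNReal.ofReal u := by
      refine (mul_le_mul' le_rfl (h g hg Q)).trans (le_of_eq ?_)
      rw [← ENNReal.ofReal_ofNat 4, ← ENNReal.ofReal_mul (by norm_num), hu]
      congr 1
      ring
    refine (ENNReal.rpow_le_rpow hu1 hry).trans ?_
    rw [ENNReal.ofReal_rpow_of_pos hu0, ← ENNReal.ofReal_add (by positivity) (T.b_pos y).le]
    refine ENNReal.ofReal_le_ofReal ?_
    have hlu : Real.log u ≤ κ' * lg Q y := by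
      rw [hu, Real.log_mul (by positivity) hS0.ne', Real.log_div (by positivity) ha.ne', hloga]
      have h1 := hlog 0 Q y (hE hy)
      have h2 := T.one_div_rQ_le 0 Q
      have h3 : 0 ≤ 1 / T.rQ 0 Q := by positivity
      have h4 := le_abs_self (Real.log (4 * C))
      have h5 := abs_nonneg (Real.log (4 * C))
      have h6 := abs_nonneg (Real.log Γ)
      have h7 : -(1 / T.rQ 0 Q * Real.log (T.m 0 Q)) ≤ 2 * κ * lg Q y := by
        have h8 : 0 ≤ κ * lg Q y := by positivity
        nlinarith
      have h9 : |Real.log (4 * C)| ≤ |Real.log (4 * C)| * lg Q y := le_mul_of_one_le_right h5 hl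
      have h10 : |Real.log Γ| ≤ |Real.log Γ| * lg Q y := le_mul_of_one_le_right h6 hl
      have h11 : 0 ≤ T.K * lg Q y := by positivity
      rw [hκ']
      nlinarith
    have key := rpow_neg_le (K := T.K) (κ := κ') (L := T.L) (Q := Q) (y := y) (t := u⁻¹)
      (a := T.r 0 y) (b := T.rQ 0 Q) hK
      (by have := abs_nonneg (Real.log (4 * C)); have := abs_nonneg (Real.log Γ); linarith)
      (inv_pos.2 hu0) (by rw [Real.log_inv]; linarith) (T.half_le 0 y) (T.holder 0 Q y (hE hy))
    rw [Real.inv_rpow hu0.le, Real.inv_rpow hu0.le, Real.rpow_neg hu0.le, Real.rpow_neg hu0.le,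
      inv_inv, inv_inv] at key
    refine key.trans (add_le_add ?_ le_rfl)
    calc Real.exp (κ' * T.L) * u ^ T.rQ 0 Q
        ≤ Real.exp (κ' * T.L) * (max 1 (4 * C) ^ T.R * (∑ i, T.e g i Q) / T.m 0 Q) := by gcongr
      _ = _ := by rw [hX]; ring
  calc _ ≤ ∫⁻ y in E, (ENNReal.ofReal (X * (∑ i, T.e g i Q) / T.m 0 Q)
        + ENNReal.ofReal (T.b y)) ∂(T.ν 0) := setLIntegral_mono' hEm hpt
    _ ≤ _ := by
        rw [lintegral_add_left measurable_const, setLIntegral_const]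
        refine add_le_add ?_ le_rfl
        calc _ ≤ ENNReal.ofReal (X * (∑ i, T.e g i Q) / T.m 0 Q) * T.ν 0 Q.toSet :=
              mul_le_mul' le_rfl (measure_mono hE)
          _ = _ := by
              rw [← T.ofReal_m, ← ENNReal.ofReal_mul (by positivity), div_mul_cancel₀ _ hm.ne']

/-- The modular form of the weighted bilinear inequality for a dyadic grid. -/
lemma exists_lintegral_gridSup_le : ∃ C : ℝ≥0∞, C ≠ ∞ ∧ ∀ g, T.UnitBall g →
    ∀ (G : Grid n) (J : Finset ℤ),
    ∫⁻ x, gridSup G J (biAvg (T.dens g 0) (T.dens g 1)) x ^ T.r 0 x ∂(T.ν 0) ≤ C := by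
  obtain ⟨C₁, hC₁, h₁⟩ := T.exists_lintegral_biAvg_le
  obtain ⟨C₂, hC₂, h₂⟩ := T.exists_ν_le_mul
  obtain ⟨C₃, hC₃, h₃⟩ := lintegral_gridSup_rpow_le (n := n) T.one_lt_s
  obtain ⟨C₄, hC₄, h₄⟩ := T.exists_lintegral_le
  set Γ := ENNReal.ofReal (2 ^ T.s * (1 + T.B)) with hΓ
  refine ⟨2 * (ENNReal.ofReal C₁ * C₂ * (C₃ * Γ + C₃ * Γ) + ENNReal.ofReal T.B),
    by finiteness, fun g hg G J => ?_⟩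
  have hr : ∀ x, 0 < T.r 0 x := fun x => by linarith [T.half_le 0 x]
  set f := T.dens g with hf
  set W : Fin 2 → Cube n → ℝ≥0∞ := fun i =>
    avg (T.ν i.succ) (fun y => ENNReal.ofReal (T.tilt i (g i) y)) with hW
  set M : Fin 2 → Rn n → ℝ≥0∞ := fun i x => gridSup G J (W i) x ^ T.s with hM
  have hMm : ∀ i, Measurable (M i) := fun i => (measurable_gridSup G J (W i)).pow_const _
  have hWD : ∀ i Q, W i Q = ENNReal.ofReal (T.D i (g i) Q) := fun i Q =>
    (T.ofReal_D (hg.nonneg i) (hg.le_one i) Q).symm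
  have hfin : ∀ i (Q : Cube n), ∫⁻ x in Q.toSet, f i x ≠ ∞ := fun i Q => by
    rw [hf, hg.lintegral_dens]
    exact ((h₄ i _ (hg.nonneg i) (hg.measurable i) (hg.le_one i) Q).trans_lt
      ENNReal.ofReal_lt_top).ne
  set Z := ENNReal.ofReal C₁ * C₂ with hZ
  have hZt : Z ≠ ∞ := by finiteness
  set K : Rn n → ℝ≥0∞ := fun x => Z * (T.φ 1 x * M 0 x + T.φ 2 x * M 1 x)
    + T.φ 0 x * ENNReal.ofReal (T.b x) with hK
  have hφM : ∀ i, Measurable fun x => T.φ (Fin.succ i) x * M i x :=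
    fun i => (T.measurable_φ _).mul (hMm i)
  have hφM0 : Measurable fun x => T.φ 1 x * M 0 x := hφM 0
  have hφM1 : Measurable fun x => T.φ 2 x * M 1 x := hφM 1
  have hKE : ∀ E, MeasurableSet E → ∫⁻ x in E, K x =
      Z * (∫⁻ x in E, M 0 x ∂(T.ν 1) + ∫⁻ x in E, M 1 x ∂(T.ν 2))
        + ∫⁻ x in E, ENNReal.ofReal (T.b x) ∂(T.ν 0) := by
    intro E hE
    have hmeas : Measurable fun x => Z * (T.φ 1 x * M 0 x + T.φ 2 x * M 1 x) :=
      (hφM0.add hφM1).const_mul Z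
    simp only [hK]
    rw [lintegral_add_left hmeas,
      lintegral_const_mul' _ _ hZt, lintegral_add_left hφM0]
    simp only [Triple.ν]
    rw [setLIntegral_withDensity_eq_setLIntegral_mul _ (T.measurable_φ _) (hMm 0) hE,
      setLIntegral_withDensity_eq_setLIntegral_mul _ (T.measurable_φ _) (hMm 1) hE,
      setLIntegral_withDensity_eq_setLIntegral_mul _ (T.measurable_φ _)
        T.measurable_b.ennreal_ofReal hE]
    rfl
  have hrpm : ∀ F : Rn n → ℝ≥0∞, Measurable F → Measurable fun x => F x ^ T.r 0 x :=
    fun F hF => hF.pow (T.measurable_r 0)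
  have e1 : ∀ E, MeasurableSet E → ∀ F : Rn n → ℝ≥0∞, Measurable F →
      ∫⁻ x in E, F x ^ T.r 0 x ∂(T.ν 0) = ∫⁻ x in E, T.φ 0 x * F x ^ T.r 0 x := by
    intro E hE F hF
    rw [Triple.ν, setLIntegral_withDensity_eq_setLIntegral_mul _ (T.measurable_φ _) (hrpm F hF) hE]
    rfl
  have main := lintegral_comp_gridSup_le (G := G) (J := J) (hfin 0) (hfin 1)
    (Ψ := fun a x => T.φ 0 x * a ^ T.r 0 x) (K := K)
    (fun x a b hab => mul_le_mul' le_rfl (ENNReal.rpow_le_rpow hab (hr x).le))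
    (fun x => by rw [ENNReal.zero_rpow_of_pos (hr x), mul_zero]) ?_
  · rw [← setLIntegral_univ, e1 univ .univ _ (measurable_gridSup _ _ _), setLIntegral_univ]
    refine main.trans (mul_le_mul' le_rfl ?_)
    rw [← setLIntegral_univ, hKE univ .univ]
    simp only [setLIntegral_univ]
    have hDoob : ∀ i, ∫⁻ x, M i x ∂(T.ν (Fin.succ i)) ≤ C₃ * Γ := by
      intro i
      refine (h₃ G J (T.ν i.succ) _ (T.ν_ne_zero _) (T.ν_ne_top _)
        (T.measurable_tilt (hg.measurable i)).ennreal_ofReal (fun x => ENNReal.ofReal_ne_top)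
        fun Q => ?_).trans (mul_le_mul' le_rfl
          (T.lintegral_tilt_rpow_le (hg.nonneg i) (hg.le_one i)))
      change W i Q < ∞
      rw [hWD]
      exact ENNReal.ofReal_lt_top
    exact add_le_add (mul_le_mul' le_rfl (add_le_add (hDoob 0) (hDoob 1))) (T.lintegral_b_le 0)
  · intro Q hQ E hE hEm hvol
    rw [hKE E hEm]
    have e2 := e1 E hEm (fun _ => 4 * biAvg (f 0) (f 1) Q) measurable_const
    rw [← e2]
    refine (h₁ g hg Q E hE hEm).trans (add_le_add ?_ le_rfl)
    have key : ∀ i, ENNReal.ofReal (T.e g i Q) ≤ C₂ * ∫⁻ x in E, M i x ∂(T.ν (Fin.succ i)) := by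
      intro i
      have hD := (T.D_pos (hg.nonneg i) (hg.measurable i) (hg.le_one i) Q)
      rw [e, ENNReal.ofReal_mul (T.m_pos _ _).le, T.ofReal_m,
        ← ENNReal.ofReal_rpow_of_pos hD, ← hWD]
      calc _ ≤ C₂ * T.ν i.succ E * W i Q ^ T.s :=
            mul_le_mul' (h₂ i.succ Q E hE hEm hvol) le_rfl
        _ = C₂ * ∫⁻ x in E, W i Q ^ T.s ∂(T.ν i.succ) := by rw [setLIntegral_const]; ring
        _ ≤ _ := by
            refine mul_le_mul' le_rfl (setLIntegral_mono' hEm fun x hx => ?_)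
            obtain ⟨j, hj, hjx⟩ := hQ x (hE hx)
            refine ENNReal.rpow_le_rpow ?_ T.s_pos.le
            rw [hjx]
            exact Finset.le_sup (f := fun j => W i (G.cell j x)) hj
    rw [ENNReal.ofReal_mul hC₁, Fin.sum_univ_two, ENNReal.ofReal_add (hg.e_pos 0 Q).le
      (hg.e_pos 1 Q).le, hZ, mul_assoc, mul_add C₂]
    exact mul_le_mul' le_rfl (add_le_add (key 0) (key 1))

end BiTriple

section Exponent

variable {p : Rn n → ℝ} {a b : ℝ}

lemma LH0.continuous_one_div (h : LH0 p) : Continuous fun x => 1 / p x := by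
  obtain ⟨C, hC, h⟩ := h
  refine Metric.continuous_iff.2 fun y ε hε =>
    ⟨min (1 / 2) (Real.exp (-(C / ε + 1))), by positivity, fun x hx => ?_⟩
  obtain ⟨h1, h2⟩ := lt_min_iff.1 hx
  rcases eq_or_ne x y with rfl | hne
  · simpa using hε
  have hd : 0 < dist x y := dist_pos.2 hne
  have h3 : C / ε < -Real.log (dist x y) := by
    have := Real.log_lt_log hd h2
    rw [Real.log_exp] at this
    linarith
  rw [Real.dist_eq]
  refine (h x y h1).trans_lt ?_
  have h4 : 0 < C / ε := by positivity
  rw [div_lt_iff₀ (h4.trans h3)]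
  rwa [div_lt_iff₀ hε, mul_comm] at h3

lemma LH0.bounds (h : LH0 p) (hp1 : ∀ x, 1 ≤ p x) (ha : 1 < a)
    (hab : ∀ᵐ x ∂(volume : Measure (Rn n)), a ≤ p x ∧ p x ≤ b) (x : Rn n) :
    a ≤ p x ∧ p x ≤ b := by
  have hpos : ∀ x, 0 < p x := fun x => one_pos.trans_le (hp1 x)
  have hc := LH0.continuous_one_div h
  have hb : 0 < b := by
    obtain ⟨y, hy⟩ := hab.exists
    linarith [hpos y]
  have hcl : IsClosed {x | 1 / b ≤ 1 / p x ∧ 1 / p x ≤ 1 / a} :=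
    (isClosed_le continuous_const hc).inter (isClosed_le hc continuous_const)
  have hd : Dense {x | 1 / b ≤ 1 / p x ∧ 1 / p x ≤ 1 / a} := by
    refine Measure.dense_of_ae (μ := (volume : Measure (Rn n))) ?_
    filter_upwards [hab] with y hy
    exact ⟨one_div_le_one_div_of_le (hpos y) hy.2, one_div_le_one_div_of_le (by linarith) hy.1⟩
  have hx : x ∈ {x | 1 / b ≤ 1 / p x ∧ 1 / p x ≤ 1 / a} := by
    rw [← hcl.closure_eq, hd.closure_eq]; trivial
  exact ⟨(one_div_le_one_div (hpos x) (by linarith)).1 hx.2,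
    (one_div_le_one_div hb (hpos x)).1 hx.1⟩

lemma LHinf.exists_bounds (h : LHinf p) (ha : 1 < a) (hab : ∀ x, a ≤ p x ∧ p x ≤ b) :
    ∃ q, (a ≤ q ∧ q ≤ b) ∧ LHinfWith p q := by
  obtain ⟨q, hq, C, hC, h⟩ := h
  rcases Nat.eq_zero_or_pos n with rfl | hn
  · refine ⟨p 0, hab 0, 1, one_pos, fun x => ?_⟩
    rw [Subsingleton.elim x 0, sub_self, abs_zero]
    have := one_le_log_base (0 : Rn 0)
    positivity
  · have hpos : ∀ x, 0 < p x := fun x => by linarith [(hab x).1]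
    have hb : 0 < b := (hpos 0).trans_le (hab 0).2
    have hnorm : ∀ k : ℕ, ‖(fun _ => (k : ℝ) : Rn n)‖ = k := by
      intro k
      have : Nonempty (Fin n) := ⟨⟨0, hn⟩⟩
      rw [pi_norm_const, Real.norm_natCast]
    have h1 : Filter.Tendsto (fun k : ℕ => C / Real.log (Real.exp 1 + k)) Filter.atTop (nhds 0) :=
      Filter.Tendsto.const_div_atTop (Real.tendsto_log_atTop.comp
        (Filter.tendsto_atTop_add_const_left _ _ tendsto_natCast_atTop_atTop)) C
    have h2 : Filter.Tendsto (fun k : ℕ => 1 / p (fun _ => (k : ℝ))) Filter.atTop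
        (nhds (1 / q)) := by
      rw [tendsto_iff_norm_sub_tendsto_zero]
      refine squeeze_zero (fun _ => norm_nonneg _) (fun k => ?_) h1
      have := h fun _ => (k : ℝ)
      rwa [hnorm] at this
    have h3 : 1 / q ≤ 1 / a := le_of_tendsto' h2 fun k =>
      one_div_le_one_div_of_le (by linarith) (hab _).1
    have h4 : 1 / b ≤ 1 / q := ge_of_tendsto' h2 fun k =>
      one_div_le_one_div_of_le (hpos _) (hab _).2
    exact ⟨q, ⟨(one_div_le_one_div hq (by linarith)).1 h3, (one_div_le_one_div hb hq).1 h4⟩,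
      C, hC, h⟩

/-- The reciprocal of a log-Hölder exponent is nearly constant on cubes. -/
lemma LH.exists_approx (h : LH p) (ha : 1 < a) (hab : ∀ x, a ≤ p x ∧ p x ≤ b) :
    ∃ (v : Cube n → ℝ) (L : ℝ), 0 ≤ L ∧ (∀ Q, 1 / b ≤ v Q ∧ v Q ≤ 1 / a) ∧
      ∀ Q : Cube n, ∀ y ∈ Q.toSet, |1 / p y - v Q| * lg Q y ≤ L := by
  obtain ⟨⟨C₀, hC₀, h₀⟩, hinf⟩ := h
  obtain ⟨q, hq, C, hC, h⟩ := LHinf.exists_bounds hinf ha hab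
  have hpos : ∀ x, 0 < p x := fun x => by linarith [(hab x).1]
  have hb : 0 < b := (hpos 0).trans_le (hab 0).2
  have hrec : ∀ t, a ≤ t ∧ t ≤ b → 1 / b ≤ 1 / t ∧ 1 / t ≤ 1 / a := fun t ht =>
    ⟨one_div_le_one_div_of_le (by linarith) ht.2, one_div_le_one_div_of_le (by linarith) ht.1⟩
  have h4 : 0 ≤ Real.log 4 := Real.log_nonneg (by norm_num)
  refine ⟨fun Q => if Q.side < 1 / 4 then 1 / p Q.base else 1 / q,
    C₀ + 3 * C + (1 + Real.log 4) * C, by positivity, fun Q => ?_, fun Q y hy => ?_⟩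
  · dsimp only
    split_ifs
    exacts [hrec _ (hab _), hrec _ hq]
  have hl := one_le_log_base y
  have hs := Q.side_pos
  have hy1 : |1 / p y - 1 / q| * Real.log (Real.exp 1 + ‖y‖) ≤ C := by
    rw [← le_div_iff₀ (by linarith)]; exact h y
  dsimp only
  split_ifs with hside
  · have hdist := dist_lt_of_mem hy
    have hlog : 0 < -Real.log Q.side := by
      have := Real.log_neg hs (by linarith); linarith
    have e1 : |1 / p y - 1 / p Q.base| * (-Real.log Q.side) ≤ C₀ := by
      rcases eq_or_ne y Q.base with rfl | hne
      · simpa using hC₀.le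
      have hd : 0 < dist y Q.base := dist_pos.2 hne
      rw [← le_div_iff₀ hlog]
      refine (h₀ y Q.base (by linarith)).trans ?_
      have := Real.log_le_log hd hdist.le
      gcongr
    have e2 : |1 / p y - 1 / p Q.base| * Real.log (Real.exp 1 + ‖y‖) ≤ 3 * C := by
      have hlb := one_le_log_base Q.base
      have hb1 : |1 / p Q.base - 1 / q| * Real.log (Real.exp 1 + ‖Q.base‖) ≤ C := by
        rw [← le_div_iff₀ (by linarith)]; exact h Q.base
      have e3 : Real.log (Real.exp 1 + ‖y‖) ≤ 2 * Real.log (Real.exp 1 + ‖Q.base‖) := by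
        have hyb : ‖y‖ ≤ ‖Q.base‖ + 1 := by
          have := norm_le_norm_add_norm_sub' y Q.base
          rw [← dist_eq_norm] at this
          linarith
        have he : 2 ≤ Real.exp 1 := by linarith [Real.add_one_le_exp 1]
        have hn0 := norm_nonneg Q.base
        have : Real.exp 1 + ‖y‖ ≤ (Real.exp 1 + ‖Q.base‖) ^ 2 := by nlinarith
        have := Real.log_le_log (base_pos y) this
        rwa [Real.log_pow] at this
      have htri : |1 / p y - 1 / p Q.base| ≤ |1 / p y - 1 / q| + |1 / p Q.base - 1 / q| := by
        rw [abs_sub_comm (1 / p Q.base)]; exact abs_sub_le _ _ _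
      have := abs_nonneg (1 / p Q.base - 1 / q)
      nlinarith
    rw [lg, max_eq_right hlog.le, mul_add]
    have : 0 ≤ (1 + Real.log 4) * C := by positivity
    linarith
  · have e3 : lg Q y ≤ (1 + Real.log 4) * Real.log (Real.exp 1 + ‖y‖) := by
      have : max 0 (-Real.log Q.side) ≤ Real.log 4 := by
        refine max_le h4 ?_
        rw [← Real.log_inv]
        refine Real.log_le_log (by positivity) ?_
        rw [inv_le_comm₀ hs (by norm_num)]
        linarith
      rw [lg]
      nlinarith
    calc _ ≤ |1 / p y - 1 / q| * ((1 + Real.log 4) * Real.log (Real.exp 1 + ‖y‖)) :=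
          mul_le_mul_of_nonneg_left e3 (abs_nonneg _)
      _ ≤ (1 + Real.log 4) * C := by nlinarith
      _ ≤ _ := by linarith

end Exponent

section Norm

variable {ρ : Rn n → ℝ} {f : Rn n → ℝ≥0∞}

lemma eModular_ofExp (hρ : ∀ x, 0 ≤ ρ x) (μ : Measure (Rn n)) (f : Rn n → ℝ≥0∞) (t : ℝ≥0∞) :
    eModular (ofExp ρ) μ f t = ∫⁻ x, (f x / t) ^ ρ x ∂μ := by
  have h1 : {x | ofExp ρ x ≠ ∞} = univ := by ext; simp [ofExp]
  have h2 : {x | ofExp ρ x = ∞} = ∅ := by ext; simp [ofExp]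
  rw [eModular, h1, h2, Measure.restrict_univ, Measure.restrict_empty, essSup_measure_zero,
    bot_eq_zero, add_zero]
  exact lintegral_congr fun x => by rw [ofExp, ENNReal.toReal_ofReal (hρ x)]

lemma eNorm_le {t : ℝ≥0∞} (hρ : ∀ x, 0 ≤ ρ x) (ht : t ≠ 0)
    (h : ∫⁻ x, (f x / t) ^ ρ x ≤ 1) : eNorm (ofExp ρ) volume f ≤ t :=
  sInf_le ⟨ht, by rwa [eModular_ofExp hρ]⟩

lemma lintegral_le_one_of_eNorm_lt {t : ℝ≥0∞} (hρ : ∀ x, 0 ≤ ρ x)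
    (h : eNorm (ofExp ρ) volume f < t) : ∫⁻ x, (f x / t) ^ ρ x ≤ 1 := by
  obtain ⟨t', ⟨-, h1⟩, ht'⟩ := sInf_lt_iff.1 h
  rw [eModular_ofExp hρ] at h1
  exact (lintegral_mono fun x => ENNReal.rpow_le_rpow (ENNReal.div_le_div_left ht'.le _)
    (hρ x)).trans h1

lemma eNorm_ne_zero (hρ : ∀ x, 1 / 2 ≤ ρ x) (hρm : Measurable ρ) (hf : Measurable f)
    {E : Set (Rn n)} (hE : volume E ≠ 0) (hpos : ∀ᵐ x, x ∈ E → f x ≠ 0) :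
    eNorm (ofExp ρ) volume f ≠ 0 := by
  intro h0
  have hρ0 : ∀ x, 0 ≤ ρ x := fun x => by linarith [hρ x]
  have h1 : ∀ k : ℕ, (k : ℝ≥0∞) * ∫⁻ x, f x ^ ρ x ≤ 1 := by
    intro k
    rcases Nat.eq_zero_or_pos k with rfl | hk
    · simp
    have hk' : (k : ℝ≥0∞) ≠ 0 := by exact_mod_cast hk.ne'
    have hk1 : (1 : ℝ≥0∞) ≤ k := by exact_mod_cast hk
    have h2 := lintegral_le_one_of_eNorm_lt hρ0 (f := f) (t := ((k : ℝ≥0∞) ^ 2)⁻¹)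
      (by rw [h0]; exact ENNReal.inv_pos.2 (by finiteness))
    refine le_trans ?_ h2
    rw [← lintegral_const_mul' _ _ (by finiteness)]
    refine lintegral_mono fun x => ?_
    rw [div_eq_mul_inv, inv_inv, ENNReal.mul_rpow_of_nonneg _ _ (hρ0 x), mul_comm]
    refine mul_le_mul' le_rfl ?_
    rw [← ENNReal.rpow_natCast, ← ENNReal.rpow_mul]
    calc (k : ℝ≥0∞) = (k : ℝ≥0∞) ^ (1 : ℝ) := (ENNReal.rpow_one _).symm
      _ ≤ _ := ENNReal.rpow_le_rpow_of_exponent_le hk1 (by push_cast; linarith [hρ x])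
  have h3 : ∫⁻ x, f x ^ ρ x = 0 := by
    by_contra h
    obtain ⟨k, hk⟩ := ENNReal.exists_nat_mul_gt h one_ne_top
    exact absurd (h1 k) (not_le.2 hk)
  rw [lintegral_eq_zero_iff (hf.pow hρm)] at h3
  refine hE (measure_eq_zero_iff_ae_notMem.2 ?_)
  filter_upwards [h3, hpos] with x hx hx' hxE
  have := hx' hxE
  simp only [Pi.zero_apply, ENNReal.rpow_eq_zero_iff] at hx
  rcases hx with hx | hx
  · exact this hx.1
  · linarith [hx.2, hρ x]

lemma mul_eNorm_le {F : Rn n → ℝ≥0∞} {c : ℝ≥0∞} (hρ : ∀ x, 0 ≤ ρ x) (hc : c ≠ 0) (hc' : c ≠ ∞)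
    (h : ∀ᵐ x, c * f x ≤ F x) : c * eNorm (ofExp ρ) volume f ≤ eNorm (ofExp ρ) volume F := by
  refine le_sInf fun t ht => ?_
  obtain ⟨ht0, ht⟩ := ht
  rw [eModular_ofExp hρ] at ht
  rcases eq_or_ne t ∞ with rfl | htt
  · exact le_top
  rw [mul_comm, ← ENNReal.le_div_iff_mul_le (Or.inl hc) (Or.inl hc')]
  refine eNorm_le hρ (ENNReal.div_ne_zero.2 ⟨ht0, hc'⟩)
    (le_trans (lintegral_mono_ae ?_) ht)
  filter_upwards [h] with x hx
  refine ENNReal.rpow_le_rpow ?_ (hρ x)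
  rw [ENNReal.div_le_iff (ENNReal.div_ne_zero.2 ⟨ht0, hc'⟩) (ENNReal.div_ne_top htt hc)]
  calc f x = c * f x / c := by rw [mul_comm, ENNReal.mul_div_cancel_right hc hc']
    _ ≤ F x / c := ENNReal.div_le_div_right hx _
    _ = F x / t * (t / c) := by
        rw [← mul_div_assoc, ENNReal.div_mul_cancel ht0 htt]

lemma conjExp_eq {p : Rn n → ℝ} (hp : ∀ x, 1 < p x) :
    conjExp p = ofExp fun x => p x / (p x - 1) := by
  ext1 x
  have h1 : ENNReal.ofReal (p x) ≠ 1 := by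
    rw [Ne, ENNReal.ofReal_eq_one]; exact (hp x).ne'
  rw [conjExp, econj, if_neg h1, if_neg ENNReal.ofReal_ne_top,
    ENNReal.toReal_ofReal (by linarith [hp x]), ofExp]

end Norm

/-- Reciprocals of the exponents of the triple associated to the reciprocals `v 0`, `v 1`. -/
def recip (v : Fin 2 → ℝ) : Fin 3 → ℝ := Fin.cons (v 0 + v 1) fun i => 1 - v i

lemma recip_zero (v : Fin 2 → ℝ) : recip v 0 = v 0 + v 1 := rfl

lemma recip_succ (v : Fin 2 → ℝ) (i : Fin 2) : recip v i.succ = 1 - v i := rfl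

lemma sum_recip (v : Fin 2 → ℝ) : ∑ j, recip v j = 2 := by
  rw [Fin.sum_univ_succ, Fin.sum_univ_two, recip_zero, recip_succ, recip_succ]
  ring

lemma abs_recip_sub_le (v v' : Fin 2 → ℝ) (j : Fin 3) :
    |recip v j - recip v' j| ≤ ∑ i, |v i - v' i| := by
  refine Fin.cases ?_ (fun i => ?_) j
  · rw [recip_zero, recip_zero, Fin.sum_univ_two, add_sub_add_comm]
    exact abs_add_le _ _
  · rw [recip_succ, recip_succ, abs_sub_comm, show 1 - v' i - (1 - v i) = v i - v' i by ring]
    exact Finset.single_le_sum (f := fun i => |v i - v' i|) (fun _ _ => abs_nonneg _)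
      (Finset.mem_univ i)

lemma one_div_recip_bounds {a b : ℝ} (ha : 1 < a) (hb : 0 < b) {v : Fin 2 → ℝ}
    (hv : ∀ i, 1 / b ≤ v i ∧ v i ≤ 1 / a) (j : Fin 3) :
    1 / 2 ≤ 1 / recip v j ∧ 1 / recip v j ≤ b + a / (a - 1) := by
  have ha' : 0 < a - 1 := by linarith
  have hb' : 0 < 1 / b := by positivity
  have ha1 : 1 / a < 1 := by rw [div_lt_one (by linarith)]; exact ha
  have hq : 0 < a / (a - 1) := div_pos (by linarith) ha'
  have h0 := hv 0
  have h1 := hv 1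
  refine Fin.cases ?_ (fun i => ?_) j
  · rw [recip_zero]
    have hpos : 0 < v 0 + v 1 := by linarith
    refine ⟨one_div_le_one_div_of_le hpos (by linarith), ?_⟩
    calc 1 / (v 0 + v 1) ≤ 1 / (1 / b) := one_div_le_one_div_of_le hb' (by linarith)
      _ = b := one_div_one_div b
      _ ≤ _ := by linarith
  · rw [recip_succ]
    have hi := hv i
    have hpos : 0 < 1 - v i := by linarith
    refine ⟨one_div_le_one_div_of_le hpos (by linarith), ?_⟩
    calc 1 / (1 - v i) ≤ 1 / (1 - 1 / a) := one_div_le_one_div_of_le (by linarith) (by linarith)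
      _ = a / (a - 1) := by field_simp
      _ ≤ _ := by linarith

lemma abs_sub_le_mul_one_div {x y R : ℝ} (hx : 0 < x) (hy : 0 < y) (hxR : x ≤ R) (hyR : y ≤ R) :
    |x - y| ≤ R ^ 2 * |1 / x - 1 / y| := by
  have h : x - y = -(x * y) * (1 / x - 1 / y) := by field_simp; ring
  rw [h, abs_mul, abs_neg, abs_of_pos (mul_pos hx hy)]
  refine mul_le_mul_of_nonneg_right ?_ (abs_nonneg _)
  nlinarith

/-- The exponents of the triple associated to `p 0` and `p 1`. -/
def tripleExp (p : Fin 2 → Rn n → ℝ) (j : Fin 3) (x : Rn n) : ℝ := 1 / recip (fun i => 1 / p i x) j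

lemma measurable_tripleExp {p : Fin 2 → Rn n → ℝ} (hp : ∀ i, Measurable (p i)) (j : Fin 3) :
    Measurable (tripleExp p j) := by
  have h : ∀ i, Measurable fun x => 1 / p i x := fun i => (hp i).const_div 1
  refine Fin.cases ?_ (fun i => ?_) j
  · exact ((h 0).add (h 1)).const_div 1
  · exact ((h i).const_sub 1).const_div 1

/-- The weights of the triple associated to `w 0` and `w 1`. -/
def tripleWeight (w : Fin 2 → Rn n → ℝ) : Fin 3 → Rn n → ℝ :=
  Fin.cons (fun x => w 0 x * w 1 x) fun i x => (w i x)⁻¹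

lemma measurable_tripleWeight {w : Fin 2 → Rn n → ℝ} (hw : ∀ i, Measurable (w i)) (j : Fin 3) :
    Measurable (tripleWeight w j) := by
  refine Fin.cases ?_ (fun i => ?_) j
  · exact (hw 0).mul (hw 1)
  · exact (hw i).inv

lemma tripleWeight_pos {w : Fin 2 → Rn n → ℝ} {x : Rn n} (hw : ∀ i, 0 < w i x) (j : Fin 3) :
    0 < tripleWeight w j x := by
  refine Fin.cases ?_ (fun i => ?_) j
  · exact mul_pos (hw 0) (hw 1)
  · exact inv_pos.2 (hw i)

lemma prod_tripleWeight {w : Fin 2 → Rn n → ℝ} {x : Rn n} (hw : ∀ i, 0 < w i x) :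
    ∏ j, tripleWeight w j x = 1 := by
  have h0 := (hw 0).ne'
  have h1 := (hw 1).ne'
  rw [Fin.prod_univ_succ, Fin.prod_univ_two]
  change w 0 x * w 1 x * ((w 0 x)⁻¹ * (w 1 x)⁻¹) = 1
  field_simp

lemma setLIntegral_withDensity_rpow {r u : Rn n → ℝ} (hr : ∀ x, 0 < r x) (hrm : Measurable r)
    (hu : Measurable u) {β : ℝ} (hβ : 0 < β) {E : Set (Rn n)} (hE : MeasurableSet E) :
    ∫⁻ y in E, ENNReal.ofReal (β ^ (-r y)) ∂(volume.withDensity fun y =>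
      ENNReal.ofReal |u y| ^ r y)
      = ∫⁻ y, (ENNReal.ofReal |E.indicator u y| / ENNReal.ofReal β) ^ r y := by
  have hm : Measurable fun y => ENNReal.ofReal |u y| ^ r y := by fun_prop
  have hm2 : Measurable fun y => ENNReal.ofReal (β ^ (-r y)) := by fun_prop
  rw [setLIntegral_withDensity_eq_setLIntegral_mul _ hm hm2 hE, ← lintegral_indicator hE]
  refine lintegral_congr fun y => ?_
  by_cases hy : y ∈ E
  · rw [indicator_of_mem hy, indicator_of_mem hy, ENNReal.div_rpow_of_nonneg _ _ (hr y).le,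
      Pi.mul_apply, ← ENNReal.ofReal_rpow_of_pos hβ, ENNReal.rpow_neg, div_eq_mul_inv]
  · rw [indicator_of_notMem hy, indicator_of_notMem hy]
    simp [hr y]

lemma one_le_sqrt_mul_sum {r u β : Fin 3 → ℝ} (hr : ∀ j, 0 < r j) (hsum : ∑ j, 1 / r j = 2)
    (hu : ∀ j, 0 < u j) (hprod : ∏ j, u j = 1) (hβ : ∀ j, 0 < β j) :
    1 ≤ √(∏ j, β j) * ∑ j, u j ^ r j * β j ^ (-r j) := by
  have hβp : 0 < ∏ j, β j := Finset.prod_pos fun j _ => hβ j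
  have hX : ∀ j, 0 < u j ^ r j * β j ^ (-r j) := fun j =>
    mul_pos (Real.rpow_pos_of_pos (hu j) _) (Real.rpow_pos_of_pos (hβ j) _)
  have hθ : ∀ j, 0 < 1 / r j / 2 := fun j => by have := hr j; positivity
  have h1 : ∑ j, 1 / r j / 2 = 1 := by rw [← Finset.sum_div, hsum]; norm_num
  have key := Real.geom_mean_le_arith_mean_weighted Finset.univ (fun j => 1 / r j / 2)
    (fun j => u j ^ r j * β j ^ (-r j)) (fun j _ => (hθ j).le) h1 (fun j _ => (hX j).le)
  have h2 : ∀ j, (u j ^ r j * β j ^ (-r j)) ^ (1 / r j / 2) = (u j / β j) ^ (1 / 2 : ℝ) := by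
    intro j
    have hb := Real.rpow_pos_of_pos (hβ j) (r j)
    rw [Real.rpow_neg (hβ j).le, ← div_eq_mul_inv, ← Real.div_rpow (hu j).le (hβ j).le,
      ← Real.rpow_mul (div_pos (hu j) (hβ j)).le]
    congr 1
    have := (hr j).ne'
    field_simp
  simp only [h2] at key
  rw [Real.finsetProd_rpow _ _ fun j _ => (div_pos (hu j) (hβ j)).le, Finset.prod_div_distrib,
    hprod, ← Real.sqrt_eq_rpow, one_div, Real.sqrt_inv] at key
  have hsq := Real.sqrt_pos.2 hβp
  have h3 : ∑ j, 1 / r j / 2 * (u j ^ r j * β j ^ (-r j)) ≤ ∑ j, u j ^ r j * β j ^ (-r j) := by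
    refine Finset.sum_le_sum fun j _ => mul_le_of_le_one_left (hX j).le ?_
    refine le_of_le_of_eq ?_ h1
    exact Finset.single_le_sum (f := fun j => 1 / r j / 2) (fun j _ => (hθ j).le)
      (Finset.mem_univ j)
  rw [← inv_le_iff_one_le_mul₀' hsq]
  exact key.trans h3

/-- The data of the key estimate associated to a bilinear Muckenhoupt weight. -/
lemma exists_biTriple {p w : Fin 2 → Rn n → ℝ} {a b : ℝ} (ha : 1 < a)
    (hab : ∀ i x, a ≤ p i x ∧ p i x ≤ b) (hpm : ∀ i, Measurable (p i)) (hLH : ∀ i, LH (p i))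
    (hwm : ∀ i, Measurable (w i)) (hw : ∀ i, ∀ᵐ x, 0 < w i x)
    (hA : ∃ C : ℝ≥0∞, C ≠ ∞ ∧ ∀ Q : Cube n, ∏ j, vNorm (ofExp (tripleExp p j))
      (Q.toSet.indicator (tripleWeight w j)) ≤ C * Q.vol ^ 2) :
    ∃ T : BiTriple n, T.r 0 = tripleExp p 0 ∧ T.p = p ∧
      T.φ = fun j x => ENNReal.ofReal |tripleWeight w j x| ^ tripleExp p j x := by
  obtain ⟨C, hC, hA⟩ := hA
  choose v Lv hLv hvb hv using fun i => LH.exists_approx (hLH i) ha (hab i)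
  have hp0 : ∀ i x, 0 < p i x := fun i x => by linarith [(hab i x).1]
  have hb : 0 < b := (hp0 0 0).trans_le (hab 0 0).2
  have hpb : ∀ x i, 1 / b ≤ 1 / p i x ∧ 1 / p i x ≤ 1 / a := fun x i =>
    ⟨one_div_le_one_div_of_le (hp0 i x) (hab i x).2,
      one_div_le_one_div_of_le (by linarith) (hab i x).1⟩
  have hr := fun j x => one_div_recip_bounds ha hb (hpb x) j
  have hrQ := fun j Q => one_div_recip_bounds ha hb (fun i => hvb i Q) j
  set R := b + a / (a - 1) with hR
  have hR0 : 0 < R := by linarith [(hr 0 0).1, (hr 0 0).2]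
  have hbR : b ≤ R := by
    have : 0 < a / (a - 1) := div_pos (by linarith) (by linarith)
    linarith
  have hrpos : ∀ j x, 0 < tripleExp p j x := fun j x => by
    have := (hr j x).1
    rw [tripleExp]; linarith
  have hrm := measurable_tripleExp hpm
  have hum := measurable_tripleWeight hwm
  have hwall : ∀ᵐ x, ∀ i, 0 < w i x := ae_all_iff.2 hw
  set N : Fin 3 → Cube n → ℝ≥0∞ := fun j Q =>
    vNorm (ofExp (tripleExp p j)) (Q.toSet.indicator (tripleWeight w j)) with hN
  have hN0 : ∀ j Q, N j Q ≠ 0 := by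
    intro j Q
    refine eNorm_ne_zero (fun x => (hr j x).1) (hrm j)
      ((hum j).indicator (measurableSet_toSet Q)).abs.ennreal_ofReal (E := Q.toSet)
      (by rw [volume_toSet]; exact vol_ne_zero Q) ?_
    filter_upwards [hwall] with x hx hxQ
    rw [indicator_of_mem hxQ]
    simpa using (tripleWeight_pos hx j).ne'
  have hNt : ∀ j Q, N j Q ≠ ∞ := by
    intro j Q h
    have h1 : ∏ j, N j Q = ∞ := WithTop.prod_eq_top (Finset.mem_univ j) h fun k _ => hN0 k Q
    have h2 := hA Q
    rw [h1, top_le_iff] at h2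
    exact ENNReal.mul_ne_top hC (ENNReal.pow_ne_top (vol_ne_top Q)) h2
  have hNpos : ∀ j Q, 0 < (N j Q).toReal := fun j Q => ENNReal.toReal_pos (hN0 j Q) (hNt j Q)
  have hmod : ∀ j (Q : Cube n) (β : ℝ), 0 < β → _ := fun j Q β hβ =>
    setLIntegral_withDensity_rpow (hrpos j) (hrm j) (hum j) hβ (measurableSet_toSet Q)
  have hL0 : 0 ≤ ∑ i, Lv i := Finset.sum_nonneg fun i _ => hLv i
  refine ⟨{
    r := tripleExp p
    rQ := fun j Q => 1 / recip (fun i => v i Q) j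
    R := R
    L := R ^ 2 * ∑ i, Lv i
    half_le := fun j x => (hr j x).1
    le_R := fun j x => (hr j x).2
    half_le_rQ := fun j Q => (hrQ j Q).1
    rQ_le_R := fun j Q => (hrQ j Q).2
    holder := fun j Q y hy => ?_
    measurable_r := hrm
    φ := fun j x => ENNReal.ofReal |tripleWeight w j x| ^ tripleExp p j x
    measurable_φ := fun j => (hum j).abs.ennreal_ofReal.pow (hrm j)
    α := fun j Q => 2 * (N j Q).toReal
    α_pos := fun j Q => mul_pos two_pos (hNpos j Q)
    lintegral_α_le := fun j Q => ?_
    α_le := fun j Q β hβ h => ?_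
    A := 8 * C.toReal
    prod_α_le := fun Q => ?_
    young := fun β E hβ hE => ?_
    p := p
    P := fun i Q => 1 / v i Q
    s := a
    one_lt_s := ha
    s_le_p := fun i x => (hab i x).1
    s_le_P := fun i Q => ?_
    measurable_p := hpm
    holder_p := fun i Q y hy => ?_
    conj := fun i Q => ?_
    sum_P := fun Q => ?_ }, rfl, rfl, rfl⟩
  · have h1 := abs_sub_le_mul_one_div (by linarith [(hr j y).1]) (by linarith [(hrQ j Q).1])
      (hr j y).2 (hrQ j Q).2
    rw [one_div_one_div, one_div_one_div] at h1
    have h2 := abs_recip_sub_le (fun i => 1 / p i y) (fun i => v i Q) j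
    have hl := one_le_lg Q y
    calc _ ≤ R ^ 2 * (∑ i, |1 / p i y - v i Q|) * lg Q y := by
          refine mul_le_mul_of_nonneg_right (h1.trans ?_) (by linarith)
          exact mul_le_mul_of_nonneg_left h2 (by positivity)
      _ = R ^ 2 * ∑ i, |1 / p i y - v i Q| * lg Q y := by rw [← Finset.sum_mul]; ring
      _ ≤ _ := mul_le_mul_of_nonneg_left (Finset.sum_le_sum fun i _ => hv i Q y hy) (by positivity)
  · rw [hmod j Q _ (mul_pos two_pos (hNpos j Q))]
    refine lintegral_le_one_of_eNorm_lt (fun x => (hrpos j x).le) ?_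
    change N j Q < _
    rw [ENNReal.ofReal_mul zero_le_two, ENNReal.ofReal_toReal (hNt j Q), ENNReal.ofReal_ofNat,
      two_mul]
    exact ENNReal.lt_add_right (hNt j Q) (hN0 j Q)
  · rw [hmod j Q β hβ] at h
    have := eNorm_le (fun x => (hrpos j x).le) (by simpa using hβ) h
    change N j Q ≤ _ at this
    have := ENNReal.toReal_le_of_le_ofReal hβ.le this
    linarith
  · have h := ENNReal.toReal_mono (ENNReal.mul_ne_top hC (ENNReal.pow_ne_top (vol_ne_top Q))) (hA Q)
    rw [ENNReal.toReal_prod, ENNReal.toReal_mul, ENNReal.toReal_pow, Cube.vol,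
      ENNReal.toReal_ofReal (pow_nonneg Q.side_pos.le _)] at h
    rw [Finset.prod_mul_distrib, Finset.prod_const]
    norm_num
    linarith
  · have hφm : ∀ j, Measurable fun x => ENNReal.ofReal |tripleWeight w j x| ^ tripleExp p j x :=
      fun j => (hum j).abs.ennreal_ofReal.pow (hrm j)
    have hβm : ∀ j, Measurable fun x => ENNReal.ofReal (β j ^ (-tripleExp p j x)) :=
      fun j => by have := hrm j; fun_prop
    calc volume E = ∫⁻ y in E, 1 := by simp
      _ ≤ ∫⁻ y in E, ENNReal.ofReal √(∏ j, β j) * ∑ j, ENNReal.ofReal |tripleWeight w j y| ^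
            tripleExp p j y * ENNReal.ofReal (β j ^ (-tripleExp p j y)) := by
          refine lintegral_mono_ae (ae_restrict_of_ae ?_)
          filter_upwards [hwall] with y hy
          have h1 := one_le_sqrt_mul_sum (fun j => hrpos j y) (by
            simp only [tripleExp, one_div_one_div]; exact sum_recip _)
            (tripleWeight_pos hy) (prod_tripleWeight hy) hβ
          have h2 : ∀ j, ENNReal.ofReal |tripleWeight w j y| ^ tripleExp p j y *
              ENNReal.ofReal (β j ^ (-tripleExp p j y)) = ENNReal.ofReal
              (tripleWeight w j y ^ tripleExp p j y * β j ^ (-tripleExp p j y)) := fun j => by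
            have := tripleWeight_pos hy j
            rw [abs_of_pos this, ENNReal.ofReal_rpow_of_pos this, ← ENNReal.ofReal_mul
              (by positivity)]
          simp only [h2]
          rw [← ENNReal.ofReal_sum_of_nonneg fun j _ => by
              have := tripleWeight_pos hy j
              have := hβ j
              positivity,
            ← ENNReal.ofReal_mul (Real.sqrt_nonneg _), ENNReal.one_le_ofReal]
          exact h1
      _ = _ := by
          rw [lintegral_const_mul' _ _ ENNReal.ofReal_ne_top,
            lintegral_finsetSum _ fun j _ => by have := hφm j; have := hβm j; fun_prop]
          congr 1
          refine Finset.sum_congr rfl fun j _ => ?_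
          rw [setLIntegral_withDensity_eq_setLIntegral_mul _ (hφm j) (hβm j) hE]
          rfl
  · have h := hvb i Q
    have hv0 : 0 < v i Q := lt_of_lt_of_le (by positivity) h.1
    have := one_div_le_one_div_of_le hv0 h.2
    rwa [one_div_one_div] at this
  · have h := hvb i Q
    have hv0 : 0 < v i Q := lt_of_lt_of_le (by positivity) h.1
    have h3 : 1 / v i Q ≤ b := by
      have := one_div_le_one_div_of_le (by positivity) h.1
      rwa [one_div_one_div] at this
    have h1 := abs_sub_le_mul_one_div (hp0 i y) (one_div_pos.2 hv0)
      ((hab i y).2.trans hbR) (h3.trans hbR)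
    rw [one_div_one_div] at h1
    have hl := one_le_lg Q y
    calc _ ≤ R ^ 2 * |1 / p i y - v i Q| * lg Q y :=
          mul_le_mul_of_nonneg_right h1 (by linarith)
      _ = R ^ 2 * (|1 / p i y - v i Q| * lg Q y) := by ring
      _ ≤ R ^ 2 * Lv i := mul_le_mul_of_nonneg_left (hv i Q y hy) (by positivity)
      _ ≤ _ := mul_le_mul_of_nonneg_left (Finset.single_le_sum (fun i _ => hLv i)
          (Finset.mem_univ i)) (by positivity)
  · rw [one_div_one_div, one_div_one_div, recip_succ]
  · rw [one_div_one_div, one_div_one_div, one_div_one_div, recip_zero]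

/-! ### Sufficiency -/

lemma inv_vol_mul_setLIntegral_le (f : Rn n → ℝ≥0∞) {Q R : Cube n} (hQR : Q.toSet ⊆ R.toSet)
    (hside : R.side ≤ 6 * Q.side) : Q.vol⁻¹ * ∫⁻ y in Q.toSet, f y ≤ 6 ^ n * avg volume f R := by
  have hvol : R.vol ≤ 6 ^ n * Q.vol := by
    have h6 : (6 : ℝ≥0∞) ^ n = ENNReal.ofReal (6 ^ n) := by
      rw [ENNReal.ofReal_pow (by norm_num), ENNReal.ofReal_ofNat]
    rw [Cube.vol, Cube.vol, h6, ← ENNReal.ofReal_mul (by positivity), ← mul_pow]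
    exact ENNReal.ofReal_le_ofReal (pow_le_pow_left₀ R.side_pos.le hside n)
  have hinv : Q.vol⁻¹ ≤ 6 ^ n * R.vol⁻¹ := by
    have h6 : (6 : ℝ≥0∞) ^ n ≠ 0 := by simp
    have h6' : (6 : ℝ≥0∞) ^ n ≠ ∞ := by finiteness
    calc Q.vol⁻¹ = 6 ^ n * (6 ^ n * Q.vol)⁻¹ := by
          rw [ENNReal.mul_inv (Or.inl h6) (Or.inl h6'), ← mul_assoc,
            ENNReal.mul_inv_cancel h6 h6', one_mul]
      _ ≤ _ := mul_le_mul' le_rfl (ENNReal.inv_le_inv.2 hvol)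
  rw [avg, volume_toSet, div_eq_mul_inv, mul_comm (∫⁻ y in R.toSet, f y), ← mul_assoc]
  exact mul_le_mul' hinv (lintegral_mono_set hQR)

lemma biMax_le_iSup_gridSup (f₁ f₂ : Rn n → ℝ) (x : Rn n) :
    biMax f₁ f₂ x ≤ 36 ^ n * ⨆ (τ : Fin n → Bool) (N : ℕ), gridSup (thirdGrid τ)
      (Finset.Icc (-(N : ℤ)) N)
      (biAvg (fun y => ENNReal.ofReal |f₁ y|) fun y => ENNReal.ofReal |f₂ y|) x := by
  refine iSup₂_le fun Q hx => ?_
  obtain ⟨τ, k, hk, hQ⟩ := exists_thirdGrid_cell Q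
  have hk' : ((thirdGrid τ).cell k x).side ≤ 6 * Q.side := by rwa [thirdGrid_side]
  refine (mul_le_mul' (inv_vol_mul_setLIntegral_le _ (hQ x hx) hk')
    (inv_vol_mul_setLIntegral_le _ (hQ x hx) hk')).trans ?_
  rw [mul_mul_mul_comm, ← mul_pow]
  norm_num
  refine mul_le_mul' le_rfl (le_trans ?_ (le_iSup₂ τ k.natAbs))
  refine Finset.le_sup (f := fun j => biAvg _ _ ((thirdGrid τ).cell j x)) ?_
  rw [Finset.mem_Icc]
  omega

lemma biMax_mul_le (f₁ f₂ : Rn n → ℝ) (c₁ c₂ : ℝ) (x : Rn n) :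
    ENNReal.ofReal |c₁| * ENNReal.ofReal |c₂| * biMax f₁ f₂ x
      ≤ biMax (fun y => c₁ * f₁ y) (fun y => c₂ * f₂ y) x := by
  have h : ∀ (c : ℝ) (f : Rn n → ℝ) (Q : Cube n), Q.vol⁻¹ * ∫⁻ y in Q.toSet,
      ENNReal.ofReal |c * f y| = ENNReal.ofReal |c| * (Q.vol⁻¹ * ∫⁻ y in Q.toSet,
        ENNReal.ofReal |f y|) := fun c f Q => by
    simp only [abs_mul, ENNReal.ofReal_mul (abs_nonneg c)]
    rw [lintegral_const_mul' _ _ ENNReal.ofReal_ne_top, mul_left_comm]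
  simp only [biMax, h, mul_mul_mul_comm (ENNReal.ofReal |c₁|), ENNReal.mul_iSup]
  exact le_rfl

lemma iSup_rpow_le_sum {ι : Type*} [Fintype ι] [Nonempty ι] (a : ι → ℝ≥0∞) (r : ℝ) :
    (⨆ i, a i) ^ r ≤ ∑ i, a i ^ r := by
  obtain ⟨i, hi⟩ := exists_eq_ciSup_of_finite (f := a)
  rw [← hi]
  exact Finset.single_le_sum (f := fun i => a i ^ r) (fun _ _ => zero_le) (Finset.mem_univ i)

lemma lintegral_iSup_gridSup_rpow_le {σ : Measure (Rn n)} {r : Rn n → ℝ} (hr : ∀ x, 0 < r x)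
    (hrm : Measurable r) {G : Grid n} {S : Cube n → ℝ≥0∞} {C : ℝ≥0∞}
    (h : ∀ J : Finset ℤ, ∫⁻ x, gridSup G J S x ^ r x ∂σ ≤ C) :
    ∫⁻ x, (⨆ N : ℕ, gridSup G (Finset.Icc (-(N : ℤ)) N) S x) ^ r x ∂σ ≤ C := by
  have h1 : ∀ x, (⨆ N : ℕ, gridSup G (Finset.Icc (-(N : ℤ)) N) S x) ^ r x
      = ⨆ N : ℕ, gridSup G (Finset.Icc (-(N : ℤ)) N) S x ^ r x := fun x =>
    (ENNReal.orderIsoRpow (r x) (hr x)).map_iSup _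
  simp only [h1]
  rw [lintegral_iSup (fun N => (measurable_gridSup G _ S).pow hrm)]
  · exact iSup_le fun N => h _
  · intro M N hMN x
    refine ENNReal.rpow_le_rpow (Finset.sup_mono (Finset.Icc_subset_Icc ?_ ?_)) (hr x).le
    · omega
    · omega

lemma biAvg_congr {f₁ f₂ g₁ g₂ : Rn n → ℝ≥0∞} (h₁ : f₁ =ᵐ[volume] g₁) (h₂ : f₂ =ᵐ[volume] g₂) :
    biAvg f₁ f₂ = biAvg g₁ g₂ := by
  ext Q
  rw [biAvg, biAvg, avg, avg, avg, avg, lintegral_congr_ae (ae_restrict_of_ae h₁),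
    lintegral_congr_ae (ae_restrict_of_ae h₂)]

/-- The maximal operator is bounded on the densities of the unit ball. -/
lemma BiTriple.exists_lintegral_biMax_le (T : BiTriple n) : ∃ C : ℝ≥0∞, C ≠ ∞ ∧
    ∀ g, T.UnitBall g → ∀ f : Fin 2 → Rn n → ℝ,
      (∀ i, (fun y => ENNReal.ofReal |f i y|) =ᵐ[volume] T.dens g i) →
      ∫⁻ x, biMax (f 0) (f 1) x ^ T.r 0 x ∂(T.ν 0) ≤ C := by
  obtain ⟨C, hC, h⟩ := T.exists_lintegral_gridSup_le
  have h36 : ((36 : ℝ≥0∞) ^ n) ^ T.R ≠ ∞ :=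
    ENNReal.rpow_ne_top_of_nonneg (by linarith [T.half_le_R]) (by finiteness)
  refine ⟨(36 ^ n) ^ T.R * ∑ _τ : Fin n → Bool, C,
    ENNReal.mul_ne_top h36 (ENNReal.sum_ne_top.2 fun _ _ => hC), fun g hg f hf => ?_⟩
  have hr : ∀ x, 0 < T.r 0 x := fun x => by linarith [T.half_le 0 x]
  calc ∫⁻ x, biMax (f 0) (f 1) x ^ T.r 0 x ∂(T.ν 0)
      ≤ ∫⁻ x, (36 ^ n) ^ T.R * ∑ τ : Fin n → Bool, (⨆ N : ℕ, gridSup (thirdGrid τ)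
          (Finset.Icc (-(N : ℤ)) N) (biAvg (T.dens g 0) (T.dens g 1)) x) ^ T.r 0 x ∂(T.ν 0) := by
        refine lintegral_mono fun x => ?_
        refine (ENNReal.rpow_le_rpow (biMax_le_iSup_gridSup _ _ x) (hr x).le).trans ?_
        rw [ENNReal.mul_rpow_of_nonneg _ _ (hr x).le, biAvg_congr (hf 0) (hf 1)]
        exact mul_le_mul' (ENNReal.rpow_le_rpow_of_exponent_le
          (one_le_pow₀ (by norm_num)) (T.le_R 0 x)) (iSup_rpow_le_sum _ _)
    _ = (36 ^ n) ^ T.R * ∑ τ : Fin n → Bool, ∫⁻ x, (⨆ N : ℕ, gridSup (thirdGrid τ)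
          (Finset.Icc (-(N : ℤ)) N) (biAvg (T.dens g 0) (T.dens g 1)) x) ^ T.r 0 x ∂(T.ν 0) := by
        rw [lintegral_const_mul' _ _ h36, lintegral_finsetSum]
        exact fun τ _ => (Measurable.iSup fun N => measurable_gridSup _ _ _).pow (T.measurable_r 0)
    _ ≤ _ := mul_le_mul' le_rfl (Finset.sum_le_sum fun τ _ =>
        lintegral_iSup_gridSup_rpow_le hr (T.measurable_r 0) fun J => h g hg _ J)

lemma inv_rpow_mul_rpow {w h q p : ℝ} (hw : 0 < w) (hh : 0 ≤ h) (hq : q * (p - 1) = p) :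
    w⁻¹ ^ q * (h * w ^ q) ^ p = (h * w) ^ p := by
  rw [Real.mul_rpow hh (by positivity), Real.mul_rpow hh hw.le, ← Real.rpow_mul hw.le,
    Real.inv_rpow hw.le, ← Real.rpow_neg hw.le, mul_left_comm, ← Real.rpow_add hw]
  congr 2
  linarith

lemma tripleExp_succ {p : Fin 2 → Rn n → ℝ} {i : Fin 2} {x : Rn n} (h : 1 < p i x) :
    tripleExp p i.succ x = p i x / (p i x - 1) := by
  have h1 : p i x ≠ 0 := by linarith
  have h2 : p i x - 1 ≠ 0 := by linarith
  rw [tripleExp, recip_succ]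
  field_simp

/-- The weighted modular estimate for the maximal operator. -/
lemma exists_lintegral_biMax_mul_le {p w : Fin 2 → Rn n → ℝ} {a b : ℝ} (ha : 1 < a)
    (hab : ∀ i x, a ≤ p i x ∧ p i x ≤ b) (hpm : ∀ i, Measurable (p i)) (hLH : ∀ i, LH (p i))
    (hwm : ∀ i, Measurable (w i)) (hw : ∀ i, ∀ᵐ x, 0 < w i x)
    (hA : ∃ C : ℝ≥0∞, C ≠ ∞ ∧ ∀ Q : Cube n, ∏ j, vNorm (ofExp (tripleExp p j))
      (Q.toSet.indicator (tripleWeight w j)) ≤ C * Q.vol ^ 2) :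
    ∃ C : ℝ≥0∞, C ≠ ∞ ∧ ∀ f : Fin 2 → Rn n → ℝ, (∀ i, Measurable (f i)) →
      (∀ i, ∫⁻ x, ENNReal.ofReal |f i x * w i x| ^ p i x ≤ 1) →
      ∫⁻ x, (biMax (f 0) (f 1) x * ENNReal.ofReal (w 0 x * w 1 x)) ^ tripleExp p 0 x ≤ C := by
  obtain ⟨T, hr, hp, hφ⟩ := exists_biTriple ha hab hpm hLH hwm hw hA
  obtain ⟨C, hC, h⟩ := T.exists_lintegral_biMax_le
  refine ⟨C, hC, fun f hf hf1 => ?_⟩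
  have hp1 : ∀ i x, 1 < p i x := fun i x => ha.trans_le (hab i x).1
  have hrm := measurable_tripleExp hpm
  have hum := measurable_tripleWeight hwm
  have hwall : ∀ᵐ x, ∀ i, 0 < w i x := ae_all_iff.2 hw
  set g : Fin 2 → Rn n → ℝ := fun i y => |f i y| * |w i y| ^ tripleExp p i.succ y with hg
  have hgm : ∀ i, Measurable (g i) := fun i =>
    (hf i).abs.mul ((hwm i).abs.pow (hrm i.succ))
  have hball : T.UnitBall g := by
    refine ⟨fun i y => by positivity, hgm, fun i => ?_⟩
    rw [Triple.ν, lintegral_withDensity_eq_lintegral_mul _ (T.measurable_φ _)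
      (((hgm i).pow (T.measurable_p i)).ennreal_ofReal), hp, hφ]
    refine le_of_eq_of_le (lintegral_congr_ae ?_) (hf1 i)
    filter_upwards [hwall] with y hy
    have hq : tripleExp p i.succ y * (p i y - 1) = p i y := by
      rw [tripleExp_succ (hp1 i y), div_mul_cancel₀]
      linarith [hp1 i y]
    have hpos : 0 < p i y := by linarith [hp1 i y]
    rw [Pi.mul_apply]
    change ENNReal.ofReal |(w i y)⁻¹| ^ tripleExp p i.succ y * _ = _
    rw [abs_of_pos (inv_pos.2 (hy i)), ENNReal.ofReal_rpow_of_pos (inv_pos.2 (hy i)),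
      ← ENNReal.ofReal_mul (Real.rpow_nonneg (inv_pos.2 (hy i)).le _), hg]
    dsimp only
    rw [abs_of_pos (hy i), inv_rpow_mul_rpow (hy i) (abs_nonneg _) hq, abs_mul, abs_of_pos (hy i),
      ENNReal.ofReal_rpow_of_nonneg (mul_nonneg (abs_nonneg _) (hy i).le) hpos.le]
  have hdens : ∀ i, (fun y => ENNReal.ofReal |f i y|) =ᵐ[volume] T.dens g i := by
    intro i
    filter_upwards [hwall] with y hy
    rw [BiTriple.dens, hφ]
    change _ = ENNReal.ofReal |(w i y)⁻¹| ^ tripleExp p i.succ y * _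
    have hwp := Real.rpow_pos_of_pos (hy i) (tripleExp p i.succ y)
    rw [abs_of_pos (inv_pos.2 (hy i)), ENNReal.ofReal_rpow_of_pos (inv_pos.2 (hy i)),
      ← ENNReal.ofReal_mul (Real.rpow_nonneg (inv_pos.2 (hy i)).le _), hg]
    dsimp only
    rw [abs_of_pos (hy i), Real.inv_rpow (hy i).le, mul_left_comm, inv_mul_cancel₀ hwp.ne',
      mul_one]
  refine le_trans (le_of_eq ?_) (h g hball f hdens)
  rw [Triple.ν, lintegral_withDensity_eq_lintegral_mul_non_measurable₀ _
    (T.measurable_φ _).aemeasurable, hr, hφ]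
  · refine lintegral_congr_ae ?_
    filter_upwards [hwall] with y hy
    have h0 : 0 ≤ tripleExp p 0 y := by
      have := T.half_le 0 y
      rw [hr] at this
      linarith
    rw [ENNReal.mul_rpow_of_nonneg _ _ h0, Pi.mul_apply, mul_comm]
    change _ = ENNReal.ofReal |w 0 y * w 1 y| ^ _ * _
    rw [abs_of_pos (mul_pos (hy 0) (hy 1))]
  · rw [hφ]
    refine Filter.Eventually.of_forall fun y => lt_top_iff_ne_top.2
      (ENNReal.rpow_ne_top_of_nonneg ?_ ENNReal.ofReal_ne_top)
    have := T.half_le 0 y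
    rw [hr] at this
    linarith

lemma half_le_tripleExp_zero {p : Fin 2 → Rn n → ℝ} (hp : ∀ i x, 1 < p i x) (x : Rn n) :
    1 / 2 ≤ tripleExp p 0 x := by
  have h : ∀ i, 0 < 1 / p i x ∧ 1 / p i x < 1 := fun i =>
    ⟨one_div_pos.2 (by linarith [hp i x]), by
      rw [div_lt_one (by linarith [hp i x])]; exact hp i x⟩
  rw [tripleExp, recip_zero]
  exact one_div_le_one_div_of_le (by linarith [(h 0).1, (h 1).1]) (by linarith [(h 0).2, (h 1).2])

lemma exists_eNorm_biMax_le {p w : Fin 2 → Rn n → ℝ} {a b : ℝ} (ha : 1 < a)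
    (hab : ∀ i x, a ≤ p i x ∧ p i x ≤ b) (hpm : ∀ i, Measurable (p i)) (hLH : ∀ i, LH (p i))
    (hwm : ∀ i, Measurable (w i)) (hw : ∀ i, ∀ᵐ x, 0 < w i x)
    (hA : ∃ C : ℝ≥0∞, C ≠ ∞ ∧ ∀ Q : Cube n, ∏ j, vNorm (ofExp (tripleExp p j))
      (Q.toSet.indicator (tripleWeight w j)) ≤ C * Q.vol ^ 2) :
    ∃ C : ℝ≥0∞, C ≠ ∞ ∧ ∀ f : Fin 2 → Rn n → ℝ, (∀ i, Measurable (f i)) →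
      (∀ i, vNorm (ofExp (p i)) (fun x => f i x * w i x) ≠ ∞) →
      eNorm (ofExp (tripleExp p 0)) volume
        (fun x => biMax (f 0) (f 1) x * ENNReal.ofReal (w 0 x * w 1 x))
        ≤ C * vNorm (ofExp (p 0)) (fun x => f 0 x * w 0 x) *
          vNorm (ofExp (p 1)) (fun x => f 1 x * w 1 x) := by
  obtain ⟨C, hC, h⟩ := exists_lintegral_biMax_mul_le ha hab hpm hLH hwm hw hA
  have hp1 : ∀ i x, 1 < p i x := fun i x => ha.trans_le (hab i x).1
  have hr := half_le_tripleExp_zero hp1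
  have hr0 : ∀ x, 0 ≤ tripleExp p 0 x := fun x => by linarith [hr x]
  have hp0 : ∀ i x, 0 ≤ p i x := fun i x => by linarith [hp1 i x]
  set K := max 1 C with hK
  have hK1 : 1 ≤ K := le_max_left _ _
  have hK0 : K ≠ 0 := (one_pos.trans_le hK1).ne'
  have hKt : K ≠ ∞ := max_ne_top one_ne_top hC
  refine ⟨K ^ 2, ENNReal.pow_ne_top hKt, fun f hf hN => ?_⟩
  set N : Fin 2 → ℝ≥0∞ := fun i => vNorm (ofExp (p i)) (fun x => f i x * w i x) with hNdef
  have key : ∀ t : Fin 2 → ℝ≥0∞, (∀ i, t i ≠ ∞) → (∀ i, N i < t i) →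
      eNorm (ofExp (tripleExp p 0)) volume
        (fun x => biMax (f 0) (f 1) x * ENNReal.ofReal (w 0 x * w 1 x)) ≤ K ^ 2 * t 0 * t 1 := by
    intro t ht hNt
    have ht0 : ∀ i, t i ≠ 0 := fun i => (zero_le.trans_lt (hNt i)).ne'
    set c : Fin 2 → ℝ := fun i => ((t i)⁻¹).toReal with hc
    have hcv : ∀ i, ENNReal.ofReal |c i| = (t i)⁻¹ := fun i => by
      rw [hc]
      dsimp only
      rw [abs_of_nonneg ENNReal.toReal_nonneg, ENNReal.ofReal_toReal (ENNReal.inv_ne_top.2 (ht0 i))]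
    have h1 := h (fun i x => c i * f i x) (fun i => (hf i).const_mul _) fun i => by
      refine le_of_eq_of_le (lintegral_congr fun x => ?_)
        (lintegral_le_one_of_eNorm_lt (hp0 i) (hNt i))
      rw [mul_assoc, abs_mul, ENNReal.ofReal_mul (abs_nonneg _), hcv, mul_comm, ← div_eq_mul_inv]
    refine eNorm_le hr0 (by simp [hK0, ht0]) ?_
    calc _ ≤ ∫⁻ x, K⁻¹ * (biMax (fun y => c 0 * f 0 y) (fun y => c 1 * f 1 y) x *
            ENNReal.ofReal (w 0 x * w 1 x)) ^ tripleExp p 0 x := by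
          refine lintegral_mono fun x => ?_
          have h2 : (K ^ 2)⁻¹ ^ tripleExp p 0 x ≤ K⁻¹ := by
            rw [ENNReal.inv_pow, ← ENNReal.rpow_natCast, ← ENNReal.rpow_mul]
            conv_rhs => rw [← ENNReal.rpow_one K⁻¹]
            refine ENNReal.rpow_le_rpow_of_exponent_ge (ENNReal.inv_le_one.2 hK1) ?_
            push_cast
            linarith [hr x]
          refine le_trans ?_ (mul_le_mul' h2 le_rfl)
          rw [← ENNReal.mul_rpow_of_nonneg _ _ (hr0 x)]
          refine ENNReal.rpow_le_rpow ?_ (hr0 x)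
          refine le_trans (le_of_eq ?_) (mul_le_mul' le_rfl
            (mul_le_mul' (biMax_mul_le (f 0) (f 1) (c 0) (c 1) x) le_rfl))
          rw [hcv, hcv, div_eq_mul_inv, ENNReal.mul_inv (Or.inr (ht 1)) (Or.inr (ht0 1)),
            ENNReal.mul_inv (Or.inr (ht 0)) (Or.inr (ht0 0))]
          ring
      _ = K⁻¹ * ∫⁻ x, (biMax (fun y => c 0 * f 0 y) (fun y => c 1 * f 1 y) x *
            ENNReal.ofReal (w 0 x * w 1 x)) ^ tripleExp p 0 x :=
          lintegral_const_mul' _ _ (ENNReal.inv_ne_top.2 hK0)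
      _ ≤ K⁻¹ * K := mul_le_mul' le_rfl (h1.trans (le_max_right _ _))
      _ = 1 := ENNReal.inv_mul_cancel hK0 hKt
  have hε : ∀ i, Filter.Tendsto (fun k : ℕ => N i + ((k : ℝ≥0∞) + 1)⁻¹) Filter.atTop
      (nhds (N i)) := by
    intro i
    have h3 : Filter.Tendsto (fun k : ℕ => ((k : ℝ≥0∞) + 1)⁻¹) Filter.atTop (nhds 0) := by
      have := (Filter.tendsto_add_atTop_iff_nat 1).2 ENNReal.tendsto_inv_nat_nhds_zero
      simpa using this
    simpa using tendsto_const_nhds.add h3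
  refine ge_of_tendsto' (ENNReal.Tendsto.mul (ENNReal.Tendsto.const_mul (hε 0)
    (Or.inr (ENNReal.pow_ne_top hKt))) (Or.inr (hN 1)) (hε 1)
    (Or.inr (ENNReal.mul_ne_top (ENNReal.pow_ne_top hKt) (hN 0)))) fun k => ?_
  refine key (fun i => N i + ((k : ℝ≥0∞) + 1)⁻¹) (fun i => ?_) fun i => ?_
  · exact ENNReal.add_ne_top.2 ⟨hN i, ENNReal.inv_ne_top.2 (by simp)⟩
  · exact ENNReal.lt_add_right (hN i) (ENNReal.inv_ne_zero.2 (by finiteness))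

/-! ### Necessity -/

lemma mul_le_of_forall_ofReal_lt {A N C : ℝ≥0∞}
    (h : ∀ t : ℝ, 0 < t → ENNReal.ofReal t < N → A * ENNReal.ofReal t ≤ C) : A * N ≤ C := by
  rw [← (Order.IsSuccPrelimit.of_dense N).sSup_Iio, ENNReal.mul_sSup]
  refine iSup₂_le fun t ht => ?_
  rw [mem_Iio] at ht
  rcases eq_or_ne t 0 with rfl | h0
  · simp
  have htt : t ≠ ∞ := ht.ne_top
  have := h t.toReal (ENNReal.toReal_pos h0 htt) (by rwa [ENNReal.ofReal_toReal htt])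
  rwa [ENNReal.ofReal_toReal htt] at this

lemma rpow_div_le_mul {W κ p : ℝ} (hW : 0 < W) (hκ : 1 ≤ κ) (hp : 1 < p) :
    W ^ (p / (p - 1)) / κ ≤ (W ^ (p / (p - 1)) / κ) ^ (1 / p) * W := by
  have hκ0 : 0 < κ := by linarith
  have hp1 : p - 1 ≠ 0 := by linarith
  have hp0 : p ≠ 0 := by linarith
  have hWq := Real.rpow_nonneg hW.le (p / (p - 1))
  have h1 : (W ^ (p / (p - 1))) ^ (1 / p) * W = W ^ (p / (p - 1)) := by
    rw [← Real.rpow_mul hW.le]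
    nth_rewrite 2 [← Real.rpow_one W]
    rw [← Real.rpow_add hW]
    congr 1
    field_simp
    ring
  rw [Real.div_rpow hWq hκ0.le, div_mul_eq_mul_div, h1]
  refine div_le_div_of_nonneg_left hWq (Real.rpow_pos_of_pos hκ0 _) ?_
  conv_rhs => rw [← Real.rpow_one κ]
  refine Real.rpow_le_rpow_of_exponent_le hκ ?_
  rw [div_le_one (by linarith)]
  exact hp.le

/-- A function which almost attains the dual norm of `w⁻¹` on a cube. -/
lemma exists_le_setLIntegral {p w : Rn n → ℝ} (hp : ∀ x, 1 < p x) (hpm : Measurable p)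
    (hwm : Measurable w) (hw : ∀ᵐ x, 0 < w x) {Q : Cube n} {t : ℝ} (ht : 0 < t)
    (h : ENNReal.ofReal t <
      vNorm (ofExp fun x => p x / (p x - 1)) (Q.toSet.indicator fun x => (w x)⁻¹)) :
    ∃ f : Rn n → ℝ, Measurable f ∧ vNorm (ofExp p) (fun x => f x * w x) ≤ 1 ∧
      ENNReal.ofReal t ≤ ∫⁻ y in Q.toSet, ENNReal.ofReal |f y| := by
  have hQ := measurableSet_toSet Q
  have hp0 : ∀ x, 0 < p x := fun x => by linarith [hp x]
  set q : Rn n → ℝ := fun x => p x / (p x - 1) with hq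
  have hq0 : ∀ x, 0 < q x := fun x => div_pos (hp0 x) (by linarith [hp x])
  have hqm : Measurable q := hpm.div (hpm.sub_const 1)
  set ψ : Rn n → ℝ := fun x => (|(w x)⁻¹| / t) ^ q x with hψ
  have hψm : Measurable ψ := (hwm.inv.abs.div_const t).pow hqm
  have hψ0 : ∀ x, 0 ≤ ψ x := fun x => by positivity
  have h1 : 1 < ∫⁻ x in Q.toSet, ENNReal.ofReal (ψ x) := by
    by_contra hcon
    refine absurd (eNorm_le (fun x => (hq0 x).le) (by simpa using ht)
      (le_of_eq_of_le ?_ (not_lt.1 hcon))) (not_le.2 h)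
    rw [← lintegral_indicator hQ]
    refine lintegral_congr fun x => ?_
    by_cases hx : x ∈ Q.toSet
    · rw [indicator_of_mem hx, indicator_of_mem hx, ← ENNReal.ofReal_div_of_pos ht,
        ENNReal.ofReal_rpow_of_nonneg (by positivity) (hq0 x).le]
    · rw [indicator_of_notMem hx, indicator_of_notMem hx]
      simp [hq0 x]
  set S : ℕ → Set (Rn n) := fun k => {x | x ∈ Q.toSet ∧ 0 < w x ∧ ψ x ≤ k} with hS
  have hSm : ∀ k, MeasurableSet (S k) := fun k =>
    hQ.inter ((measurableSet_lt measurable_const hwm).inter (measurableSet_le hψm measurable_const))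
  have hSU : (⋃ k, S k) =ᵐ[volume] Q.toSet := by
    filter_upwards [hw] with x hx
    obtain ⟨k, hk⟩ := exists_nat_ge (ψ x)
    refine propext ⟨fun h => ?_, fun h => mem_iUnion.2 ⟨k, h, hx, hk⟩⟩
    obtain ⟨j, hj⟩ := mem_iUnion.1 h
    exact hj.1
  have hmono : Monotone S := fun j k hjk x hx =>
    ⟨hx.1, hx.2.1, hx.2.2.trans (by exact_mod_cast hjk)⟩
  rw [← Measure.restrict_congr_set hSU, setLIntegral_iUnion_of_directed _ hmono.directed_le,
    lt_iSup_iff] at h1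
  obtain ⟨k, hk⟩ := h1
  set K := ∫⁻ x in S k, ENNReal.ofReal (ψ x) with hK
  have hKt : K ≠ ∞ := by
    refine ne_top_of_le_ne_top (b := ENNReal.ofReal k * volume Q.toSet)
      (ENNReal.mul_ne_top ENNReal.ofReal_ne_top (by rw [volume_toSet]; exact vol_ne_top Q)) ?_
    calc K ≤ ∫⁻ x in S k, ENNReal.ofReal k := setLIntegral_mono measurable_const fun x hx =>
          ENNReal.ofReal_le_ofReal hx.2.2
      _ = ENNReal.ofReal k * volume (S k) := setLIntegral_const _ _
      _ ≤ _ := mul_le_mul' le_rfl (measure_mono fun x hx => hx.1)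
  have hK0 : K ≠ 0 := (one_pos.trans hk).ne'
  set κ := K.toReal with hκ
  have hκ1 : 1 ≤ κ := by
    have := ENNReal.toReal_mono hKt hk.le
    simpa using this
  have hκ0 : 0 < κ := by linarith
  have hKκ : ENNReal.ofReal κ = K := ENNReal.ofReal_toReal hKt
  have hψκ : ∀ x, ENNReal.ofReal (ψ x / κ) = K⁻¹ * ENNReal.ofReal (ψ x) := fun x => by
    rw [ENNReal.ofReal_div_of_pos hκ0, hKκ, div_eq_mul_inv, mul_comm]
  have hI : ∫⁻ x in S k, ENNReal.ofReal (ψ x / κ) = 1 := by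
    simp only [hψκ]
    rw [lintegral_const_mul' _ _ (ENNReal.inv_ne_top.2 hK0), ENNReal.inv_mul_cancel hK0 hKt]
  refine ⟨(S k).indicator fun x => (ψ x / κ) ^ (1 / p x) * (w x)⁻¹, Measurable.indicator
    (((hψm.div_const κ).pow (hpm.const_div 1)).mul hwm.inv) (hSm k), ?_, ?_⟩
  · refine eNorm_le (fun x => (hp0 x).le) one_ne_zero (le_of_eq ?_)
    refine Eq.trans (lintegral_congr fun x => ?_) ((lintegral_indicator (hSm k) _).trans hI)
    dsimp only
    by_cases hx : x ∈ S k
    · have hwx := hx.2.1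
      have hq : 0 ≤ ψ x / κ := div_nonneg (hψ0 x) hκ0.le
      rw [indicator_of_mem hx, indicator_of_mem hx, div_one, mul_assoc, inv_mul_cancel₀ hwx.ne',
        mul_one, abs_of_nonneg (Real.rpow_nonneg hq _),
        ENNReal.ofReal_rpow_of_nonneg (Real.rpow_nonneg hq _) (hp0 x).le, ← Real.rpow_mul hq,
        one_div_mul_cancel (hp0 x).ne', Real.rpow_one]
    · rw [indicator_of_notMem hx, indicator_of_notMem hx]
      simp [hp0 x]
  · calc ENNReal.ofReal t = ∫⁻ x in S k, ENNReal.ofReal t * ENNReal.ofReal (ψ x / κ) := by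
          rw [lintegral_const_mul' _ _ ENNReal.ofReal_ne_top, hI, mul_one]
      _ ≤ ∫⁻ x in S k, ENNReal.ofReal |(S k).indicator
            (fun x => (ψ x / κ) ^ (1 / p x) * (w x)⁻¹) x| := by
          refine setLIntegral_mono' (hSm k) fun x hx => ?_
          have hwx := inv_pos.2 hx.2.1
          have hq : 0 ≤ ψ x / κ := div_nonneg (hψ0 x) hκ0.le
          have h2 := rpow_div_le_mul (div_pos hwx ht) hκ1 (hp x)
          rw [indicator_of_mem hx, ← ENNReal.ofReal_mul ht.le,
            abs_of_nonneg (mul_nonneg (Real.rpow_nonneg hq _) hwx.le)]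
          refine ENNReal.ofReal_le_ofReal ?_
          have h3 : ψ x = ((w x)⁻¹ / t) ^ (p x / (p x - 1)) := by
            rw [hψ]; dsimp only; rw [abs_of_pos hwx]
          rw [h3]
          refine (mul_le_mul_of_nonneg_left h2 ht.le).trans (le_of_eq ?_)
          field_simp
      _ ≤ _ := lintegral_mono_set fun x hx => hx.1

lemma le_biMax (f₁ f₂ : Rn n → ℝ) {Q : Cube n} {x : Rn n} (hx : x ∈ Q.toSet) :
    (Q.vol⁻¹ * ∫⁻ y in Q.toSet, ENNReal.ofReal |f₁ y|) *
      (Q.vol⁻¹ * ∫⁻ y in Q.toSet, ENNReal.ofReal |f₂ y|) ≤ biMax f₁ f₂ x :=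
  le_iSup₂ (f := fun (Q : Cube n) (_ : x ∈ Q.toSet) =>
    (Q.vol⁻¹ * ∫⁻ y in Q.toSet, ENNReal.ofReal |f₁ y|) *
      (Q.vol⁻¹ * ∫⁻ y in Q.toSet, ENNReal.ofReal |f₂ y|)) Q hx

lemma vNorm_mul_le_of_eNorm_biMax_le {p₁ p₂ p w₁ w₂ w : Rn n → ℝ} (hp₁ : ∀ x, 1 < p₁ x)
    (hp₂ : ∀ x, 1 < p₂ x) (hp : ∀ x, 0 ≤ p x) (hp₁m : Measurable p₁) (hp₂m : Measurable p₂)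
    (hw₁ : IsWeight w₁) (hw₂ : IsWeight w₂) (hw : ∀ x, w x = w₁ x * w₂ x) {C : ℝ≥0∞}
    (h : ∀ f₁ f₂ : Rn n → ℝ, Measurable f₁ → Measurable f₂ →
      vNorm (ofExp p₁) (fun x => f₁ x * w₁ x) ≠ ∞ →
      vNorm (ofExp p₂) (fun x => f₂ x * w₂ x) ≠ ∞ →
      eNorm (ofExp p) volume (fun x => biMax f₁ f₂ x * ENNReal.ofReal (w x)) ≤
        C * vNorm (ofExp p₁) (fun x => f₁ x * w₁ x) *
          vNorm (ofExp p₂) (fun x => f₂ x * w₂ x)) (Q : Cube n) :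
    Q.vol⁻¹ ^ 2 * vNorm (ofExp p) (Q.toSet.indicator w) *
      vNorm (conjExp p₁) (Q.toSet.indicator fun x => (w₁ x)⁻¹) *
      vNorm (conjExp p₂) (Q.toSet.indicator fun x => (w₂ x)⁻¹) ≤ C := by
  rw [conjExp_eq hp₁, conjExp_eq hp₂]
  refine mul_le_of_forall_ofReal_lt fun t₂ ht₂ h₂ => ?_
  rw [mul_right_comm]
  refine mul_le_of_forall_ofReal_lt fun t₁ ht₁ h₁ => ?_
  obtain ⟨f₁, hf₁m, hf₁, hf₁t⟩ := exists_le_setLIntegral hp₁ hp₁m hw₁.1 hw₁.2 ht₁ h₁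
  obtain ⟨f₂, hf₂m, hf₂, hf₂t⟩ := exists_le_setLIntegral hp₂ hp₂m hw₂.1 hw₂.2 ht₂ h₂
  have hM := h f₁ f₂ hf₁m hf₂m (ne_top_of_le_ne_top one_ne_top hf₁)
    (ne_top_of_le_ne_top one_ne_top hf₂)
  have hv0 : Q.vol⁻¹ ≠ 0 := ENNReal.inv_ne_zero.2 (vol_ne_top Q)
  have hvt : Q.vol⁻¹ ≠ ∞ := ENNReal.inv_ne_top.2 (vol_ne_zero Q)
  calc _ = Q.vol⁻¹ * ENNReal.ofReal t₁ * (Q.vol⁻¹ * ENNReal.ofReal t₂) *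
        vNorm (ofExp p) (Q.toSet.indicator w) := by ring
    _ ≤ eNorm (ofExp p) volume (fun x => biMax f₁ f₂ x * ENNReal.ofReal (w x)) := by
        refine mul_eNorm_le hp (by simp [hv0, ht₁, ht₂]) (by finiteness) ?_
        filter_upwards [hw₁.2, hw₂.2] with x hx₁ hx₂
        by_cases hx : x ∈ Q.toSet
        · rw [indicator_of_mem hx, hw, abs_of_pos (mul_pos hx₁ hx₂)]
          exact mul_le_mul' ((mul_le_mul' (mul_le_mul' le_rfl hf₁t)
            (mul_le_mul' le_rfl hf₂t)).trans (le_biMax f₁ f₂ hx)) le_rfl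
        · simp [indicator_of_notMem hx]
    _ ≤ C * 1 * 1 := hM.trans (mul_le_mul' (mul_le_mul' le_rfl hf₁) hf₂)
    _ = C := by simp

end BilinearMaximal

/-- the bilinear maximal operator satisfies the weighted norm inequality
on variable Lebesgue spaces iff `(w₁,w₂,w) ∈ A_{p⃗(·)}`. -/
theorem statement0 {n : ℕ} (p₁ p₂ p w₁ w₂ w : Rn n → ℝ)
    (hp₁m : Measurable p₁) (hp₂m : Measurable p₂)
    (hp₁1 : ∀ x, 1 ≤ p₁ x) (hp₂1 : ∀ x, 1 ≤ p₂ x)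
    (hp₁b : ∃ a b : ℝ, 1 < a ∧ ∀ᵐ x ∂(volume : Measure (Rn n)), a ≤ p₁ x ∧ p₁ x ≤ b)
    (hp₂b : ∃ a b : ℝ, 1 < a ∧ ∀ᵐ x ∂(volume : Measure (Rn n)), a ≤ p₂ x ∧ p₂ x ≤ b)
    (hp₁LH : LH p₁) (hp₂LH : LH p₂)
    (hp : ∀ x, 1 / p x = 1 / p₁ x + 1 / p₂ x)
    (hw₁ : IsWeight w₁) (hw₂ : IsWeight w₂)
    (hw : ∀ x, w x = w₁ x * w₂ x) :
    (∃ C : ℝ≥0∞, C ≠ ∞ ∧ ∀ f₁ f₂ : Rn n → ℝ, Measurable f₁ → Measurable f₂ →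
        vNorm (ofExp p₁) (fun x => f₁ x * w₁ x) ≠ ∞ →
        vNorm (ofExp p₂) (fun x => f₂ x * w₂ x) ≠ ∞ →
        eNorm (ofExp p) volume (fun x => biMax f₁ f₂ x * ENNReal.ofReal (w x)) ≤
          C * vNorm (ofExp p₁) (fun x => f₁ x * w₁ x) *
            vNorm (ofExp p₂) (fun x => f₂ x * w₂ x)) ↔
      ApVec p₁ p₂ p w₁ w₂ w := by
  obtain ⟨a₁, b₁, ha₁, hab₁⟩ := hp₁b
  obtain ⟨a₂, b₂, ha₂, hab₂⟩ := hp₂b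
  have hB₁ := BilinearMaximal.LH0.bounds hp₁LH.1 hp₁1 ha₁ hab₁
  have hB₂ := BilinearMaximal.LH0.bounds hp₂LH.1 hp₂1 ha₂ hab₂
  have h₁ : ∀ x, 1 < p₁ x := fun x => ha₁.trans_le (hB₁ x).1
  have h₂ : ∀ x, 1 < p₂ x := fun x => ha₂.trans_le (hB₂ x).1
  have hp0 : BilinearMaximal.tripleExp ![p₁, p₂] 0 = p := by
    ext x
    change 1 / (1 / p₁ x + 1 / p₂ x) = p x
    rw [← hp, one_div_one_div]
  have hall : ∀ i x, 1 < (![p₁, p₂] : Fin 2 → Rn n → ℝ) i x := Fin.forall_fin_two.2 ⟨h₁, h₂⟩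
  constructor
  · rintro ⟨C, hC, h⟩
    have hp' : ∀ x, 0 ≤ p x := fun x => by
      have := BilinearMaximal.half_le_tripleExp_zero hall x
      rw [hp0] at this
      linarith
    exact ⟨C, hC, BilinearMaximal.vNorm_mul_le_of_eNorm_biMax_le h₁ h₂ hp' hp₁m hp₂m hw₁ hw₂ hw h⟩
  · rintro ⟨C, hC, hA⟩
    have hw0 : BilinearMaximal.tripleWeight ![w₁, w₂] 0 = w := funext fun x => (hw x).symm
    obtain ⟨K, hK, h⟩ := BilinearMaximal.exists_eNorm_biMax_le (p := ![p₁, p₂]) (w := ![w₁, w₂])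
      (a := min a₁ a₂) (b := max b₁ b₂) (lt_min ha₁ ha₂)
      (Fin.forall_fin_two.2
        ⟨fun x => ⟨(min_le_left _ _).trans (hB₁ x).1, (hB₁ x).2.trans (le_max_left _ _)⟩,
          fun x => ⟨(min_le_right _ _).trans (hB₂ x).1, (hB₂ x).2.trans (le_max_right _ _)⟩⟩)
      (Fin.forall_fin_two.2 ⟨hp₁m, hp₂m⟩) (Fin.forall_fin_two.2 ⟨hp₁LH, hp₂LH⟩)
      (Fin.forall_fin_two.2 ⟨hw₁.1, hw₂.1⟩) (Fin.forall_fin_two.2 ⟨hw₁.2, hw₂.2⟩)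
      ⟨C, hC, fun Q => by
        have hQ := hA Q
        have hv0 := BilinearMaximal.vol_ne_zero Q
        have hvt := BilinearMaximal.vol_ne_top Q
        have e₁ : conjExp p₁ = ofExp (BilinearMaximal.tripleExp ![p₁, p₂] (Fin.succ 0)) := by
          rw [BilinearMaximal.conjExp_eq h₁]
          exact congrArg ofExp (funext fun x =>
            (BilinearMaximal.tripleExp_succ (hall 0 x)).symm)
        have e₂ : conjExp p₂ = ofExp (BilinearMaximal.tripleExp ![p₁, p₂] (Fin.succ 1)) := by
          rw [BilinearMaximal.conjExp_eq h₂]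
          exact congrArg ofExp (funext fun x =>
            (BilinearMaximal.tripleExp_succ (hall 1 x)).symm)
        rw [e₁, e₂, ← hp0, ← hw0, mul_assoc, mul_assoc, ← ENNReal.inv_pow, mul_comm,
          ← div_eq_mul_inv, ENNReal.div_le_iff (pow_ne_zero 2 hv0) (ENNReal.pow_ne_top hvt)] at hQ
        rw [Fin.prod_univ_succ, Fin.prod_univ_two]
        exact hQ⟩
    refine ⟨K, hK, fun f₁ f₂ hf₁ hf₂ hN₁ hN₂ => ?_⟩
    have := h ![f₁, f₂] (Fin.forall_fin_two.2 ⟨hf₁, hf₂⟩) (Fin.forall_fin_two.2 ⟨hN₁, hN₂⟩)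
    rw [hp0] at this
    simp only [hw]
    exact this
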